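/- Let F be a field and Ω a connected quiver. Then the following are equivalent: (a) every representation of Ω over F is an internal direct sum of a family of indecomposable subrepresentations, any two such decompositions of a given representation admit a bijection between their index sets matching isomorphic summands, and any two indecomposable representations whose vertex spaces have equal dimension at every vertex are isomorphic; (b) Ω is eventually outward and the Tits form of Ω is positive definite on the root space. Moreover, when these hold, every indecomposable representation of Ω is FLEI, and the map sending (the isomorphism class of) an indecomposable representation to its dimension vector is a bijection onto the set of positive roots of Ω, i.e. the elements n of the root space with n_i ≥ 0 for all vertices i and ⟨n,n⟩_Ω = 1. -/

import Mathlib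

/-- A quiver: a set of vertices, a set of arrows, with source and target maps. -/
structure Quiv : Type 1 where
  V : Type
  A : Type
  s : A → V
  t : A → V

/-- A representation of a quiver over a field `F`. -/
structure QRep (F : Type) [Field F] (Q : Quiv) : Type 1 where
  M : Q.V → Type
  [acg : ∀ i, AddCommGroup (M i)]
  [mod : ∀ i, Module F (M i)]
  map : ∀ a : Q.A, M (Q.s a) →ₗ[F] M (Q.t a)

attribute [instance] QRep.acg QRep.mod

namespace QRep

variable {F : Type} [Field F] {Q : Quiv}

/-- A representation is nonzero if some vertex space has a nonzero vector. -/
def Nonzero (V : QRep F Q) : Prop := ∃ i, ∃ x : V.M i, x ≠ 0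

/-- A morphism of representations. -/
structure Hom (V W : QRep F Q) : Type where
  app : ∀ i, V.M i →ₗ[F] W.M i
  comm : ∀ a : Q.A, (W.map a).comp (app (Q.s a)) = (app (Q.t a)).comp (V.map a)

/-- A morphism is an isomorphism iff it is bijective at each vertex. -/
def Hom.IsIso {V W : QRep F Q} (f : Hom V W) : Prop := ∀ i, Function.Bijective (f.app i)

/-- Two representations are isomorphic. -/
def Iso (V W : QRep F Q) : Prop := ∃ f : Hom V W, f.IsIso

/-- The (external) direct sum of two representations. -/
def dsum (V W : QRep F Q) : QRep F Q where
  M i := V.M i × W.M i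
  map a := (V.map a).prodMap (W.map a)

/-- A representation is indecomposable if it is nonzero and not isomorphic to a direct
sum of two nonzero representations. -/
def Indec (V : QRep F Q) : Prop :=
  V.Nonzero ∧ ∀ A B : QRep F Q, A.Nonzero → B.Nonzero → ¬ Iso V (dsum A B)

/-- FLEI: locally finite-dimensional, and all but finitely many arrow maps are
isomorphisms. -/
def IsFLEI (V : QRep F Q) : Prop :=
  (∀ i, FiniteDimensional F (V.M i)) ∧ {a : Q.A | ¬ Function.Bijective (V.map a)}.Finite

end QRep

/-- A subrepresentation: a subspace at each vertex, stable under the arrow maps. -/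
structure Subrep {F : Type} [Field F] {Q : Quiv} (V : QRep F Q) : Type where
  S : ∀ i, Submodule F (V.M i)
  stable : ∀ a : Q.A, ∀ x ∈ S (Q.s a), V.map a x ∈ S (Q.t a)

namespace Subrep

variable {F : Type} [Field F] {Q : Quiv} {V : QRep F Q}

/-- A subrepresentation, viewed as a representation in its own right. -/
def toRep (W : Subrep V) : QRep F Q where
  M i := ↥(W.S i)
  map a := (V.map a).restrict (W.stable a)

/-- The quotient of a representation by a subrepresentation. -/
def quot (W : Subrep V) : QRep F Q where
  M i := V.M i ⧸ W.S i
  map a := Submodule.mapQ _ _ (V.map a) (fun x hx => W.stable a x hx)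

end Subrep
/-- Adjacency in the underlying graph of a quiver. -/
def Quiv.Adj (Q : Quiv) (i j : Q.V) : Prop :=
  ∃ a : Q.A, (Q.s a = i ∧ Q.t a = j) ∨ (Q.s a = j ∧ Q.t a = i)

/-- The underlying graph is connected. -/
def Quiv.Connected (Q : Quiv) : Prop :=
  ∀ i j : Q.V, Relation.ReflTransGen Q.Adj i j

/-- Source of an oriented edge-traversal (arrow plus direction of traversal). -/
def Quiv.esrc (Q : Quiv) (p : Q.A × Bool) : Q.V := if p.2 then Q.s p.1 else Q.t p.1

/-- Target of an oriented edge-traversal. -/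
def Quiv.etgt (Q : Quiv) (p : Q.A × Bool) : Q.V := if p.2 then Q.t p.1 else Q.s p.1

/-- `e 0, …, e (n-1)` is a cycle: a closed walk of positive length in the underlying
graph traversing no edge twice. -/
def Quiv.IsCycle (Q : Quiv) (n : ℕ) (e : ℕ → Q.A × Bool) : Prop :=
  0 < n ∧ (∀ k < n, Q.etgt (e k) = Q.esrc (e ((k + 1) % n))) ∧
    (∀ j < n, ∀ k < n, (e j).1 = (e k).1 → j = k)

/-- The quiver has no cycles in its underlying graph. -/
def Quiv.NoCycles (Q : Quiv) : Prop := ¬ ∃ (n : ℕ) (e : ℕ → Q.A × Bool), Q.IsCycle n e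

/-- A tree quiver: connected underlying graph with no cycles. -/
def Quiv.IsTree (Q : Quiv) : Prop := Q.Connected ∧ Q.NoCycles
/-- A journey in a quiver: a finite or infinite sequence of pairwise distinct vertices
`vert 0, vert 1, …` (up to index `len`, which may be `⊤`), consecutive vertices being
joined by an arrow (in either direction). -/
structure Journey (Q : Quiv) : Type where
  len : ℕ∞
  vert : ℕ → Q.V
  edge : ∀ k : ℕ, (k : ℕ∞) < len → Q.A
  inj : ∀ m n : ℕ, (m : ℕ∞) ≤ len → (n : ℕ∞) ≤ len → vert m = vert n → m = n
  adj : ∀ (k : ℕ) (h : (k : ℕ∞) < len),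
    (Q.s (edge k h) = vert k ∧ Q.t (edge k h) = vert (k + 1)) ∨
    (Q.s (edge k h) = vert (k + 1) ∧ Q.t (edge k h) = vert k)

/-- A quiver is eventually outward if every journey contains only finitely many arrows
pointing towards the start of the journey. -/
def Quiv.EventuallyOutward (Q : Quiv) : Prop :=
  ∀ j : Journey Q,
    {k : ℕ | ∃ h : (k : ℕ∞) < j.len,
      Q.s (j.edge k h) = j.vert (k + 1) ∧ Q.t (j.edge k h) = j.vert k}.Finite

/-- A quiver is finitely branching if it is a union of finitely many journeys. -/
def Quiv.FinitelyBranching (Q : Quiv) : Prop :=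
  ∃ (n : ℕ) (js : Fin n → Journey Q),
    (∀ v : Q.V, ∃ (m : Fin n) (k : ℕ), (k : ℕ∞) ≤ (js m).len ∧ (js m).vert k = v) ∧
    (∀ a : Q.A, ∃ (m : Fin n) (k : ℕ) (h : (k : ℕ∞) < (js m).len), (js m).edge k h = a)
/-- A family of subrepresentations is an internal direct sum decomposition if at each
vertex the subspaces are independent and sum to the whole space. -/
def IsDecomp {F : Type} [Field F] {Q : Quiv} {V : QRep F Q} {ι : Type}
    (W : ι → Subrep V) : Prop :=
  (∀ i : Q.V, ∀ j : ι, Disjoint ((W j).S i) (⨆ (k : ι) (_ : k ≠ j), (W k).S i)) ∧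
  (∀ i : Q.V, (⨆ j : ι, (W j).S i) = ⊤)
/-- A subquiver: a set of vertices and a set of arrows whose endpoints lie in it. -/
structure Subquiv (Q : Quiv) : Type where
  verts : Set Q.V
  arrows : Set Q.A
  src_mem : ∀ a ∈ arrows, Q.s a ∈ verts
  tgt_mem : ∀ a ∈ arrows, Q.t a ∈ verts

namespace Subquiv

variable {Q : Quiv}

/-- A subquiver is finite if it has finitely many vertices and arrows. -/
def Finite (S : Subquiv Q) : Prop := S.verts.Finite ∧ S.arrows.Finite

/-- Containment of subquivers. -/
def le (S T : Subquiv Q) : Prop := S.verts ⊆ T.verts ∧ S.arrows ⊆ T.arrows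

/-- Adjacency within a subquiver. -/
def Adj (S : Subquiv Q) (i j : Q.V) : Prop :=
  ∃ a ∈ S.arrows, (Q.s a = i ∧ Q.t a = j) ∨ (Q.s a = j ∧ Q.t a = i)

/-- A subquiver is IC ("injective on components") if no connected component of `Ω`
contains two distinct connected components of the subquiver; equivalently, any two
vertices of the subquiver joined by a walk in `Ω` are joined by a walk in the
subquiver. -/
def IsIC (S : Subquiv Q) : Prop :=
  ∀ i ∈ S.verts, ∀ j ∈ S.verts,
    Relation.ReflTransGen Q.Adj i j → Relation.ReflTransGen S.Adj i j

/-- A subquiver regarded as a quiver in its own right. -/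
def toQuiv (S : Subquiv Q) : Quiv where
  V := ↥S.verts
  A := ↥S.arrows
  s a := ⟨Q.s a.1, S.src_mem a.1 a.2⟩
  t a := ⟨Q.t a.1, S.tgt_mem a.1 a.2⟩

end Subquiv

/-- The directed set of finite IC subquivers of `Q`, preordered by inclusion. -/
def FinICSub (Q : Quiv) : Type := {S : Subquiv Q // S.Finite ∧ S.IsIC}

instance (Q : Quiv) : Preorder (FinICSub Q) where
  le S T := S.1.le T.1
  le_refl S := ⟨subset_rfl, subset_rfl⟩
  le_trans S T U h h' := ⟨h.1.trans h'.1, h.2.trans h'.2⟩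

/-- The Tits form of `n` on a (finite) subquiver:
`Σ_{i ∈ Ω'₀} n_i² − Σ_{a ∈ Ω'₁} n_{s(a)} n_{t(a)}`. -/
noncomputable def tits (Q : Quiv) (n : Q.V → ℤ) (S : Subquiv Q) : ℤ :=
  (∑ᶠ i ∈ S.verts, n i ^ 2) - ∑ᶠ a ∈ S.arrows, n (Q.s a) * n (Q.t a)

/-- Membership of `n` in the root space of `Q`: `n` is constant along all but finitely
many arrows. -/
def IsRoot (Q : Quiv) (n : Q.V → ℤ) : Prop := {a : Q.A | n (Q.s a) ≠ n (Q.t a)}.Finite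

/-- The support of `n`: the full subquiver on the vertices where `n` is nonzero. -/
def suppQuiv (Q : Quiv) (n : Q.V → ℤ) : Subquiv Q where
  verts := {i | n i ≠ 0}
  arrows := {a | n (Q.s a) ≠ 0 ∧ n (Q.t a) ≠ 0}
  src_mem _ ha := ha.1
  tgt_mem _ ha := ha.2

/-- The net of values of the Tits form of `n` over the directed set of finite IC
subquivers, viewed in the extended reals `ℤ ∪ {±∞} ⊆ [-∞,∞]`. -/
noncomputable def titsNet (Q : Quiv) (n : Q.V → ℤ) : FinICSub Q → EReal :=
  fun S => (((tits Q n S.1 : ℤ) : ℝ) : EReal)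

/-- A quiver has finitely many connected components. -/
def Quiv.ComponentsFinite (Q : Quiv) : Prop :=
  ∃ s : Set Q.V, s.Finite ∧ ∀ v : Q.V, ∃ w ∈ s, Relation.ReflTransGen Q.Adj w v

/-- A quiver has finitely many cycles: the set of edge sets of cycles is finite. -/
def Quiv.CyclesFinite (Q : Quiv) : Prop :=
  {s : Set Q.A | ∃ (n : ℕ) (e : ℕ → Q.A × Bool),
    Q.IsCycle n e ∧ s = {a | ∃ k < n, a = (e k).1}}.Finite

/-- The representation theory of `Ω` over `F` is of unique type and infinite
Krull–Schmidt: every representation is an internal direct sum of indecomposable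
subrepresentations, such decompositions are unique up to a bijection matching isomorphic
summands, and indecomposables with the same dimension at every vertex are isomorphic. -/
def KSUniqueType (F : Type) [Field F] (Q : Quiv) : Prop :=
  (∀ V : QRep F Q, ∃ (J : Type) (W : J → Subrep V),
    (∀ j, (W j).toRep.Indec) ∧ IsDecomp W) ∧
  (∀ (V : QRep F Q) (J J' : Type) (W : J → Subrep V) (W' : J' → Subrep V),
    (∀ j, (W j).toRep.Indec) → IsDecomp W →
    (∀ j, (W' j).toRep.Indec) → IsDecomp W' →
    ∃ e : J ≃ J', ∀ j, QRep.Iso (W j).toRep (W' (e j)).toRep) ∧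
  (∀ V W : QRep F Q, V.Indec → W.Indec →
    (∀ i : Q.V, Module.rank F (V.M i) = Module.rank F (W.M i)) → QRep.Iso V W)

/-- The Tits form of `Ω` is positive definite on the root space: every nonzero element of
the root space whose Tits form converges has a positive limit (a positive integer or
`+∞`). -/
def PosDefTits (Q : Quiv) : Prop :=
  ∀ n : Q.V → ℤ, IsRoot Q n → (∃ i, n i ≠ 0) →
    ∀ L : EReal, Filter.Tendsto (titsNet Q n) Filter.atTop (nhds L) → 0 < L

/-- `n` is a positive root of `Ω`: an element of the root space, nonnegative at each
vertex, with `⟨n,n⟩_Ω = 1`. -/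
def IsPosRoot (Q : Quiv) (n : Q.V → ℤ) : Prop :=
  IsRoot Q n ∧ (∀ i, 0 ≤ n i) ∧
    Filter.Tendsto (titsNet Q n) Filter.atTop (nhds (((1 : ℤ) : ℝ) : EReal))

/-- The dimension vector of a representation. -/
noncomputable def dimvec (F : Type) [Field F] {Q : Quiv} (V : QRep F Q) : Q.V → ℤ :=
  fun i => (Module.finrank F (V.M i) : ℤ)

namespace QRep

variable {F : Type} [Field F] {Q : Quiv}

/-- The map whose kernel is `Hom(X, Y)` and whose cokernel is `Ext(X, Y)`. -/
def dmap (X Y : QRep F Q) :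
    (∀ i, X.M i →ₗ[F] Y.M i) →ₗ[F] (∀ a, X.M (Q.s a) →ₗ[F] Y.M (Q.t a)) where
  toFun φ a := (Y.map a).comp (φ (Q.s a)) - (φ (Q.t a)).comp (X.map a)
  map_add' φ ψ := by
    funext a; ext x; simp; abel
  map_smul' c φ := by
    funext a; ext x; simp [smul_sub]

/-- The space of morphisms between two representations. -/
def HomS (X Y : QRep F Q) : Submodule F (∀ i, X.M i →ₗ[F] Y.M i) := LinearMap.ker (dmap X Y)

/-- Morphisms, as elements of `HomS`. -/
abbrev Mor (X Y : QRep F Q) := ↥(HomS X Y)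

variable {X Y Z W : QRep F Q}

theorem dmap_apply (φ : ∀ i, X.M i →ₗ[F] Y.M i) (a : Q.A) (x : X.M (Q.s a)) :
    dmap X Y φ a x = Y.map a (φ (Q.s a) x) - φ (Q.t a) (X.map a x) := rfl

theorem mem_HomS {φ : ∀ i, X.M i →ₗ[F] Y.M i} :
    φ ∈ HomS X Y ↔ ∀ a x, Y.map a (φ (Q.s a) x) = φ (Q.t a) (X.map a x) := by
  unfold HomS
  rw [LinearMap.mem_ker]
  constructor
  · intro h a x
    have := congrArg (fun ψ => ψ a x) h
    simpa [dmap_apply, sub_eq_zero] using this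
  · intro h
    funext a; ext x
    rw [dmap_apply, h a x, sub_self]; rfl

namespace Mor

theorem comm (f : Mor X Y) (a : Q.A) (x : X.M (Q.s a)) :
    Y.map a (f.1 (Q.s a) x) = f.1 (Q.t a) (X.map a x) := mem_HomS.1 f.2 a x

theorem ext' {f g : Mor X Y} (h : ∀ i x, f.1 i x = g.1 i x) : f = g := by
  apply Subtype.ext; funext i; ext x; exact h i x

/-- Identity morphism. -/
def id (X : QRep F Q) : Mor X X := ⟨fun _ => LinearMap.id, mem_HomS.2 fun _ _ => rfl⟩

/-- Composition of morphisms. -/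
def comp (g : Mor Y Z) (f : Mor X Y) : Mor X Z :=
  ⟨fun i => (g.1 i).comp (f.1 i), mem_HomS.2 fun a x => by simp [g.comm, f.comm]⟩

@[simp] theorem id_app (i) (x : X.M i) : (id X).1 i x = x := rfl
@[simp] theorem comp_app (g : Mor Y Z) (f : Mor X Y) (i) (x : X.M i) :
    (comp g f).1 i x = g.1 i (f.1 i x) := rfl
@[simp] theorem add_app (f g : Mor X Y) (i) (x : X.M i) : (f + g).1 i x = f.1 i x + g.1 i x := rfl
@[simp] theorem sub_app (f g : Mor X Y) (i) (x : X.M i) : (f - g).1 i x = f.1 i x - g.1 i x := rfl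
@[simp] theorem smul_app (c : F) (f : Mor X Y) (i) (x : X.M i) : (c • f).1 i x = c • f.1 i x := rfl
@[simp] theorem zero_app (i) (x : X.M i) : (0 : Mor X Y).1 i x = 0 := rfl

theorem eq_zero_iff {f : Mor X Y} : f = 0 ↔ ∀ i x, f.1 i x = 0 :=
  ⟨fun h i x => by rw [h]; rfl, fun h => ext' fun i x => by simp [h]⟩

theorem ne_zero_iff {f : Mor X Y} : f ≠ 0 ↔ ∃ i x, f.1 i x ≠ 0 := by
  rw [Ne, eq_zero_iff]; push Not; rfl

/-- A morphism which is bijective at each vertex. -/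
def Bij (f : Mor X Y) : Prop := ∀ i, Function.Bijective (f.1 i)

/-- Injective at each vertex. -/
def Inj (f : Mor X Y) : Prop := ∀ i, Function.Injective (f.1 i)

/-- Surjective at each vertex. -/
def Surj (f : Mor X Y) : Prop := ∀ i, Function.Surjective (f.1 i)

/-- The inverse of a bijective morphism. -/
noncomputable def inv (f : Mor X Y) (h : f.Bij) : Mor Y X :=
  ⟨fun i => ((LinearEquiv.ofBijective (f.1 i) (h i)).symm : Y.M i →ₗ[F] X.M i), by
    refine mem_HomS.2 fun a y => ?_
    apply (h _).1
    rw [← f.comm]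
    simp only [LinearEquiv.coe_coe]
    have h1 := (LinearEquiv.ofBijective (f.1 (Q.t a)) (h _)).apply_symm_apply (Y.map a y)
    have h2 := (LinearEquiv.ofBijective (f.1 (Q.s a)) (h _)).apply_symm_apply y
    simp only [LinearEquiv.ofBijective_apply] at h1 h2
    rw [h1, h2]⟩

@[simp] theorem inv_app_right (f : Mor X Y) (h : f.Bij) (i) (y : Y.M i) :
    f.1 i ((f.inv h).1 i y) = y :=
  (LinearEquiv.ofBijective (f.1 i) (h i)).apply_symm_apply y

@[simp] theorem inv_app_left (f : Mor X Y) (h : f.Bij) (i) (x : X.M i) :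
    (f.inv h).1 i (f.1 i x) = x :=
  (LinearEquiv.ofBijective (f.1 i) (h i)).symm_apply_apply x

theorem inv_bij (f : Mor X Y) (h : f.Bij) : (f.inv h).Bij := fun i =>
  Function.bijective_iff_has_inverse.2 ⟨f.1 i, fun y => by simp, fun x => by simp⟩

theorem comp_bij {g : Mor Y Z} {f : Mor X Y} (hg : g.Bij) (hf : f.Bij) : (comp g f).Bij :=
  fun i => (hg i).comp (hf i)

/-- Composition as a bilinear map. -/
def compL (X Y Z : QRep F Q) : Mor Y Z →ₗ[F] Mor X Y →ₗ[F] Mor X Z :=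
  LinearMap.mk₂ F comp (fun _ _ _ => rfl) (fun _ _ _ => rfl)
    (fun g f f' => ext' fun i x => by simp) (fun c g f => ext' fun i x => by simp)

@[simp] theorem compL_apply (g : Mor Y Z) (f : Mor X Y) : compL X Y Z g f = comp g f := rfl

end Mor

theorem iso_iff : Iso X Y ↔ ∃ f : Mor X Y, f.Bij := by
  constructor
  · rintro ⟨f, hf⟩
    exact ⟨⟨f.app, mem_HomS.2 fun a x => LinearMap.congr_fun (f.comm a) x⟩, hf⟩
  · rintro ⟨f, hf⟩
    exact ⟨⟨f.1, fun a => LinearMap.ext fun x => f.comm a x⟩, hf⟩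

theorem Iso.refl (X : QRep F Q) : Iso X X :=
  iso_iff.2 ⟨Mor.id X, fun _ => Function.bijective_id⟩

theorem Iso.symm (h : Iso X Y) : Iso Y X := by
  obtain ⟨f, hf⟩ := iso_iff.1 h
  exact iso_iff.2 ⟨f.inv hf, f.inv_bij hf⟩

theorem Iso.trans (h : Iso X Y) (h' : Iso Y Z) : Iso X Z := by
  obtain ⟨f, hf⟩ := iso_iff.1 h
  obtain ⟨g, hg⟩ := iso_iff.1 h'
  exact iso_iff.2 ⟨Mor.comp g f, Mor.comp_bij hg hf⟩

theorem Iso.nonzero (h : Iso X Y) (hX : X.Nonzero) : Y.Nonzero := by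
  obtain ⟨f, hf⟩ := iso_iff.1 h
  obtain ⟨i, x, hx⟩ := hX
  exact ⟨i, f.1 i x, fun h0 => hx ((hf i).1 (by simpa using h0))⟩

theorem Iso.finrank_eq (h : Iso X Y) (i : Q.V) :
    Module.finrank F (X.M i) = Module.finrank F (Y.M i) := by
  obtain ⟨f, hf⟩ := iso_iff.1 h
  exact (LinearEquiv.ofBijective (f.1 i) (hf i)).finrank_eq

theorem Iso.indec (h : Iso X Y) (hX : X.Indec) : Y.Indec :=
  ⟨h.nonzero hX.1, fun A B hA hB hY => hX.2 A B hA hB (h.trans hY)⟩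

theorem id_ne_zero (h : X.Nonzero) : Mor.id X ≠ 0 := by
  obtain ⟨i, x, hx⟩ := h
  exact Mor.ne_zero_iff.2 ⟨i, x, hx⟩

end QRep

namespace Subrep

open QRep

variable {F : Type} [Field F] {Q : Quiv} {X Y Z : QRep F Q}

@[ext] theorem ext' {W W' : Subrep X} (h : ∀ i, W.S i = W'.S i) : W = W' := by
  cases W; cases W'; congr; funext i; exact h i

instance : PartialOrder (Subrep X) :=
  PartialOrder.lift Subrep.S (fun _ _ h => Subrep.ext' (fun i => congrFun h i))

/-- Inclusion of a subrepresentation. -/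
def incl (W : Subrep X) : Mor W.toRep X :=
  ⟨fun i => (W.S i).subtype, mem_HomS.2 fun _ _ => rfl⟩

theorem incl_app (W : Subrep X) (i) (x : W.toRep.M i) : W.incl.1 i x = x.1 := rfl

theorem incl_inj (W : Subrep X) : W.incl.Inj := fun _ => Subtype.val_injective

/-- Corestriction of a morphism to a subrepresentation containing its image. -/
def cod (W : Subrep X) (f : Mor Y X) (h : ∀ i y, f.1 i y ∈ W.S i) : Mor Y W.toRep :=
  ⟨fun i => (f.1 i).codRestrict (W.S i) (h i), mem_HomS.2 fun a x => Subtype.ext (f.comm a x)⟩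

/-- The quotient map. -/
def quo (W : Subrep X) : Mor X W.quot :=
  ⟨fun i => (W.S i).mkQ, mem_HomS.2 fun _ _ => rfl⟩

theorem quo_surj (W : Subrep X) : W.quo.Surj := fun _ => Submodule.mkQ_surjective _

theorem quo_eq_zero (W : Subrep X) (i) (x : X.M i) : W.quo.1 i x = 0 ↔ x ∈ W.S i :=
  Submodule.Quotient.mk_eq_zero _

/-- Factor a morphism through a quotient. -/
def desc (W : Subrep X) (f : Mor X Y) (h : ∀ i, ∀ x ∈ W.S i, f.1 i x = 0) : Mor W.quot Y :=
  ⟨fun i => (W.S i).liftQ (f.1 i) (fun x hx => h i x hx), by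
    refine mem_HomS.2 fun a x => ?_
    obtain ⟨x, rfl⟩ := W.quo_surj _ x
    exact f.comm a x⟩

theorem desc_quo (W : Subrep X) (f : Mor X Y) (h : ∀ i, ∀ x ∈ W.S i, f.1 i x = 0) (i) (x : X.M i) :
    (W.desc f h).1 i (W.quo.1 i x) = f.1 i x := rfl

end Subrep

namespace QRep

variable {F : Type} [Field F] {Q : Quiv} {X Y Z : QRep F Q}

/-- The kernel of a morphism. -/
def Mor.kerS (f : Mor X Y) : Subrep X where
  S i := LinearMap.ker (f.1 i)
  stable a x hx := by
    rw [LinearMap.mem_ker] at *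
    rw [← f.comm, hx, map_zero]

/-- The image of a morphism. -/
def Mor.rangeS (f : Mor X Y) : Subrep Y where
  S i := LinearMap.range (f.1 i)
  stable a y hy := by
    obtain ⟨x, rfl⟩ := hy
    exact ⟨X.map a x, (f.comm a x).symm⟩

theorem Mor.mem_kerS {f : Mor X Y} {i} {x : X.M i} : x ∈ f.kerS.S i ↔ f.1 i x = 0 :=
  LinearMap.mem_ker

/-- The surjection onto the image. -/
def Mor.toRange (f : Mor X Y) : Mor X f.rangeS.toRep :=
  f.rangeS.cod f (fun _ x => ⟨x, rfl⟩)

theorem Mor.toRange_surj (f : Mor X Y) : f.toRange.Surj := by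
  rintro i ⟨y, x, rfl⟩
  exact ⟨x, rfl⟩

theorem Mor.range_nonzero {f : Mor X Y} (h : f ≠ 0) : f.rangeS.toRep.Nonzero := by
  obtain ⟨i, x, hx⟩ := Mor.ne_zero_iff.1 h
  exact ⟨i, ⟨f.1 i x, x, rfl⟩, fun h0 => hx (congrArg Subtype.val h0)⟩

theorem Mor.bij_iff {f : Mor X Y} : f.Bij ↔ f.Inj ∧ f.Surj :=
  ⟨fun h => ⟨fun i => (h i).1, fun i => (h i).2⟩, fun h i => ⟨h.1 i, h.2 i⟩⟩

/-- A retract of an indecomposable is isomorphic to it or zero. -/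
theorem Indec.idem (h : Y.Indec) (e : Mor Y Y) (he : Mor.comp e e = e) :
    e = 0 ∨ e = Mor.id Y := by
  by_contra! hcon
  have hap : ∀ i x, e.1 i (e.1 i x) = e.1 i x := fun i x => by
    rw [← Mor.comp_app, he]
  refine h.2 e.rangeS.toRep e.kerS.toRep (Mor.range_nonzero hcon.1) ?_ ?_
  · obtain ⟨i, x, hx⟩ := Mor.ne_zero_iff.1 (sub_ne_zero.2 hcon.2)
    exact ⟨i, ⟨x - e.1 i x, by rw [Mor.mem_kerS, map_sub, hap, sub_self]⟩, fun h0 => hx (by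
      have := congrArg Subtype.val h0
      simp only [Mor.sub_app, Mor.id_app]
      have h2 : x - e.1 i x = 0 := this
      rw [← neg_sub, h2, neg_zero])⟩
  · refine iso_iff.2 ⟨⟨fun i => LinearMap.prod (e.toRange.1 i)
      ((e.kerS.cod (Mor.id Y - e) (fun i y => by
        rw [Mor.mem_kerS]; simp [hap])).1 i), ?_⟩, ?_⟩
    · refine mem_HomS.2 fun a x => ?_
      exact Prod.ext (e.toRange.comm a x) ((e.kerS.cod (Mor.id Y - e) _).comm a x)
    · intro i
      constructor
      · rw [← LinearMap.ker_eq_bot, LinearMap.ker_eq_bot']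
        intro x hx
        have h1 : e.1 i x = 0 := congrArg Subtype.val (congrArg Prod.fst hx)
        have h2 : x - e.1 i x = 0 := congrArg Subtype.val (congrArg Prod.snd hx)
        rw [h1, sub_zero] at h2; exact h2
      · rintro ⟨⟨_, x, rfl⟩, ⟨z, hz⟩⟩
        rw [Mor.mem_kerS] at hz
        refine ⟨e.1 i x + z, Prod.ext (Subtype.ext ?_) (Subtype.ext ?_)⟩
        · change e.1 i (e.1 i x + z) = e.1 i x
          rw [map_add, hap, hz, add_zero]
        · change (e.1 i x + z) - e.1 i (e.1 i x + z) = z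
          rw [map_add, hap, hz]; abel

/-- First inclusion in the direct sum. -/
def inlM (X Y : QRep F Q) : Mor X (dsum X Y) :=
  ⟨fun i => LinearMap.inl F (X.M i) (Y.M i), mem_HomS.2 fun a x => by
    change ((X.map a).prodMap (Y.map a)) (x, 0) = (X.map a x, 0)
    simp⟩

/-- Second inclusion in the direct sum. -/
def inrM (X Y : QRep F Q) : Mor Y (dsum X Y) :=
  ⟨fun i => LinearMap.inr F (X.M i) (Y.M i), mem_HomS.2 fun a x => by
    change ((X.map a).prodMap (Y.map a)) (0, x) = (0, Y.map a x)
    simp⟩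

/-- First projection from the direct sum. -/
def fstM (X Y : QRep F Q) : Mor (dsum X Y) X :=
  ⟨fun i => LinearMap.fst F (X.M i) (Y.M i), mem_HomS.2 fun _ _ => rfl⟩

/-- Second projection from the direct sum. -/
def sndM (X Y : QRep F Q) : Mor (dsum X Y) Y :=
  ⟨fun i => LinearMap.snd F (X.M i) (Y.M i), mem_HomS.2 fun _ _ => rfl⟩

theorem fst_inl (i) (a : X.M i) : (fstM X Y).1 i ((inlM X Y).1 i a) = a := rfl
theorem snd_inl (i) (a : X.M i) : (sndM X Y).1 i ((inlM X Y).1 i a) = 0 := rfl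
theorem fst_inr (i) (a : Y.M i) : (fstM X Y).1 i ((inrM X Y).1 i a) = 0 := rfl
theorem snd_inr (i) (a : Y.M i) : (sndM X Y).1 i ((inrM X Y).1 i a) = a := rfl

theorem indec_iff : Y.Indec ↔
    Y.Nonzero ∧ ∀ e : Mor Y Y, Mor.comp e e = e → e = 0 ∨ e = Mor.id Y := by
  refine ⟨fun h => ⟨h.1, h.idem⟩, fun h => ⟨h.1, fun A B hA hB hi => ?_⟩⟩
  obtain ⟨f, hf⟩ := iso_iff.1 hi
  let p : Mor (dsum A B) (dsum A B) := Mor.comp (inlM A B) (fstM A B)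
  have hp : ∀ i x, p.1 i x = (inlM A B).1 i ((fstM A B).1 i x) := fun i x => rfl
  let e : Mor Y Y := Mor.comp (f.inv hf) (Mor.comp p f)
  have he : ∀ i y, e.1 i y = (f.inv hf).1 i (p.1 i (f.1 i y)) := fun i y => rfl
  rcases h.2 e (Mor.ext' fun i y => by simp [he, hp, fst_inl]) with h0 | h1
  · obtain ⟨i, a, ha⟩ := hA
    apply ha
    have := Mor.eq_zero_iff.1 h0 i ((f.inv hf).1 i ((inlM A B).1 i a))
    rw [he, Mor.inv_app_right, hp, fst_inl] at this
    have h2 := congrArg (fun y => (fstM A B).1 i (f.1 i y)) this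
    simpa [fst_inl] using h2
  · obtain ⟨i, b, hb⟩ := hB
    apply hb
    have : e.1 i ((f.inv hf).1 i ((inrM A B).1 i b)) = (f.inv hf).1 i ((inrM A B).1 i b) := by
      rw [h1]; rfl
    rw [he, Mor.inv_app_right, hp, fst_inr] at this
    have h2 := congrArg (fun y => (sndM A B).1 i (f.1 i y)) this
    simpa [snd_inr] using h2.symm

theorem Indec.retract (h : Y.Indec) (hX : X.Nonzero) (f : Mor X Y) (g : Mor Y X)
    (hgf : ∀ i x, g.1 i (f.1 i x) = x) : f.Bij := by
  rcases h.idem (Mor.comp f g) (Mor.ext' fun i y => by simp [hgf]) with h0 | h1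
  · exfalso
    obtain ⟨i, x, hx⟩ := hX
    apply hx
    have := Mor.eq_zero_iff.1 h0 i (f.1 i x)
    rw [Mor.comp_app, hgf] at this
    rw [← hgf i x, this, map_zero]
  · intro i
    refine ⟨fun x y hxy => by rw [← hgf i x, hxy, hgf], fun y => ⟨g.1 i y, ?_⟩⟩
    rw [← Mor.comp_app, h1]; rfl

/-- Vanishing of `Ext` passes to quotients in the second variable. -/
theorem dmap_surj_right (f : Mor Y Z) (hf : f.Surj)
    (h : Function.Surjective (dmap X Y)) : Function.Surjective (dmap X Z) := by
  intro η
  have hη : ∀ a, ∃ η' : X.M (Q.s a) →ₗ[F] Y.M (Q.t a), (f.1 (Q.t a)).comp η' = η a := by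
    intro a
    obtain ⟨r, hr⟩ := (f.1 (Q.t a)).exists_rightInverse_of_surjective
      (LinearMap.range_eq_top.2 (hf _))
    exact ⟨r.comp (η a), by rw [← LinearMap.comp_assoc, hr, LinearMap.id_comp]⟩
  choose η' hη' using hη
  obtain ⟨φ, hφ⟩ := h η'
  refine ⟨fun i => (f.1 i).comp (φ i), ?_⟩
  funext a; ext x
  rw [dmap_apply, ← hη', ← hφ]
  simp [dmap_apply, f.comm]

/-- Vanishing of `Ext` passes to subobjects in the first variable. -/
theorem dmap_surj_left (f : Mor X Y) (hf : f.Inj)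
    (h : Function.Surjective (dmap Y Z)) : Function.Surjective (dmap X Z) := by
  intro η
  have hη : ∀ a, ∃ η' : Y.M (Q.s a) →ₗ[F] Z.M (Q.t a), η'.comp (f.1 (Q.s a)) = η a := by
    intro a
    obtain ⟨r, hr⟩ := (f.1 (Q.s a)).exists_leftInverse_of_injective
      (LinearMap.ker_eq_bot.2 (hf _))
    exact ⟨(η a).comp r, by rw [LinearMap.comp_assoc, hr, LinearMap.comp_id]⟩
  choose η' hη' using hη
  obtain ⟨φ, hφ⟩ := h η'
  refine ⟨fun i => (φ i).comp (f.1 i), ?_⟩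
  funext a; ext x
  rw [dmap_apply, ← hη', ← hφ]
  simp [dmap_apply, f.comm]

end QRep

/-- A presentation of a quiver as a finite core together with finitely many infinite rays leaving
the core, all of whose arrows point outwards. -/
structure RayData (Q : Quiv) : Type 1 where
  T : Finset Q.V
  B : Finset Q.A
  ι : Type
  [fι : Fintype ι]
  ra : ι → ℕ → Q.A
  srcB : ∀ a ∈ B, Q.s a ∈ T
  tgtB : ∀ a ∈ B, Q.t a ∈ T
  src0 : ∀ i, Q.s (ra i 0) ∈ T
  src_succ : ∀ i k, Q.s (ra i (k + 1)) = Q.t (ra i k)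
  tgt_notin : ∀ i k, Q.t (ra i k) ∉ T
  tgt_inj : ∀ i j k l, Q.t (ra i k) = Q.t (ra j l) → i = j ∧ k = l
  coverV : ∀ v, v ∈ T ∨ ∃ i k, v = Q.t (ra i k)
  coverA : ∀ a, a ∈ B ∨ ∃ i k, a = ra i k

attribute [instance] RayData.fι

namespace RayData

open QRep

variable {F : Type} [Field F] {Q : Quiv} (R : RayData Q)

theorem ra_notin (i k) : R.ra i k ∉ R.B := fun h => R.tgt_notin i k (R.tgtB _ h)

theorem ra_inj {i j k l} (h : R.ra i k = R.ra j l) : i = j ∧ k = l :=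
  R.tgt_inj i j k l (by rw [h])

/-- Induction from the core outwards along the rays. -/
theorem induct {P : Q.V → Prop} (h0 : ∀ v ∈ R.T, P v)
    (h1 : ∀ i k, P (Q.s (R.ra i k)) → P (Q.t (R.ra i k))) (v : Q.V) : P v := by
  have key : ∀ i k, P (Q.t (R.ra i k)) := by
    intro i k
    induction k with
    | zero => exact h1 i 0 (h0 _ (R.src0 i))
    | succ k ih => exact h1 i (k + 1) (by rw [R.src_succ]; exact ih)
  rcases R.coverV v with h | ⟨i, k, rfl⟩
  · exact h0 v h
  · exact key i k

/-- The graph of the recursively defined function of `exists_rec`. -/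
inductive RecGraph {C : Q.V → Type} (base : ∀ v ∈ R.T, C v)
    (step : ∀ i k, C (Q.s (R.ra i k)) → C (Q.t (R.ra i k))) : ∀ v, C v → Prop
  | base (v) (h : v ∈ R.T) : RecGraph base step v (base v h)
  | step (i k c) : RecGraph base step (Q.s (R.ra i k)) c →
      RecGraph base step (Q.t (R.ra i k)) (step i k c)

/-- Recursion from the core outwards along the rays. -/
theorem exists_rec {C : Q.V → Type} (base : ∀ v ∈ R.T, C v)
    (step : ∀ i k, C (Q.s (R.ra i k)) → C (Q.t (R.ra i k))) :
    ∃ f : ∀ v, C v, (∀ v h, f v = base v h) ∧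
      ∀ i k, f (Q.t (R.ra i k)) = step i k (f (Q.s (R.ra i k))) := by
  have hinv : ∀ v c, R.RecGraph base step v c → (∀ h : v ∈ R.T, c = base v h) ∧
      ∀ i k, ∀ h : Q.t (R.ra i k) = v, ∃ c', R.RecGraph base step _ c' ∧ c = h ▸ step i k c' := by
    intro v c hc
    induction hc with
    | base v h => exact ⟨fun _ => rfl, fun i k h' => absurd (h' ▸ h) (R.tgt_notin i k)⟩
    | step i k c hc ih =>
      refine ⟨fun h => absurd h (R.tgt_notin i k), fun j l h => ?_⟩
      obtain ⟨rfl, rfl⟩ := R.tgt_inj _ _ _ _ h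
      exact ⟨c, hc, rfl⟩
  have hex : ∀ v, ∃! c, R.RecGraph base step v c := by
    refine R.induct (fun v h => ⟨_, .base v h, fun c hc => (hinv v c hc).1 h⟩) ?_
    rintro i k ⟨c, hc, hu⟩
    refine ⟨_, .step i k c hc, fun c' hc' => ?_⟩
    obtain ⟨c'', h1, h2⟩ := (hinv _ c' hc').2 i k rfl
    rw [h2, hu c'' h1]
  choose f hf hu using hex
  refine ⟨f, fun v h => (hinv v _ (hf v)).1 h, fun i k => ?_⟩
  exact (hu _ _ (.step i k _ (hf _))).symm

open Classical in
/-- Enlarge the core by the first `N` arrows on each ray. -/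
noncomputable def shift (N : ℕ) : RayData Q where
  T := R.T ∪ (Finset.univ ×ˢ Finset.range N).image (fun p : R.ι × ℕ => Q.t (R.ra p.1 p.2))
  B := R.B ∪ (Finset.univ ×ˢ Finset.range N).image (fun p : R.ι × ℕ => R.ra p.1 p.2)
  ι := R.ι
  ra i k := R.ra i (N + k)
  srcB a ha := by
    simp only [Finset.mem_union, Finset.mem_image, Finset.mem_product, Finset.mem_univ,
      Finset.mem_range, true_and, Prod.exists] at *
    rcases ha with ha | ⟨i, k, hk, rfl⟩
    · exact Or.inl (R.srcB a ha)
    · cases k with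
      | zero => exact Or.inl (R.src0 i)
      | succ k => exact Or.inr ⟨i, k, by omega, (R.src_succ i k).symm⟩
  tgtB a ha := by
    simp only [Finset.mem_union, Finset.mem_image, Finset.mem_product, Finset.mem_univ,
      Finset.mem_range, true_and, Prod.exists] at *
    rcases ha with ha | ⟨i, k, hk, rfl⟩
    · exact Or.inl (R.tgtB a ha)
    · exact Or.inr ⟨i, k, hk, rfl⟩
  src0 i := by
    simp only [Finset.mem_union, Finset.mem_image, Finset.mem_product, Finset.mem_univ,
      Finset.mem_range, true_and, Prod.exists] at *
    cases N with
    | zero => exact Or.inl (R.src0 i)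
    | succ k => exact Or.inr ⟨i, k, by omega, (R.src_succ i k).symm⟩
  src_succ i k := R.src_succ i (N + k)
  tgt_notin i k h := by
    simp only [Finset.mem_union, Finset.mem_image, Finset.mem_product, Finset.mem_univ,
      Finset.mem_range, true_and, Prod.exists] at h
    rcases h with h | ⟨j, l, hl, h⟩
    · exact R.tgt_notin _ _ h
    · have := (R.tgt_inj _ _ _ _ h).2
      omega
  tgt_inj i j k l h := by
    have := R.tgt_inj _ _ _ _ h
    exact ⟨this.1, by omega⟩
  coverV v := by
    simp only [Finset.mem_union, Finset.mem_image, Finset.mem_product, Finset.mem_univ,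
      Finset.mem_range, true_and, Prod.exists]
    rcases R.coverV v with h | ⟨i, k, rfl⟩
    · exact Or.inl (Or.inl h)
    · by_cases hk : k < N
      · exact Or.inl (Or.inr ⟨i, k, hk, rfl⟩)
      · exact Or.inr ⟨i, k - N, by rw [Nat.add_sub_cancel' (by omega)]⟩
  coverA a := by
    simp only [Finset.mem_union, Finset.mem_image, Finset.mem_product, Finset.mem_univ,
      Finset.mem_range, true_and, Prod.exists]
    rcases R.coverA a with h | ⟨i, k, rfl⟩
    · exact Or.inl (Or.inl h)
    · by_cases hk : k < N
      · exact Or.inl (Or.inr ⟨i, k, hk, rfl⟩)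
      · exact Or.inr ⟨i, k - N, by rw [Nat.add_sub_cancel' (by omega)]⟩

theorem mem_shift_T {N : ℕ} {v : Q.V} :
    v ∈ (R.shift N).T ↔ v ∈ R.T ∨ ∃ i k, k < N ∧ v = Q.t (R.ra i k) := by
  simp only [shift, Finset.mem_union, Finset.mem_image, Finset.mem_product, Finset.mem_univ,
    Finset.mem_range, true_and, Prod.exists, eq_comm]

theorem mem_shift_B {N : ℕ} {a : Q.A} :
    a ∈ (R.shift N).B ↔ a ∈ R.B ∨ ∃ i k, k < N ∧ a = R.ra i k := by
  simp only [shift, Finset.mem_union, Finset.mem_image, Finset.mem_product, Finset.mem_univ,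
    Finset.mem_range, true_and, Prod.exists, eq_comm]

/-- The Euler form of the core. -/
def form (n m : Q.V → ℤ) : ℤ :=
  ∑ v ∈ R.T, n v * m v - ∑ a ∈ R.B, n (Q.s a) * m (Q.t a)

theorem form_shift (N : ℕ) (n m : Q.V → ℤ) :
    (R.shift N).form n m = R.form n m + ∑ i, ∑ k ∈ Finset.range N,
      (n (Q.t (R.ra i k)) * m (Q.t (R.ra i k)) - n (Q.s (R.ra i k)) * m (Q.t (R.ra i k))) := by
  classical
  unfold form
  have hT : ∑ v ∈ (R.shift N).T, n v * m v = ∑ v ∈ R.T, n v * m v +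
      ∑ i, ∑ k ∈ Finset.range N, n (Q.t (R.ra i k)) * m (Q.t (R.ra i k)) := by
    have : (R.shift N).T = R.T ∪ (Finset.univ ×ˢ Finset.range N).image
      (fun p : R.ι × ℕ => Q.t (R.ra p.1 p.2)) := by ext v; simp [mem_shift_T, eq_comm]
    rw [this, Finset.sum_union, Finset.sum_image, Finset.sum_product]
    · rintro ⟨i, k⟩ - ⟨j, l⟩ - h
      have := R.tgt_inj _ _ _ _ h
      exact Prod.ext this.1 this.2
    · rw [Finset.disjoint_right]
      simp only [Finset.mem_image, forall_exists_index, and_imp]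
      rintro _ ⟨i, k⟩ - rfl
      exact R.tgt_notin i k
  have hB : ∑ a ∈ (R.shift N).B, n (Q.s a) * m (Q.t a) = ∑ a ∈ R.B, n (Q.s a) * m (Q.t a) +
      ∑ i, ∑ k ∈ Finset.range N, n (Q.s (R.ra i k)) * m (Q.t (R.ra i k)) := by
    have : (R.shift N).B = R.B ∪ (Finset.univ ×ˢ Finset.range N).image
      (fun p : R.ι × ℕ => R.ra p.1 p.2) := by ext v; simp [mem_shift_B, eq_comm]
    rw [this, Finset.sum_union, Finset.sum_image, Finset.sum_product]
    · rintro ⟨i, k⟩ - ⟨j, l⟩ - h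
      have := R.ra_inj h
      exact Prod.ext this.1 this.2
    · rw [Finset.disjoint_right]
      simp only [Finset.mem_image, forall_exists_index, and_imp]
      rintro _ ⟨i, k⟩ - rfl
      exact R.ra_notin i k
  rw [hT, hB]
  simp only [Finset.sum_sub_distrib]
  ring

/-- Representations which are locally finite-dimensional with bijective maps on the rays. -/
def Mem (X : QRep F Q) : Prop :=
  (∀ v, FiniteDimensional F (X.M v)) ∧ ∀ i k, Function.Bijective (X.map (R.ra i k))

theorem Mem.shift {X : QRep F Q} {N M : ℕ} (h : (R.shift N).Mem X) (hNM : N ≤ M) :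
    (R.shift M).Mem X :=
  ⟨h.1, fun i k => by
    have h2 : Function.Bijective (X.map (R.ra i (N + (M - N + k)))) := h.2 i (M - N + k)
    rwa [← add_assoc, Nat.add_sub_cancel' hNM] at h2⟩

theorem flei_iff {X : QRep F Q} : X.IsFLEI ↔ ∃ N, (R.shift N).Mem X := by
  constructor
  · rintro ⟨hfd, hfin⟩
    have : {p : R.ι × ℕ | ¬ Function.Bijective (X.map (R.ra p.1 p.2))}.Finite := by
      refine Set.Finite.of_finite_image (f := fun p : R.ι × ℕ => R.ra p.1 p.2)
        (hfin.subset ?_) ?_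
      · rintro _ ⟨p, hp, rfl⟩; exact hp
      · rintro ⟨i, k⟩ - ⟨j, l⟩ - h
        have := R.ra_inj h
        exact Prod.ext this.1 this.2
    obtain ⟨N, hN⟩ := (this.image Prod.snd).bddAbove
    refine ⟨N + 1, hfd, fun i k => ?_⟩
    by_contra hcon
    have := hN ⟨(i, N + 1 + k), hcon, rfl⟩
    simp only at this
    omega
  · rintro ⟨N, hfd, hb⟩
    refine ⟨hfd, (R.shift N).B.finite_toSet.subset fun a ha => ?_⟩
    rcases (R.shift N).coverA a with h | ⟨i, k, rfl⟩
    · exact h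
    · exact absurd (hb i k) ha

/-- Extension of linear maps from the core along the rays, with prescribed defect. -/
theorem exists_extend {X Y : QRep F Q} (hX : ∀ i k, Function.Bijective (X.map (R.ra i k)))
    (φ : ∀ v, X.M v →ₗ[F] Y.M v) (η : ∀ a, X.M (Q.s a) →ₗ[F] Y.M (Q.t a)) :
    ∃ ψ : ∀ v, X.M v →ₗ[F] Y.M v, (∀ v ∈ R.T, ψ v = φ v) ∧
      ∀ i k, dmap X Y ψ (R.ra i k) = η (R.ra i k) := by
  obtain ⟨ψ, h1, h2⟩ := R.exists_rec (C := fun v => X.M v →ₗ[F] Y.M v) (fun v _ => φ v)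
    (fun i k c => ((Y.map (R.ra i k)).comp c - η (R.ra i k)).comp
      (LinearEquiv.ofBijective _ (hX i k)).symm.toLinearMap)
  refine ⟨ψ, fun v hv => h1 v hv, fun i k => ?_⟩
  ext x
  rw [dmap_apply, h2]
  have : (LinearEquiv.ofBijective _ (hX i k)).symm (X.map (R.ra i k) x) = x :=
    (LinearEquiv.ofBijective _ (hX i k)).symm_apply_apply x
  simp [this]

theorem mor_eq_zero {X Y : QRep F Q} (hX : ∀ i k, Function.Surjective (X.map (R.ra i k)))
    (f : Mor X Y) (h : ∀ v ∈ R.T, f.1 v = 0) : f = 0 := by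
  have : ∀ v, f.1 v = 0 := R.induct h (fun i k hk => by
    ext x
    obtain ⟨y, rfl⟩ := hX i k x
    rw [← f.comm, hk]; simp)
  exact Mor.ext' fun v x => by rw [this]; rfl

/-- The Euler form computes `dim Hom - dim Ext`. -/
theorem euler {X Y : QRep F Q} (hX : R.Mem X) (hY : ∀ v, FiniteDimensional F (Y.M v)) :
    FiniteDimensional F (Mor X Y) ∧ ∃ e : ℕ,
      (Module.finrank F (Mor X Y) : ℤ) = R.form (dimvec F X) (dimvec F Y) + e ∧
      (e = 0 ↔ Function.Surjective (dmap X Y)) := by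
  classical
  have := hX.1
  let H0 := ∀ v : R.T, X.M v →ₗ[F] Y.M v
  let H1 := ∀ a : R.B, X.M (Q.s a) →ₗ[F] Y.M (Q.t a)
  let d : H0 →ₗ[F] H1 :=
    { toFun := fun φ a => (Y.map a).comp (φ ⟨_, R.srcB a a.2⟩) -
        (φ ⟨_, R.tgtB a a.2⟩).comp (X.map a)
      map_add' := fun φ ψ => by
        funext a; ext x
        change Y.map a (φ _ x + ψ _ x) - (φ ⟨_, R.tgtB a a.2⟩ (X.map a x) + ψ ⟨_, R.tgtB a a.2⟩ (X.map a x)) =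
          (Y.map a (φ _ x) - φ ⟨_, R.tgtB a a.2⟩ (X.map a x)) + (Y.map a (ψ _ x) - ψ ⟨_, R.tgtB a a.2⟩ (X.map a x))
        rw [map_add]; abel
      map_smul' := fun c φ => by
        funext a; ext x
        change Y.map a (c • φ _ x) - c • φ ⟨_, R.tgtB a a.2⟩ (X.map a x) =
          c • (Y.map a (φ _ x) - φ ⟨_, R.tgtB a a.2⟩ (X.map a x))
        rw [map_smul, smul_sub] }
  have hd : ∀ (φ : H0) (a : R.B) x, d φ a x = Y.map a (φ ⟨_, R.srcB a a.2⟩ x) -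
      φ ⟨_, R.tgtB a a.2⟩ (X.map a x) := fun _ _ _ => rfl
  let res : Mor X Y →ₗ[F] LinearMap.ker d :=
    { toFun := fun f => ⟨fun v => f.1 v, by
        rw [LinearMap.mem_ker]
        funext a; ext x
        rw [hd, f.comm, sub_self]; rfl⟩
      map_add' := fun _ _ => rfl
      map_smul' := fun _ _ => rfl }
  have ext0 : ∀ (φ : H0) (η : ∀ a, X.M (Q.s a) →ₗ[F] Y.M (Q.t a)),
      ∃ ψ : ∀ v, X.M v →ₗ[F] Y.M v, (∀ v : R.T, ψ v = φ v) ∧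
        (∀ a : R.B, dmap X Y ψ a = d φ a) ∧ ∀ i k, dmap X Y ψ (R.ra i k) = η (R.ra i k) := by
    intro φ η
    obtain ⟨ψ, h1, h2⟩ := R.exists_extend hX.2
      (fun v => if h : v ∈ R.T then φ ⟨v, h⟩ else (0 : X.M v →ₗ[F] Y.M v)) η
    have h1' : ∀ v : R.T, ψ v = φ v := fun v => by
      rw [h1 v v.2, dif_pos v.2]
    refine ⟨ψ, h1', fun a => ?_, h2⟩
    ext x
    rw [hd, dmap_apply, ← h1', ← h1']
  have hres : Function.Bijective res := by
    constructor
    · rw [← LinearMap.ker_eq_bot, LinearMap.ker_eq_bot']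
      intro f hf
      refine R.mor_eq_zero (fun i k => (hX.2 i k).2) f fun v hv => ?_
      exact congrFun (congrArg Subtype.val hf) ⟨v, hv⟩
    · rintro ⟨φ, hφ⟩
      obtain ⟨ψ, h1, h2, h3⟩ := ext0 φ 0
      refine ⟨⟨ψ, ?_⟩, Subtype.ext (funext fun v => h1 v)⟩
      change dmap X Y ψ = 0
      funext a
      rcases R.coverA a with ha | ⟨i, k, rfl⟩
      · rw [h2 ⟨a, ha⟩, LinearMap.mem_ker.1 hφ]; rfl
      · exact h3 i k
  let eqv := LinearEquiv.ofBijective res hres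
  have hsurj : Function.Surjective d ↔ Function.Surjective (dmap X Y) := by
    constructor
    · intro h η
      obtain ⟨φ, hφ⟩ := h fun a => η a
      obtain ⟨ψ, h1, h2, h3⟩ := ext0 φ η
      refine ⟨ψ, ?_⟩
      funext a
      rcases R.coverA a with ha | ⟨i, k, rfl⟩
      · rw [h2 ⟨a, ha⟩, hφ]
      · exact h3 i k
    · intro h η
      obtain ⟨ψ, hψ⟩ := h fun a => if ha : a ∈ R.B then η ⟨a, ha⟩ else 0
      refine ⟨fun v => ψ v, ?_⟩
      funext a; ext x
      have := congrArg (fun f => f a.1 x) hψ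
      simp only [dif_pos a.2] at this
      rw [← this]; rfl
  refine ⟨Module.Finite.equiv eqv.symm, Module.finrank F H1 - Module.finrank F (LinearMap.range d),
    ?_, ?_⟩
  · rw [eqv.finrank_eq, Nat.cast_sub (Submodule.finrank_le _)]
    have h0 := LinearMap.finrank_range_add_finrank_ker d
    have e0 : (Module.finrank F H0 : ℤ) = ∑ v ∈ R.T, dimvec F X v * dimvec F Y v := by
      rw [Module.finrank_pi_fintype]
      push_cast
      rw [← Finset.sum_coe_sort R.T (fun v => dimvec F X v * dimvec F Y v)]
      refine Finset.sum_congr rfl fun v _ => ?_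
      rw [Module.finrank_linearMap]; push_cast; rfl
    have e1 : (Module.finrank F H1 : ℤ) = ∑ a ∈ R.B, dimvec F X (Q.s a) * dimvec F Y (Q.t a) := by
      rw [Module.finrank_pi_fintype]
      push_cast
      rw [← Finset.sum_coe_sort R.B (fun a => dimvec F X (Q.s a) * dimvec F Y (Q.t a))]
      refine Finset.sum_congr rfl fun v _ => ?_
      rw [Module.finrank_linearMap]; push_cast; rfl
    unfold form
    rw [← e0, ← e1]
    push_cast [← h0]
    ring
  · rw [← hsurj, ← LinearMap.range_eq_top, Nat.sub_eq_zero_iff_le]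
    constructor
    · intro h
      exact Submodule.eq_top_of_finrank_eq (le_antisymm (Submodule.finrank_le _) h)
    · intro h
      rw [h, finrank_top]

/-- Positive definiteness of the core form. -/
def PD : Prop := ∀ n : Q.V → ℤ, (∃ v ∈ R.T, n v ≠ 0) → 0 < R.form n n

/-- Total dimension on the core. -/
noncomputable def size (X : QRep F Q) : ℕ := ∑ v ∈ R.T, Module.finrank F (X.M v)

end RayData

namespace QRep

variable {F : Type} [Field F] {Q : Quiv} {X Y Z : QRep F Q}

/-- Morphisms from the kernel of an epimorphism `X → I` to `L` extend to `X` if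
`Ext(I, L)` vanishes. -/
theorem exists_extension {I L : QRep F Q} (p : Mor X I) (hp : p.Surj)
    (h : Function.Surjective (dmap I L)) (π : Mor p.kerS.toRep L) :
    ∃ π' : Mor X L, Mor.comp π' p.kerS.incl = π := by
  have h1 : ∀ i, ∃ φ : X.M i →ₗ[F] L.M i, φ.comp (p.kerS.S i).subtype = π.1 i := fun i =>
    LinearMap.exists_extend (π.1 i)
  choose φ hφ using h1
  have hφ' : ∀ i x (hx : p.1 i x = 0), φ i x = π.1 i ⟨x, hx⟩ := fun i x hx =>
    LinearMap.congr_fun (hφ i) ⟨x, hx⟩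
  have h2 : ∀ a, ∃ η : I.M (Q.s a) →ₗ[F] L.M (Q.t a), η.comp (p.1 (Q.s a)) = dmap X L φ a := by
    intro a
    obtain ⟨r, hr⟩ := (p.1 (Q.s a)).exists_rightInverse_of_surjective
      (LinearMap.range_eq_top.2 (hp _))
    have hr' : ∀ y, p.1 (Q.s a) (r y) = y := fun y => LinearMap.congr_fun hr y
    refine ⟨(dmap X L φ a).comp r, LinearMap.ext fun x => ?_⟩
    have hk : p.1 (Q.s a) (r (p.1 (Q.s a) x) - x) = 0 := by rw [map_sub, hr', sub_self]
    have hz : dmap X L φ a (r (p.1 (Q.s a) x) - x) = 0 := by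
      rw [dmap_apply, hφ' _ _ hk, hφ' _ _ (by rw [← p.comm, hk, map_zero]), sub_eq_zero]
      exact π.comm a ⟨_, hk⟩
    rw [map_sub, sub_eq_zero] at hz
    exact hz
  choose η hη using h2
  obtain ⟨ψ, hψ⟩ := h η
  refine ⟨⟨fun i => φ i - (ψ i).comp (p.1 i), mem_HomS.2 fun a x => ?_⟩, ?_⟩
  · have e1 := LinearMap.congr_fun (hη a) x
    rw [← hψ] at e1
    simp only [LinearMap.comp_apply, dmap_apply, p.comm] at e1
    simp only [LinearMap.sub_apply, LinearMap.comp_apply, map_sub]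
    rw [sub_eq_sub_iff_sub_eq_sub, ← e1]
  · refine Mor.ext' fun i x => ?_
    change φ i x.1 - ψ i (p.1 i x.1) = _
    rw [Mor.mem_kerS.1 x.2, map_zero, sub_zero, hφ' i x.1 x.2]
    rfl

/-- If `Ext(X, X) = 0` then all structure maps have maximal rank. -/
theorem max_rank (h : Function.Surjective (dmap X X)) (a : Q.A) :
    Function.Injective (X.map a) ∨ Function.Surjective (X.map a) := by
  classical
  by_contra! hcon
  obtain ⟨h1, h2⟩ := hcon
  rw [← LinearMap.ker_eq_bot, LinearMap.ker_eq_bot'] at h1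
  push Not at h1
  obtain ⟨x, hx, hx0⟩ := h1
  simp only [Function.Surjective, not_forall] at h2
  obtain ⟨y, hy⟩ := h2
  obtain ⟨l, hl⟩ := Module.Projective.exists_dual_ne_zero F hx0
  obtain ⟨φ, hφ⟩ := h (Pi.single a ((l.smulRight ((l x)⁻¹ • y))))
  have := LinearMap.congr_fun (congrFun hφ a) x
  rw [dmap_apply, hx, map_zero, sub_zero, Pi.single_eq_same] at this
  simp only [LinearMap.smulRight_apply, smul_smul, mul_inv_cancel₀ hl, one_smul] at this
  exact hy ⟨_, this⟩

/-- The endomorphism algebra. -/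
def EndA (X : QRep F Q) : Subalgebra F (∀ i, Module.End F (X.M i)) where
  carrier := HomS X X
  mul_mem' {f g} hf hg := (Mor.comp ⟨f, hf⟩ ⟨g, hg⟩).2
  add_mem' hf hg := (HomS X X).add_mem hf hg
  algebraMap_mem' c := (c • Mor.id X).2

theorem brick_dvd (hX : X.Nonzero) (hb : ∀ f : Mor X X, f ≠ 0 → f.Bij) (v : Q.V) :
    Module.finrank F (Mor X X) ∣ Module.finrank F (X.M v) := by
  classical
  have hnt : Nontrivial (EndA X) := ⟨⟨Mor.id X, 0, id_ne_zero hX⟩⟩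
  have hu : ∀ f : EndA X, IsUnit f ∨ f = 0 := by
    intro f
    by_cases hf : f = 0
    · exact Or.inr hf
    · left
      have hf' : (show Mor X X from f).Bij := hb f hf
      refine ⟨⟨f, Mor.inv (show Mor X X from f) hf', ?_, ?_⟩, rfl⟩
      · exact Mor.ext' (f := Mor.comp f (Mor.inv (show Mor X X from f) hf'))
          (g := Mor.id X) fun i x => Mor.inv_app_right _ hf' i x
      · exact Mor.ext' (f := Mor.comp (Mor.inv (show Mor X X from f) hf') f)
          (g := Mor.id X) fun i x => Mor.inv_app_left _ hf' i x
  let : DivisionRing (EndA X) := DivisionRing.ofIsUnitOrEqZero hu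
  let : Module (EndA X) (X.M v) := Module.compHom (X.M v)
    ((Pi.evalRingHom (fun i => Module.End F (X.M i)) v).comp (EndA X).val.toRingHom)
  have : IsScalarTower F (EndA X) (X.M v) := ⟨fun c f x => rfl⟩
  exact ⟨_, (Module.finrank_mul_finrank F (EndA X) (X.M v)).symm⟩

end QRep

namespace RayData

open QRep

variable {F : Type} [Field F] {Q : Quiv} {R : RayData Q} {X Y Z : QRep F Q}

theorem Mem.iso (hX : R.Mem X) (h : Iso X Y) : R.Mem Y := by
  obtain ⟨f, hf⟩ := iso_iff.1 h
  refine ⟨fun v => ?_, fun i k => ?_⟩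
  · have := hX.1 v
    exact Module.Finite.equiv (LinearEquiv.ofBijective (f.1 v) (hf v))
  · have h2 : Y.map (R.ra i k) ∘ f.1 _ = f.1 _ ∘ X.map (R.ra i k) := funext fun x => f.comm _ x
    have h3 : Function.Bijective (Y.map (R.ra i k) ∘ f.1 _) := h2 ▸ (hf _).comp (hX.2 i k)
    exact (Function.Bijective.of_comp_iff _ (hf _)).1 h3

theorem Mem.sub (hX : R.Mem X) (W : Subrep X)
    (h : ∀ i k, ∀ x, X.map (R.ra i k) x ∈ W.S _ → x ∈ W.S _) : R.Mem W.toRep := by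
  refine ⟨fun v => ?_, fun i k => ⟨fun x y hxy => ?_, fun y => ?_⟩⟩
  · have := hX.1 v
    exact inferInstanceAs (FiniteDimensional F (W.S v))
  · exact Subtype.ext ((hX.2 i k).1 (congrArg Subtype.val hxy))
  · obtain ⟨x, hx⟩ := (hX.2 i k).2 y.1
    exact ⟨⟨x, h i k x (hx ▸ y.2)⟩, Subtype.ext hx⟩

theorem Mem.range (hX : R.Mem X) (hY : R.Mem Y) (f : Mor X Y) : R.Mem f.rangeS.toRep := by
  refine hY.sub _ fun i k y hy => ?_
  obtain ⟨x, hx⟩ := hy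
  obtain ⟨x', rfl⟩ := (hX.2 i k).2 x
  exact ⟨x', (hY.2 i k).1 (by rw [f.comm, hx])⟩

theorem Mem.ker (hX : R.Mem X) (hY : R.Mem Y) (f : Mor X Y) : R.Mem f.kerS.toRep := by
  refine hX.sub _ fun i k x hx => ?_
  rw [Mor.mem_kerS, ← f.comm] at hx
  exact (hY.2 i k).1 (by rw [hx, map_zero])

theorem Mem.dsum (hX : R.Mem X) (hY : R.Mem Y) : R.Mem (dsum X Y) := by
  refine ⟨fun v => ?_, fun i k => (hX.2 i k).prodMap (hY.2 i k)⟩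
  have := hX.1 v
  have := hY.1 v
  exact inferInstanceAs (FiniteDimensional F (X.M v × Y.M v))

theorem bij_of_core (hX : ∀ i k, Function.Bijective (X.map (R.ra i k)))
    (hY : ∀ i k, Function.Bijective (Y.map (R.ra i k))) (f : Mor X Y)
    (h : ∀ v ∈ R.T, Function.Bijective (f.1 v)) : f.Bij := by
  refine R.induct h fun i k hk => ?_
  have h2 : Y.map (R.ra i k) ∘ f.1 _ = f.1 _ ∘ X.map (R.ra i k) := funext fun x => f.comm _ x
  have h3 : Function.Bijective (f.1 _ ∘ X.map (R.ra i k)) := h2 ▸ (hY i k).comp hk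
  exact (Function.Bijective.of_comp_iff _ (hX i k)).1 h3

theorem size_le_of_inj (hY : R.Mem Y) {f : Mor X Y} (hf : f.Inj) : R.size X ≤ R.size Y :=
  Finset.sum_le_sum fun v _ => by
    have := hY.1 v
    exact LinearMap.finrank_le_finrank_of_injective (hf v)

theorem bij_of_inj (hX : R.Mem X) (hY : R.Mem Y) {f : Mor X Y} (hf : f.Inj)
    (h : R.size Y ≤ R.size X) : f.Bij := by
  have hle : ∀ v ∈ R.T, Module.finrank F (X.M v) ≤ Module.finrank F (Y.M v) := fun v _ => by
    have := hY.1 v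
    exact LinearMap.finrank_le_finrank_of_injective (hf v)
  have heq := (Finset.sum_eq_sum_iff_of_le hle).1 (le_antisymm (Finset.sum_le_sum hle) h)
  refine bij_of_core hX.2 hY.2 f fun v hv => ⟨hf v, ?_⟩
  have := hX.1 v
  have := hY.1 v
  exact (LinearMap.injective_iff_surjective_of_finrank_eq_finrank (heq v hv)).1 (hf v)

theorem bij_of_surj (hX : R.Mem X) (hY : R.Mem Y) {f : Mor X Y} (hf : f.Surj)
    (h : R.size X ≤ R.size Y) : f.Bij := by
  have hle : ∀ v ∈ R.T, Module.finrank F (Y.M v) ≤ Module.finrank F (X.M v) := fun v _ => by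
    have := hX.1 v
    exact (f.1 v).finrank_le_finrank_of_surjective (hf v)
  have heq := (Finset.sum_eq_sum_iff_of_le hle).1 (le_antisymm (Finset.sum_le_sum hle) h)
  refine bij_of_core hX.2 hY.2 f fun v hv => ⟨?_, hf v⟩
  have := hX.1 v
  have := hY.1 v
  exact (LinearMap.injective_iff_surjective_of_finrank_eq_finrank (heq v hv).symm).2 (hf v)

theorem nonzero_core (hX : ∀ i k, Function.Surjective (X.map (R.ra i k))) (h : X.Nonzero) :
    ∃ v ∈ R.T, ∃ x : X.M v, x ≠ 0 := by
  by_contra! hcon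
  obtain ⟨v, x, hx⟩ := h
  have : ∀ v, ∀ x : X.M v, x = 0 := R.induct hcon fun i k hk x => by
    obtain ⟨y, rfl⟩ := hX i k x
    rw [hk y, map_zero]
  exact hx (this v x)

theorem dimvec_ne_zero (hX : R.Mem X) {v} {x : X.M v} (hx : x ≠ 0) : dimvec F X v ≠ 0 := by
  have := hX.1 v
  have : Nontrivial (X.M v) := ⟨⟨x, 0, hx⟩⟩
  unfold dimvec
  exact_mod_cast (Module.finrank_pos (R := F) (M := X.M v)).ne'

theorem form_pos (hR : R.PD) (hX : R.Mem X) (h : X.Nonzero) :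
    0 < R.form (dimvec F X) (dimvec F X) := by
  obtain ⟨v, hv, x, hx⟩ := nonzero_core (fun i k => (hX.2 i k).2) h
  exact hR _ ⟨v, hv, dimvec_ne_zero hX hx⟩

theorem form_mul (c : ℤ) (m : Q.V → ℤ) :
    R.form (fun v => c * m v) (fun v => c * m v) = c * c * R.form m m := by
  unfold form
  rw [mul_sub, Finset.mul_sum, Finset.mul_sum]
  congr 1 <;> exact Finset.sum_congr rfl fun _ _ => by ring

/-- Bricks over a positive definite core are real Schur roots. -/
theorem brick_one (hR : R.PD) (hX : R.Mem X) (h : X.Nonzero)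
    (hb : ∀ f : Mor X X, f ≠ 0 → f.Bij) :
    Module.finrank F (Mor X X) = 1 ∧ R.form (dimvec F X) (dimvec F X) = 1 ∧
      Function.Surjective (dmap X X) := by
  obtain ⟨hfd, e, he, he0⟩ := R.euler hX hX.1
  have hpos := form_pos hR hX h
  set d := Module.finrank F (Mor X X) with hd
  have hdpos : 0 < d := by
    have : Nontrivial (Mor X X) := ⟨⟨Mor.id X, 0, id_ne_zero h⟩⟩
    exact Module.finrank_pos
  choose m hm using fun v => brick_dvd h hb v
  have hdv : dimvec F X = fun v => (d : ℤ) * (m v : ℤ) := by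
    funext v
    unfold dimvec
    rw [hm v]; push_cast; rfl
  have hq : R.form (dimvec F X) (dimvec F X) = d * d * R.form (fun v => (m v : ℤ)) (fun v => m v) := by
    rw [hdv, form_mul]
  have hdz : (0 : ℤ) < d := by exact_mod_cast hdpos
  have hez : (0 : ℤ) ≤ e := by positivity
  set k := R.form (fun v => (m v : ℤ)) (fun v => (m v : ℤ))
  have hk : 0 < k := by
    rw [hq] at hpos
    exact pos_of_mul_pos_right hpos (by positivity)
  have hd1 : (d : ℤ) = 1 := by nlinarith
  have he1 : (e : ℤ) = 0 := by nlinarith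
  refine ⟨by exact_mod_cast hd1, by omega, he0.1 (by exact_mod_cast he1)⟩

/-- Given a property of endomorphisms compatible with sums, there is an idempotent with an
indecomposable image satisfying it. -/
theorem exists_idem (hX : R.Mem X) (P : Mor X X → Prop) (h0 : ¬ P 0) (h1 : P (Mor.id X))
    (hadd : ∀ e e', P (e + e') → P e ∨ P e') :
    ∃ e : Mor X X, Mor.comp e e = e ∧ P e ∧ e.rangeS.toRep.Indec := by
  classical
  have hex : ∃ n, ∃ e : Mor X X, Mor.comp e e = e ∧ P e ∧ R.size e.rangeS.toRep = n :=
    ⟨_, Mor.id X, rfl, h1, rfl⟩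
  obtain ⟨e, he, hPe, hsz⟩ := Nat.find_spec hex
  have hmin : ∀ e' : Mor X X, Mor.comp e' e' = e' → P e' →
      R.size e.rangeS.toRep ≤ R.size e'.rangeS.toRep := fun e' h1 h2 => by
    rw [hsz]; exact Nat.find_min' hex ⟨e', h1, h2, rfl⟩
  refine ⟨e, he, hPe, ?_⟩
  have hap : ∀ i x, e.1 i (e.1 i x) = e.1 i x := fun i x => by rw [← Mor.comp_app, he]
  have hfix : ∀ i (y : e.rangeS.toRep.M i), e.toRange.1 i (e.rangeS.incl.1 i y) = y := by
    rintro i ⟨_, x, rfl⟩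
    exact Subtype.ext (hap i x)
  have hL := hX.range hX e
  have key : ∀ u : Mor e.rangeS.toRep e.rangeS.toRep, Mor.comp u u = u →
      P (Mor.comp e.rangeS.incl (Mor.comp u e.toRange)) → u = Mor.id _ := by
    intro u hu hPu
    have hu' : ∀ i x, u.1 i (u.1 i x) = u.1 i x := fun i x => by rw [← Mor.comp_app, hu]
    have hid : Mor.comp (Mor.comp e.rangeS.incl (Mor.comp u e.toRange))
        (Mor.comp e.rangeS.incl (Mor.comp u e.toRange)) =
        Mor.comp e.rangeS.incl (Mor.comp u e.toRange) := Mor.ext' fun i x => by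
      simp [hfix, hu']
    have hle := hmin _ hid hPu
    let w : Mor u.rangeS.toRep e.rangeS.toRep := u.rangeS.incl
    let g : Mor (Mor.comp e.rangeS.incl (Mor.comp u e.toRange)).rangeS.toRep u.rangeS.toRep :=
      Mor.comp u.toRange (Mor.comp e.toRange (Subrep.incl _))
    have hg : g.Inj := by
      rintro i ⟨_, x, rfl⟩ ⟨_, y, rfl⟩ hxy
      apply Subtype.ext
      have h3 := congrArg Subtype.val hxy
      simp only [g, Mor.comp_app, Subrep.incl_app] at h3
      change u.1 i (e.toRange.1 i (e.rangeS.incl.1 i (u.1 i (e.toRange.1 i x)))) =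
        u.1 i (e.toRange.1 i (e.rangeS.incl.1 i (u.1 i (e.toRange.1 i y)))) at h3
      rw [hfix, hfix, hu', hu'] at h3
      change e.rangeS.incl.1 i (u.1 i (e.toRange.1 i x)) =
        e.rangeS.incl.1 i (u.1 i (e.toRange.1 i y))
      rw [h3]
    have hle2 := size_le_of_inj (hL.range hL u) hg
    have hb := bij_of_inj (hL.range hL u) hL (Subrep.incl_inj u.rangeS) (hle.trans hle2)
    refine Mor.ext' fun i y => ?_
    obtain ⟨⟨_, x, rfl⟩, rfl⟩ := (hb i).2 y
    exact hu' i x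
  refine indec_iff.2 ⟨Mor.range_nonzero fun h => h0 (h ▸ hPe), fun u hu => ?_⟩
  have hu' : ∀ i x, u.1 i (u.1 i x) = u.1 i x := fun i x => by rw [← Mor.comp_app, hu]
  have hsum : e = Mor.comp e.rangeS.incl (Mor.comp u e.toRange) +
      Mor.comp e.rangeS.incl (Mor.comp (Mor.id _ - u) e.toRange) := Mor.ext' fun i x => by
    simp only [Mor.add_app, Mor.comp_app, Mor.sub_app, Mor.id_app]
    rw [← map_add, add_sub_cancel]; rfl
  rcases hadd _ _ (hsum ▸ hPe) with h | h
  · exact Or.inr (key u hu h)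
  · left
    have := key (Mor.id _ - u) (Mor.ext' fun i x => by simp [hu']) h
    exact sub_eq_self.1 this

/-- Indecomposables over a positive definite core are bricks. -/
theorem indec_brick (hR : R.PD) : ∀ n (X : QRep F Q), R.size X ≤ n → R.Mem X → X.Indec →
    ∀ f : Mor X X, f ≠ 0 → f.Bij := by
  classical
  intro n
  induction n using Nat.strong_induction_on with
  | _ n ih =>
  intro X hn hX hI
  by_contra! hcon
  have hex : ∃ m, ∃ f : Mor X X, f ≠ 0 ∧ ¬ f.Bij ∧ R.size f.rangeS.toRep = m := by
    obtain ⟨f, h1, h2⟩ := hcon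
    exact ⟨_, f, h1, h2, rfl⟩
  obtain ⟨θ, hθ0, hθb, hsz⟩ := Nat.find_spec hex
  have hmin : ∀ f : Mor X X, f ≠ 0 → ¬ f.Bij → R.size θ.rangeS.toRep ≤ R.size f.rangeS.toRep :=
    fun f h1 h2 => by rw [hsz]; exact Nat.find_min' hex ⟨f, h1, h2, rfl⟩
  have hIm := hX.range hX θ
  -- any endomorphism factoring as `g ∘ θ` with nonzero composite has `g` injective on the image
  have hfac : ∀ (L : QRep F Q) (_ : R.Mem L) (g : Mor θ.rangeS.toRep L) (j : Mor L X), j.Inj →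
      Mor.comp g θ.toRange ≠ 0 → g.Inj := by
    intro L hL g j hj hne
    set f : Mor X X := Mor.comp j (Mor.comp g θ.toRange) with hf
    have hf0 : f ≠ 0 := by
      obtain ⟨i, x, hx⟩ := Mor.ne_zero_iff.1 hne
      exact Mor.ne_zero_iff.2 ⟨i, x, fun h => hx (hj i (h.trans (map_zero _).symm))⟩
    have hfb : ¬ f.Bij := by
      intro hb
      apply hθb
      refine bij_of_inj hX hX (fun i x y hxy => (hb i).1 ?_) le_rfl
      have : θ.toRange.1 i x = θ.toRange.1 i y := Subtype.ext hxy
      simp [hf, this]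
    have hle := hmin f hf0 hfb
    let p : Mor θ.rangeS.toRep f.rangeS.toRep := f.rangeS.cod (Mor.comp j g) (fun i y => by
      obtain ⟨x, rfl⟩ := θ.toRange_surj i y
      exact ⟨x, rfl⟩)
    have hp : p.Surj := by
      rintro i ⟨_, x, rfl⟩
      exact ⟨θ.toRange.1 i x, rfl⟩
    have hpb := bij_of_surj hIm (hX.range hX f) hp hle
    intro i x y hxy
    apply (hpb i).1
    apply Subtype.ext
    change j.1 i (g.1 i x) = j.1 i (g.1 i y)
    rw [hxy]
  -- the square vanishes
  have hsq : ∀ i x, θ.1 i (θ.1 i x) = 0 := by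
    by_contra! hne
    obtain ⟨i, x, hx⟩ := hne
    set g : Mor θ.rangeS.toRep θ.rangeS.toRep := Mor.comp θ.toRange θ.rangeS.incl with hg
    have hginj : g.Inj := hfac _ hIm g θ.rangeS.incl (Subrep.incl_inj _)
      (Mor.ne_zero_iff.2 ⟨i, x, fun h => hx (congrArg Subtype.val h)⟩)
    have hgb := bij_of_inj hIm hIm hginj le_rfl
    have hb := hI.retract (Mor.range_nonzero hθ0) θ.rangeS.incl
      (Mor.comp (g.inv hgb) θ.toRange) (fun i x => Mor.inv_app_left g hgb i x)
    apply hθb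
    refine bij_of_surj hX hX (fun i x => ?_) le_rfl
    obtain ⟨⟨_, y, rfl⟩, rfl⟩ := (hb i).2 x
    exact ⟨y, rfl⟩
  have hK := hX.ker hX θ
  let u : Mor θ.rangeS.toRep θ.kerS.toRep := θ.kerS.cod θ.rangeS.incl (by
    rintro i ⟨_, x, rfl⟩
    exact hsq i x)
  obtain ⟨e, he, hPe, hLI⟩ := exists_idem hK (fun e => Mor.comp e (Mor.comp u θ.toRange) ≠ 0)
    (fun h => h (Mor.ext' fun i x => by simp))
    (by
      obtain ⟨i, x, hx⟩ := Mor.ne_zero_iff.1 hθ0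
      exact Mor.ne_zero_iff.2 ⟨i, x, fun h => hx (congrArg Subtype.val h)⟩)
    (fun e e' h => by
      by_contra! hc
      apply h
      refine Mor.ext' fun i x => ?_
      have h1 := Mor.eq_zero_iff.1 hc.1 i x
      have h2 := Mor.eq_zero_iff.1 hc.2 i x
      simp only [Mor.comp_app] at h1 h2
      simp [h1, h2])
  have hL := hK.range hK e
  have hginj : (Mor.comp e.toRange u).Inj := by
    refine hfac _ hL _ (Mor.comp θ.kerS.incl e.rangeS.incl)
      (fun i => (Subrep.incl_inj _ i).comp (Subrep.incl_inj _ i)) ?_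
    obtain ⟨i, x, hx⟩ := Mor.ne_zero_iff.1 hPe
    exact Mor.ne_zero_iff.2 ⟨i, x, fun h => hx (congrArg Subtype.val h)⟩
  have hKlt : R.size θ.kerS.toRep < R.size X := by
    by_contra! hle
    have hb := bij_of_inj hK hX (Subrep.incl_inj θ.kerS) hle
    apply hθ0
    refine Mor.ext' fun i x => ?_
    obtain ⟨y, rfl⟩ := (hb i).2 x
    exact y.2
  have hLle : R.size e.rangeS.toRep ≤ R.size θ.kerS.toRep :=
    size_le_of_inj hK (Subrep.incl_inj _)
  have hLb := ih _ (by omega) e.rangeS.toRep le_rfl hL hLI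
  have hext := (brick_one hR hL hLI.1 hLb).2.2
  have hext2 := dmap_surj_left _ hginj hext
  have hkk : θ.toRange.kerS = θ.kerS := Subrep.ext' fun i => by
    ext x
    rw [Mor.mem_kerS, Mor.mem_kerS]
    exact Subtype.ext_iff
  obtain ⟨π', hπ'⟩ : ∃ π' : Mor X e.rangeS.toRep, Mor.comp π' θ.kerS.incl = e.toRange := by
    have := exists_extension θ.toRange θ.toRange_surj hext2
    rw [hkk] at this
    exact this _
  have hb := hI.retract hLI.1 (Mor.comp θ.kerS.incl e.rangeS.incl) π' (fun i x => by
    rw [Mor.comp_app, ← Mor.comp_app π', hπ']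
    obtain ⟨_, y, rfl⟩ := x
    exact Subtype.ext (by
      change e.1 i (e.1 i y) = e.1 i y
      rw [← Mor.comp_app, he]))
  have := size_le_of_inj hL (fun i => ((Mor.comp θ.kerS.incl e.rangeS.incl).inv_bij hb i).1)
  omega

theorem Indec.brick (hR : R.PD) (hX : R.Mem X) (h : X.Indec) (f : Mor X X) (hf : f ≠ 0) : f.Bij :=
  indec_brick hR _ X le_rfl hX h f hf

theorem Indec.one (hR : R.PD) (hX : R.Mem X) (h : X.Indec) :
    Module.finrank F (Mor X X) = 1 ∧ R.form (dimvec F X) (dimvec F X) = 1 ∧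
      Function.Surjective (dmap X X) :=
  brick_one hR hX h.1 fun f hf => Indec.brick hR hX h f hf

end RayData

namespace RayData

open QRep

variable {F : Type} [Field F] {Q : Quiv} {R : RayData Q} {X Y Z : QRep F Q}

theorem form_congr {n n' m m' : Q.V → ℤ} (h : ∀ v ∈ R.T, n v = n' v) (h' : ∀ v ∈ R.T, m v = m' v) :
    R.form n m = R.form n' m' := by
  unfold form
  congr 1
  · exact Finset.sum_congr rfl fun v hv => by rw [h v hv, h' v hv]
  · exact Finset.sum_congr rfl fun a ha => by rw [h _ (R.srcB a ha), h' _ (R.tgtB a ha)]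

theorem form_sub_sub (n m : Q.V → ℤ) : R.form (fun v => n v - m v) (fun v => n v - m v) =
    R.form n n - R.form n m - R.form m n + R.form m m := by
  unfold form
  have h1 : ∀ v, (n v - m v) * (n v - m v) = n v * n v - n v * m v - m v * n v + m v * m v :=
    fun v => by ring
  have h2 : ∀ a, (n (Q.s a) - m (Q.s a)) * (n (Q.t a) - m (Q.t a)) = n (Q.s a) * n (Q.t a) -
    n (Q.s a) * m (Q.t a) - m (Q.s a) * n (Q.t a) + m (Q.s a) * m (Q.t a) := fun v => by ring
  simp only [h1, h2, Finset.sum_add_distrib, Finset.sum_sub_distrib]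
  ring

theorem Indec.scalar (hR : R.PD) (hX : R.Mem X) (h : X.Indec) (f : Mor X X) :
    ∃ c : F, f = c • Mor.id X := by
  obtain ⟨c, hc⟩ := (finrank_eq_one_iff_of_nonzero' (Mor.id X) (id_ne_zero h.1)).1
    (Indec.one hR hX h).1 f
  exact ⟨c, hc.symm⟩

theorem one_le_form (hX : R.Mem X) (hY : ∀ v, FiniteDimensional F (Y.M v))
    (h : Function.Surjective (dmap X Y)) {f : Mor X Y} (hf : f ≠ 0) :
    1 ≤ R.form (dimvec F X) (dimvec F Y) := by
  obtain ⟨hfd, e, he, he0⟩ := R.euler hX hY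
  rw [he0.2 h, Nat.cast_zero, add_zero] at he
  rw [← he]
  have : Nontrivial (Mor X Y) := ⟨⟨f, 0, hf⟩⟩
  exact_mod_cast Module.finrank_pos

theorem exists_indec_image (hX : R.Mem X) (hY : R.Mem Y) {f : Mor X Y} (hf : f ≠ 0) :
    ∃ (L : QRep F Q) (p : Mor X L) (j : Mor L Y), R.Mem L ∧ L.Indec ∧ p.Surj ∧ j.Inj := by
  have hI := hX.range hY f
  obtain ⟨i, x, hx⟩ := Mor.ne_zero_iff.1 hf
  obtain ⟨e, he, -, hL⟩ := exists_idem hI (fun e => e.1 i (f.toRange.1 i x) ≠ 0)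
    (fun h => h rfl) (fun h => hx (congrArg Subtype.val h)) (fun e e' h => by
      by_contra! hc
      exact h (by rw [Mor.add_app, hc.1, hc.2, add_zero]))
  exact ⟨e.rangeS.toRep, Mor.comp e.toRange f.toRange, Mor.comp f.rangeS.incl e.rangeS.incl,
    hI.range hI e, hL, fun i => (e.toRange_surj i).comp (f.toRange_surj i),
    fun i => (Subrep.incl_inj _ i).comp (Subrep.incl_inj _ i)⟩

theorem ne_zero_of_surj {p : Mor X Y} (hp : p.Surj) (h : Y.Nonzero) : p ≠ 0 := by
  obtain ⟨i, y, hy⟩ := h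
  obtain ⟨x, rfl⟩ := hp i y
  exact Mor.ne_zero_iff.2 ⟨i, x, hy⟩

theorem ne_zero_of_inj {p : Mor X Y} (hp : p.Inj) (h : X.Nonzero) : p ≠ 0 := by
  obtain ⟨i, x, hx⟩ := h
  exact Mor.ne_zero_iff.2 ⟨i, x, fun h => hx (hp i (h.trans (map_zero _).symm))⟩

/-- If `q(x - l) ≤ 0` then `x` and `l` agree on the core. -/
theorem PD.eq_of_le (hR : R.PD) {n m : Q.V → ℤ}
    (h : R.form n n - R.form n m - R.form m n + R.form m m ≤ 0) : ∀ v ∈ R.T, n v = m v := by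
  by_contra! hc
  obtain ⟨v, hv, hne⟩ := hc
  have := hR (fun v => n v - m v) ⟨v, hv, sub_ne_zero.2 hne⟩
  rw [form_sub_sub] at this
  omega

theorem size_eq_of_dimvec (h : ∀ v ∈ R.T, dimvec F X v = dimvec F Y v) : R.size X = R.size Y :=
  Finset.sum_congr rfl fun v hv => by
    have := h v hv
    unfold dimvec at this
    exact_mod_cast this

/-- Indecomposables are determined by their dimension vectors. -/
theorem Indec.unique (hR : R.PD) (hX : R.Mem X) (hY : R.Mem Y) (hXi : X.Indec) (hYi : Y.Indec)
    (h : ∀ v ∈ R.T, dimvec F X v = dimvec F Y v) : Iso X Y := by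
  obtain ⟨hx1, hx2, hx3⟩ := Indec.one hR hX hXi
  obtain ⟨hy1, hy2, hy3⟩ := Indec.one hR hY hYi
  obtain ⟨hfd, e, he, he0⟩ := R.euler hX hY.1
  have hq : R.form (dimvec F X) (dimvec F Y) = 1 := by
    rw [← hx2]; exact form_congr (fun _ _ => rfl) (fun v hv => (h v hv).symm)
  have : 0 < Module.finrank F (Mor X Y) := by omega
  obtain ⟨f, hf⟩ := (Module.finrank_pos_iff_exists_ne_zero (R := F)).1 this
  obtain ⟨L, p, j, hL, hLi, hp, hj⟩ := exists_indec_image hX hY hf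
  obtain ⟨-, hl2, -⟩ := Indec.one hR hL hLi
  have h1 := one_le_form hX hL.1 (dmap_surj_right p hp hx3) (ne_zero_of_surj hp hLi.1)
  have h2 := one_le_form hL hY.1 (dmap_surj_left j hj hy3) (ne_zero_of_inj hj hLi.1)
  have h3 : R.form (dimvec F L) (dimvec F X) = R.form (dimvec F L) (dimvec F Y) :=
    form_congr (fun _ _ => rfl) h
  have heq := hR.eq_of_le (n := dimvec F X) (m := dimvec F L) (by omega)
  have hs := size_eq_of_dimvec heq
  have hs2 := size_eq_of_dimvec h
  exact iso_iff.2 ⟨Mor.comp j p, Mor.comp_bij (bij_of_inj hL hY hj (by omega))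
    (bij_of_surj hX hL hp (by omega))⟩

theorem finrank_hom_le_left (hfd : FiniteDimensional F (Mor Z X))
    (hfd' : FiniteDimensional F (Mor Z Y)) {E : QRep F Q} (i : Mor X E) (p : Mor E Y) (hi : i.Inj)
    (hex : ∀ v y, p.1 v y = 0 → ∃ x, i.1 v x = y) :
    FiniteDimensional F (Mor Z E) →
    Module.finrank F (Mor Z E) ≤ Module.finrank F (Mor Z X) + Module.finrank F (Mor Z Y) := by
  intro _
  rw [← LinearMap.finrank_range_add_finrank_ker (Mor.compL Z E Y p), add_comm]
  refine add_le_add ?_ (Submodule.finrank_le _)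
  have : LinearMap.ker (Mor.compL Z E Y p) ≤ LinearMap.range (Mor.compL Z X E i) := by
    intro f hf
    have hf' : ∀ v z, p.1 v (f.1 v z) = 0 := Mor.eq_zero_iff.1 (LinearMap.mem_ker.1 hf)
    have hb : i.toRange.Bij := Mor.bij_iff.2
      ⟨fun v x y hxy => hi v (congrArg Subtype.val hxy), i.toRange_surj⟩
    refine ⟨Mor.comp (i.toRange.inv hb) (i.rangeS.cod f fun v z => hex v _ (hf' v z)), ?_⟩
    refine Mor.ext' fun v z => ?_
    exact congrArg Subtype.val (Mor.inv_app_right i.toRange hb v ((i.rangeS.cod f _).1 v z))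
  exact (Submodule.finrank_mono this).trans (LinearMap.finrank_range_le _)

theorem finrank_hom_le_right (hfd' : FiniteDimensional F (Mor Y Z)) {E : QRep F Q} (i : Mor X E)
    (p : Mor E Y) (hp : p.Surj) (hex : ∀ v y, p.1 v y = 0 → ∃ x, i.1 v x = y) :
    FiniteDimensional F (Mor E Z) →
    Module.finrank F (Mor E Z) ≤ Module.finrank F (LinearMap.range
      ((Mor.compL X E Z).flip i)) + Module.finrank F (Mor Y Z) := by
  intro _
  rw [← LinearMap.finrank_range_add_finrank_ker ((Mor.compL X E Z).flip i)]
  refine Nat.add_le_add_left ?_ _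
  have : LinearMap.ker ((Mor.compL X E Z).flip i) ≤ LinearMap.range ((Mor.compL E Y Z).flip p) := by
    intro f hf
    have hf' : ∀ v z, f.1 v (i.1 v z) = 0 := Mor.eq_zero_iff.1 (LinearMap.mem_ker.1 hf)
    have hk : ∀ v, ∀ x ∈ p.kerS.S v, f.1 v x = 0 := fun v x hx => by
      obtain ⟨x, rfl⟩ := hex v x hx
      exact hf' v x
    have hb : (p.kerS.desc p fun v x hx => hx).Bij := Mor.bij_iff.2 ⟨fun v => by
      rw [← LinearMap.ker_eq_bot, LinearMap.ker_eq_bot']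
      intro x hx
      obtain ⟨x, rfl⟩ := p.kerS.quo_surj v x
      exact (p.kerS.quo_eq_zero v x).2 hx, fun v y => by
        obtain ⟨x, rfl⟩ := hp v y
        exact ⟨p.kerS.quo.1 v x, rfl⟩⟩
    refine ⟨Mor.comp (p.kerS.desc f hk) (Mor.inv _ hb), ?_⟩
    refine Mor.ext' fun v z => ?_
    change (p.kerS.desc f hk).1 v ((Mor.inv _ hb).1 v (p.1 v z)) = f.1 v z
    have h2 : (Mor.inv _ hb).1 v (p.1 v z) = p.kerS.quo.1 v z :=
      Mor.inv_app_left (p.kerS.desc p fun v x hx => hx) hb v (p.kerS.quo.1 v z)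
    rw [h2, Subrep.desc_quo]
  exact (Submodule.finrank_mono this).trans (LinearMap.finrank_range_le _)

/-- The extension of `X` by `Y` with cocycle `η`. -/
def extRep (X Y : QRep F Q) (η : ∀ a, X.M (Q.s a) →ₗ[F] Y.M (Q.t a)) : QRep F Q where
  M v := X.M v × Y.M v
  map a := ((X.map a).comp (LinearMap.fst F _ _)).prod
    ((Y.map a).comp (LinearMap.snd F _ _) + (η a).comp (LinearMap.fst F _ _))

/-- Inclusion of the sub of an extension. -/
def extInr (X Y : QRep F Q) (η : ∀ a, X.M (Q.s a) →ₗ[F] Y.M (Q.t a)) : Mor Y (extRep X Y η) :=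
  ⟨fun i => LinearMap.inr F (X.M i) (Y.M i), mem_HomS.2 fun a x => by
    refine Prod.ext ?_ ?_
    · exact map_zero (X.map a)
    · change Y.map a x + η a 0 = Y.map a x
      rw [map_zero, add_zero]⟩

/-- Projection to the quotient of an extension. -/
def extFst (X Y : QRep F Q) (η : ∀ a, X.M (Q.s a) →ₗ[F] Y.M (Q.t a)) : Mor (extRep X Y η) X :=
  ⟨fun i => LinearMap.fst F (X.M i) (Y.M i), mem_HomS.2 fun _ _ => rfl⟩

theorem Mem.extRep (hX : R.Mem X) (hY : R.Mem Y) (η : ∀ a, X.M (Q.s a) →ₗ[F] Y.M (Q.t a)) :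
    R.Mem (extRep X Y η) := by
  refine ⟨fun v => ?_, fun i k => ⟨?_, ?_⟩⟩
  · have := hX.1 v
    have := hY.1 v
    exact inferInstanceAs (FiniteDimensional F (X.M v × Y.M v))
  · rw [← LinearMap.ker_eq_bot, LinearMap.ker_eq_bot']
    rintro ⟨x, y⟩ h
    have h1 : X.map (R.ra i k) x = 0 := congrArg Prod.fst h
    have h2 : Y.map (R.ra i k) y + η _ x = 0 := congrArg Prod.snd h
    have hx : x = 0 := (hX.2 i k).1 (h1.trans (map_zero _).symm)
    subst hx
    rw [map_zero, add_zero] at h2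
    have hy : y = 0 := (hY.2 i k).1 (h2.trans (map_zero _).symm)
    rw [hy]; rfl
  · rintro ⟨x, y⟩
    obtain ⟨x, rfl⟩ := (hX.2 i k).2 x
    obtain ⟨y', hy'⟩ := (hY.2 i k).2 (y - η _ x)
    refine ⟨(x, y'), Prod.ext rfl ?_⟩
    change Y.map (R.ra i k) y' + η _ x = y
    rw [hy', sub_add_cancel]

theorem dimvec_extRep (η : ∀ a, X.M (Q.s a) →ₗ[F] Y.M (Q.t a)) :
    dimvec F (extRep X Y η) = dimvec F (dsum X Y) := rfl

/-- A nonsplit extension has a smaller endomorphism algebra than the direct sum. -/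
theorem finrank_end_ext_lt (hX : R.Mem X) (hY : R.Mem Y)
    (η : ∀ a, X.M (Q.s a) →ₗ[F] Y.M (Q.t a)) (hη : ∀ φ, dmap X Y φ ≠ η) :
    Module.finrank F (Mor (extRep X Y η) (extRep X Y η)) <
      Module.finrank F (Mor (dsum X Y) (dsum X Y)) := by
  have hE := hX.extRep hY η
  have fd : ∀ {A B : QRep F Q}, R.Mem A → R.Mem B → FiniteDimensional F (Mor A B) :=
    fun hA hB => (R.euler hA hB.1).1
  have hex : ∀ v y, (extFst X Y η).1 v y = 0 → ∃ x, (extInr X Y η).1 v x = y := by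
    rintro v ⟨x, y⟩ h
    exact ⟨y, Prod.ext (Eq.symm h) rfl⟩
  have hinj : (extInr X Y η).Inj := fun v x y h => congrArg Prod.snd h
  have hsurj : (extFst X Y η).Surj := fun v x => ⟨(x, 0), rfl⟩
  have h1 := finrank_hom_le_left (fd hE hY) (fd hE hX) (extInr X Y η) (extFst X Y η) hinj hex
    (fd hE hE)
  have h2 := finrank_hom_le_right (Z := X) (fd hX hX) (extInr X Y η) (extFst X Y η) hsurj hex
    (fd hE hX)
  have h3 := finrank_hom_le_right (Z := Y) (fd hX hY) (extInr X Y η) (extFst X Y η) hsurj hex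
    (fd hE hY)
  have := fd hY hY
  have := fd hY hX
  have := fd hX hY
  have := fd hX hX
  have h2' := Submodule.finrank_le (LinearMap.range
      ((Mor.compL Y (extRep X Y η) X).flip (extInr X Y η)))
  have h3' : Module.finrank F (LinearMap.range
      ((Mor.compL Y (extRep X Y η) Y).flip (extInr X Y η))) < Module.finrank F (Mor Y Y) := by
    refine Submodule.finrank_lt fun htop => ?_
    obtain ⟨r, hr⟩ := LinearMap.range_eq_top.1 htop (Mor.id Y)
    have hr' : ∀ v y, r.1 v (0, y) = y := fun v y => by
      have := congrArg (fun f : Mor Y Y => f.1 v y) hr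
      exact this
    have hr2 : ∀ v x y, r.1 v (x, y) = r.1 v (x, 0) + y := fun v x y => by
      have h5 : ((x, y) : X.M v × Y.M v) = (x, 0) + (0, y) := by simp
      conv_lhs => rw [h5]
      exact (map_add (r.1 v) _ _).trans (by rw [hr'])
    refine hη (fun v => (r.1 v).comp (LinearMap.inl F (X.M v) (Y.M v))) ?_
    funext a; ext x
    have h4 : Y.map a (r.1 _ ((x, 0) : X.M _ × Y.M _)) =
        r.1 _ ((X.map a x, Y.map a 0 + η a x) : X.M _ × Y.M _) := r.comm a _
    have h7 := hr2 _ (X.map a x) (Y.map a 0 + η a x)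
    rw [map_zero, zero_add] at h4 h7
    change Y.map a (r.1 _ (x, 0)) - r.1 _ (X.map a x, 0) = η a x
    rw [h4]
    exact sub_eq_iff_eq_add'.2 h7
  let Φ : (Mor X X × Mor Y X) × (Mor X Y × Mor Y Y) →ₗ[F] Mor (dsum X Y) (dsum X Y) :=
    { toFun := fun f =>
        (Mor.comp (inlM X Y) (Mor.comp f.1.1 (fstM X Y)) +
          Mor.comp (inlM X Y) (Mor.comp f.1.2 (sndM X Y))) +
        (Mor.comp (inrM X Y) (Mor.comp f.2.1 (fstM X Y)) +
          Mor.comp (inrM X Y) (Mor.comp f.2.2 (sndM X Y)))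
      map_add' := fun f g => Mor.ext' fun v x => by simp; abel
      map_smul' := fun c g => Mor.ext' fun v x => by simp }
  have hΦ : Function.Injective Φ := by
    rw [← LinearMap.ker_eq_bot, LinearMap.ker_eq_bot']
    rintro ⟨⟨f1, f2⟩, ⟨f3, f4⟩⟩ h
    have h' : ∀ v x, ((inlM X Y).1 v (f1.1 v ((fstM X Y).1 v x)) +
      (inlM X Y).1 v (f2.1 v ((sndM X Y).1 v x))) + ((inrM X Y).1 v (f3.1 v ((fstM X Y).1 v x)) +
      (inrM X Y).1 v (f4.1 v ((sndM X Y).1 v x))) = 0 := Mor.eq_zero_iff.1 h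
    have e1 : f1 = 0 := Mor.ext' fun v x => by
      have := congrArg ((fstM X Y).1 v) (h' v ((inlM X Y).1 v x))
      simpa [fst_inl, fst_inr, snd_inl] using this
    have e2 : f2 = 0 := Mor.ext' fun v x => by
      have := congrArg ((fstM X Y).1 v) (h' v ((inrM X Y).1 v x))
      simpa [fst_inl, fst_inr, snd_inr] using this
    have e3 : f3 = 0 := Mor.ext' fun v x => by
      have := congrArg ((sndM X Y).1 v) (h' v ((inlM X Y).1 v x))
      simpa [fst_inl, snd_inr, snd_inl] using this
    have e4 : f4 = 0 := Mor.ext' fun v x => by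
      have := congrArg ((sndM X Y).1 v) (h' v ((inrM X Y).1 v x))
      simpa [fst_inr, snd_inr, snd_inl] using this
    rw [e1, e2, e3, e4]; rfl
  have := fd (hX.dsum hY) (hX.dsum hY)
  have h5 := LinearMap.finrank_le_finrank_of_injective hΦ
  rw [Module.finrank_prod, Module.finrank_prod, Module.finrank_prod] at h5
  omega

theorem dmap_surj_dsum {A B C D : QRep F Q} (h1 : Function.Surjective (dmap A C))
    (h2 : Function.Surjective (dmap A D)) (h3 : Function.Surjective (dmap B C))
    (h4 : Function.Surjective (dmap B D)) :
    Function.Surjective (dmap (dsum A B) (dsum C D)) := by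
  intro η
  obtain ⟨φ1, e1⟩ := h1 fun a => ((fstM C D).1 _).comp ((η a).comp ((inlM A B).1 _))
  obtain ⟨φ2, e2⟩ := h2 fun a => ((sndM C D).1 _).comp ((η a).comp ((inlM A B).1 _))
  obtain ⟨φ3, e3⟩ := h3 fun a => ((fstM C D).1 _).comp ((η a).comp ((inrM A B).1 _))
  obtain ⟨φ4, e4⟩ := h4 fun a => ((sndM C D).1 _).comp ((η a).comp ((inrM A B).1 _))
  refine ⟨fun v => ((φ1 v).coprod (φ3 v)).prod ((φ2 v).coprod (φ4 v)), ?_⟩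
  funext a
  refine LinearMap.ext fun x => ?_
  have hx : x = (inlM A B).1 _ x.1 + (inrM A B).1 _ x.2 :=
    Prod.ext (add_zero _).symm (zero_add _).symm
  have g1 := LinearMap.congr_fun (congrFun e1 a) x.1
  have g2 := LinearMap.congr_fun (congrFun e2 a) x.1
  have g3 := LinearMap.congr_fun (congrFun e3 a) x.2
  have g4 := LinearMap.congr_fun (congrFun e4 a) x.2
  refine Prod.ext ?_ ?_
  · have : (η a x).1 = ((fstM C D).1 _).comp ((η a).comp ((inlM A B).1 _)) x.1 +
        ((fstM C D).1 _).comp ((η a).comp ((inrM A B).1 _)) x.2 := by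
      conv_lhs => rw [hx, map_add]
      rfl
    rw [this, ← g1, ← g3]
    change C.map a (φ1 _ x.1 + φ3 _ x.2) - (φ1 _ (A.map a x.1) + φ3 _ (B.map a x.2)) =
      (C.map a (φ1 _ x.1) - φ1 _ (A.map a x.1)) + (C.map a (φ3 _ x.2) - φ3 _ (B.map a x.2))
    rw [map_add]; abel
  · have : (η a x).2 = ((sndM C D).1 _).comp ((η a).comp ((inlM A B).1 _)) x.1 +
        ((sndM C D).1 _).comp ((η a).comp ((inrM A B).1 _)) x.2 := by
      conv_lhs => rw [hx, map_add]
      rfl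
    rw [this, ← g2, ← g4]
    change D.map a (φ2 _ x.1 + φ4 _ x.2) - (φ2 _ (A.map a x.1) + φ4 _ (B.map a x.2)) =
      (D.map a (φ2 _ x.1) - φ2 _ (A.map a x.1)) + (D.map a (φ4 _ x.2) - φ4 _ (B.map a x.2))
    rw [map_add]; abel

theorem Iso.dsum_comm (A B : QRep F Q) : Iso (dsum A B) (dsum B A) :=
  iso_iff.2 ⟨⟨fun v => (LinearEquiv.prodComm F (A.M v) (B.M v)).toLinearMap,
    mem_HomS.2 fun _ _ => rfl⟩, fun v => (LinearEquiv.prodComm F (A.M v) (B.M v)).bijective⟩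

theorem Iso.dsum_assoc (A B C : QRep F Q) : Iso (dsum (dsum A B) C) (dsum A (dsum B C)) :=
  iso_iff.2 ⟨⟨fun v => (LinearEquiv.prodAssoc F (A.M v) (B.M v) (C.M v)).toLinearMap,
    mem_HomS.2 fun _ _ => rfl⟩,
    fun v => (LinearEquiv.prodAssoc F (A.M v) (B.M v) (C.M v)).bijective⟩

theorem Iso.dsum_left {A A' : QRep F Q} (h : Iso A A') (B : QRep F Q) :
    Iso (dsum A B) (dsum A' B) := by
  obtain ⟨f, hf⟩ := iso_iff.1 h
  exact iso_iff.2 ⟨⟨fun v => (f.1 v).prodMap LinearMap.id, mem_HomS.2 fun a x =>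
    Prod.ext (f.comm a x.1) rfl⟩, fun v => (hf v).prodMap Function.bijective_id⟩

theorem dmap_surj_iso {A B : QRep F Q} (h : Iso A B) (hs : Function.Surjective (dmap B B)) :
    Function.Surjective (dmap A A) := by
  obtain ⟨f, hf⟩ := iso_iff.1 h
  exact dmap_surj_left f (fun i => (hf i).1)
    (dmap_surj_right (f.inv hf) (fun i => (f.inv_bij hf i).2) hs)

theorem dimvec_iso {A B : QRep F Q} (h : Iso A B) : dimvec F A = dimvec F B := by
  funext v
  unfold dimvec
  rw [h.finrank_eq]

theorem Mem.of_dsum_left {A B : QRep F Q} (h : R.Mem (QRep.dsum A B)) : R.Mem A := by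
  refine ⟨fun v => ?_, fun i k => ?_⟩
  · have : FiniteDimensional F (A.M v × B.M v) := h.1 v
    exact Module.Finite.of_surjective (LinearMap.fst F (A.M v) (B.M v)) LinearMap.fst_surjective
  · have := h.2 i k
    refine ⟨fun x y hxy => ?_, fun y => ?_⟩
    · have h2 := this.1 (a₁ := ((x, 0) : A.M _ × B.M _)) (a₂ := ((y, 0) : A.M _ × B.M _))
        (Prod.ext hxy rfl)
      exact congrArg Prod.fst h2
    · obtain ⟨x, hx⟩ := this.2 ((y, 0) : A.M _ × B.M _)
      exact ⟨x.1, congrArg Prod.fst hx⟩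

theorem size_dsum {A B : QRep F Q} (hA : R.Mem A) (hB : R.Mem B) :
    R.size (dsum A B) = R.size A + R.size B := by
  unfold size
  rw [← Finset.sum_add_distrib]
  refine Finset.sum_congr rfl fun v _ => ?_
  have := hA.1 v
  have := hB.1 v
  exact Module.finrank_prod

theorem size_iso {A B : QRep F Q} (h : Iso A B) : R.size A = R.size B :=
  Finset.sum_congr rfl fun v _ => h.finrank_eq v

theorem size_pos {A : QRep F Q} (hA : R.Mem A) (h : A.Nonzero) : 0 < R.size A := by
  obtain ⟨v, hv, x, hx⟩ := nonzero_core (fun i k => (hA.2 i k).2) h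
  have := hA.1 v
  have : Nontrivial (A.M v) := ⟨⟨x, 0, hx⟩⟩
  exact Finset.sum_pos' (fun _ _ => Nat.zero_le _) ⟨v, hv, Module.finrank_pos⟩

/-- If `Ext` vanishes between complementary summands then it vanishes altogether. -/
theorem rigid_of_summands (hR : R.PD) : ∀ n (X : QRep F Q), R.size X ≤ n → R.Mem X →
    (∀ A B : QRep F Q, Iso X (dsum A B) → Function.Surjective (dmap A B)) →
    Function.Surjective (dmap X X) := by
  intro n
  induction n using Nat.strong_induction_on with
  | _ n ih =>
  intro X hn hX hsum
  by_cases h0 : X.Nonzero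
  swap
  · unfold Nonzero at h0
    push Not at h0
    intro η
    refine ⟨0, ?_⟩
    funext a; ext x
    rw [h0 _ x, map_zero, map_zero]
  by_cases hI : X.Indec
  · exact (Indec.one hR hX hI).2.2
  have : ∃ A B : QRep F Q, A.Nonzero ∧ B.Nonzero ∧ Iso X (dsum A B) := by
    by_contra! hc
    exact hI ⟨h0, hc⟩
  obtain ⟨A, B, hA, hB, hi⟩ := this
  have hAm : R.Mem A := Mem.of_dsum_left (hX.iso hi)
  have hBm : R.Mem B := Mem.of_dsum_left (hX.iso (hi.trans (Iso.dsum_comm A B)))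
  have hsz : R.size X = R.size A + R.size B := (size_iso hi).trans (size_dsum hAm hBm)
  have hsA := size_pos hAm hA
  have hsB := size_pos hBm hB
  have key : ∀ A B : QRep F Q, Iso X (dsum A B) → ∀ A1 A2 : QRep F Q, Iso A (dsum A1 A2) →
      Function.Surjective (dmap A1 A2) := by
    intro A B hi A1 A2 hA
    have := hsum A1 (dsum A2 B) (hi.trans ((Iso.dsum_left hA B).trans (Iso.dsum_assoc _ _ _)))
    exact dmap_surj_right (fstM A2 B) (fun i x => ⟨(x, 0), rfl⟩) this
  have hi' := hi.trans (Iso.dsum_comm A B)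
  refine dmap_surj_iso hi (dmap_surj_dsum ?_ (hsum A B hi) (hsum B A hi') ?_)
  · exact ih (R.size A) (by omega) A le_rfl hAm (key A B hi)
  · exact ih (R.size B) (by omega) B le_rfl hBm (key B A hi')

theorem indec_of_finrank_end (h : X.Nonzero) (h1 : Module.finrank F (Mor X X) = 1) : X.Indec := by
  refine indec_iff.2 ⟨h, fun e he => ?_⟩
  obtain ⟨c, rfl⟩ := (finrank_eq_one_iff_of_nonzero' (Mor.id X) (id_ne_zero h)).1 h1 e
  obtain ⟨i, x, hx⟩ := h
  have h2 := congrArg (fun f : Mor X X => f.1 i x) he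
  simp only [Mor.comp_app, Mor.smul_app, Mor.id_app, smul_smul] at h2
  rw [← sub_eq_zero, ← sub_smul, smul_eq_zero, or_iff_left hx] at h2
  have h3 : c * (c - 1) = 0 := by linear_combination h2
  rcases mul_eq_zero.1 h3 with h4 | h4
  · left; rw [h4, zero_smul]
  · right; rw [sub_eq_zero.1 h4, one_smul]

/-- Every positive root, constant along the rays, is the dimension vector of an indecomposable. -/
theorem exists_indec (F : Type) [Field F] (hR : R.PD) (n : Q.V → ℤ) (hn : ∀ v, 0 ≤ n v)
    (hc : ∀ i k, n (Q.s (R.ra i k)) = n (Q.t (R.ra i k))) (hq : R.form n n = 1) :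
    ∃ X : QRep F Q, R.Mem X ∧ X.Indec ∧ dimvec F X = n := by
  classical
  have hex : ∃ d, ∃ X : QRep F Q, R.Mem X ∧ dimvec F X = n ∧ Module.finrank F (Mor X X) = d := by
    refine ⟨_, ⟨fun v => Fin (n v).toNat → F, fun a => if h : n (Q.s a) = n (Q.t a) then
      LinearMap.funLeft F F (Fin.cast (by rw [h])) else 0⟩, ⟨fun v => ?_, fun i k => ?_⟩, ?_, rfl⟩
    · exact inferInstanceAs (FiniteDimensional F (Fin (n v).toNat → F))
    · simp only [dif_pos (hc i k)]
      exact (LinearEquiv.funCongrLeft F F (finCongr (by rw [hc i k]))).bijective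
    · funext v
      unfold dimvec
      have : Module.finrank F (Fin (n v).toNat → F) = (n v).toNat := Module.finrank_fin_fun F
      change ((Module.finrank F (Fin (n v).toNat → F) : ℕ) : ℤ) = n v
      rw [this, Int.toNat_of_nonneg (hn v)]
  obtain ⟨X, hX, hdim, hd⟩ := Nat.find_spec hex
  have hmin : ∀ Y : QRep F Q, R.Mem Y → dimvec F Y = n →
      Module.finrank F (Mor X X) ≤ Module.finrank F (Mor Y Y) := fun Y h1 h2 => by
    rw [hd]; exact Nat.find_min' hex ⟨Y, h1, h2, rfl⟩
  have hrig : Function.Surjective (dmap X X) := by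
    refine rigid_of_summands hR _ X le_rfl hX fun A B hi => ?_
    by_contra hns
    simp only [Function.Surjective, not_forall, not_exists] at hns
    obtain ⟨η, hη⟩ := hns
    have hA : R.Mem A := Mem.of_dsum_left (hX.iso hi)
    have hB : R.Mem B := Mem.of_dsum_left (hX.iso (hi.trans (Iso.dsum_comm A B)))
    have h1 := finrank_end_ext_lt hA hB η hη
    have h2 := hmin _ (hA.extRep hB η) ((dimvec_extRep η).trans
      ((dimvec_iso hi).symm.trans hdim))
    have h3 : Module.finrank F (Mor X X) = Module.finrank F (Mor (dsum A B) (dsum A B)) := by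
      obtain ⟨f, hf⟩ := iso_iff.1 hi
      refine LinearEquiv.finrank_eq (LinearEquiv.ofLinearMap
        ((Mor.compL (dsum A B) X (dsum A B) f).comp
          ((Mor.compL (dsum A B) X X).flip (f.inv hf)))
        ((Mor.compL X (dsum A B) X (f.inv hf)).comp
          ((Mor.compL X (dsum A B) (dsum A B)).flip f)) ?_ ?_)
      · refine LinearMap.ext fun g => Mor.ext' fun v x => ?_
        simp
      · refine LinearMap.ext fun g => Mor.ext' fun v x => ?_
        simp
    omega
  obtain ⟨-, e, he, he0⟩ := R.euler hX hX.1
  rw [he0.2 hrig, hdim, hq] at he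
  refine ⟨X, hX, indec_of_finrank_end ?_ (by exact_mod_cast he), hdim⟩
  by_contra hz
  unfold Nonzero at hz
  push Not at hz
  have : n = fun _ => 0 := by
    rw [← hdim]
    funext v
    have : Subsingleton (X.M v) := ⟨fun x y => by rw [hz v x, hz v y]⟩
    unfold dimvec
    rw [Module.finrank_zero_of_subsingleton]; rfl
  rw [this] at hq
  simp [form] at hq

end RayData

namespace RayData

open QRep

variable {F : Type} [Field F] {Q : Quiv} {R : RayData Q} {X Y Z : QRep F Q}

theorem PD.congr {R' : RayData Q} (h : R.PD) (hT : R.T = R'.T) (hB : R.B = R'.B) : R'.PD := by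
  unfold PD form at *
  rwa [← hT, ← hB]

theorem shift_zero_T : (R.shift 0).T = R.T := by
  ext v; simp [mem_shift_T]

theorem shift_zero_B : (R.shift 0).B = R.B := by
  ext v; simp [mem_shift_B]

theorem PD.of_forall_shift (h : ∀ N, (R.shift N).PD) : R.PD :=
  (h 0).congr shift_zero_T shift_zero_B

theorem PD.shift_shift (h : ∀ N, (R.shift N).PD) (M N : ℕ) : ((R.shift M).shift N).PD := by
  refine (h (M + N)).congr ?_ ?_
  · ext v
    simp only [mem_shift_T]
    constructor
    · rintro (h | ⟨i, k, hk, rfl⟩)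
      · exact Or.inl (Or.inl h)
      · by_cases hkM : k < M
        · exact Or.inl (Or.inr ⟨i, k, hkM, rfl⟩)
        · exact Or.inr ⟨i, k - M, by omega, by
            change _ = Q.t (R.ra i (M + (k - M))); rw [Nat.add_sub_cancel' (by omega)]⟩
    · rintro ((h | ⟨i, k, hk, rfl⟩) | ⟨i, k, hk, rfl⟩)
      · exact Or.inl h
      · exact Or.inr ⟨i, k, by omega, rfl⟩
      · exact Or.inr ⟨i, M + k, by omega, rfl⟩
  · ext v
    simp only [mem_shift_B]
    constructor
    · rintro (h | ⟨i, k, hk, rfl⟩)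
      · exact Or.inl (Or.inl h)
      · by_cases hkM : k < M
        · exact Or.inl (Or.inr ⟨i, k, hkM, rfl⟩)
        · exact Or.inr ⟨i, k - M, by omega, by
            change _ = R.ra i (M + (k - M)); rw [Nat.add_sub_cancel' (by omega)]⟩
    · rintro ((h | ⟨i, k, hk, rfl⟩) | ⟨i, k, hk, rfl⟩)
      · exact Or.inl h
      · exact Or.inr ⟨i, k, by omega, rfl⟩
      · exact Or.inr ⟨i, M + k, by omega, rfl⟩

theorem PD.nonneg (h : R.PD) (n : Q.V → ℤ) : 0 ≤ R.form n n := by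
  by_cases h0 : ∃ v ∈ R.T, n v ≠ 0
  · exact (h n h0).le
  · push Not at h0
    have : R.form n n = R.form (fun _ => 0) (fun _ => 0) := form_congr h0 h0
    rw [this]; simp [form]

theorem PD.eq_zero (h : R.PD) {n : Q.V → ℤ} (hn : R.form n n ≤ 0) : ∀ v ∈ R.T, n v = 0 := by
  by_contra hc
  push Not at hc
  exact absurd (h n hc) (not_lt.2 hn)

theorem two_mul_sum_sq (r : ℕ → ℤ) (N : ℕ) :
    2 * ∑ k ∈ Finset.range N, (r (k + 1) * r (k + 1) - r k * r (k + 1)) =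
      ∑ k ∈ Finset.range N, (r (k + 1) - r k) ^ 2 + r N ^ 2 - r 0 ^ 2 := by
  induction N with
  | zero => simp
  | succ N ih => rw [Finset.sum_range_succ, mul_add, ih, Finset.sum_range_succ]; ring

theorem two_mul_form_shift (N : ℕ) (n : Q.V → ℤ) :
    2 * (R.shift N).form n n = (2 * R.form n n - ∑ i, n (Q.s (R.ra i 0)) ^ 2) +
      ∑ i, (∑ k ∈ Finset.range N, (n (Q.t (R.ra i k)) - n (Q.s (R.ra i k))) ^ 2 +
        n (Q.s (R.ra i N)) ^ 2) := by
  rw [form_shift, mul_add, Finset.mul_sum]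
  have : ∀ i, 2 * ∑ k ∈ Finset.range N, (n (Q.t (R.ra i k)) * n (Q.t (R.ra i k)) -
      n (Q.s (R.ra i k)) * n (Q.t (R.ra i k))) =
      (∑ k ∈ Finset.range N, (n (Q.t (R.ra i k)) - n (Q.s (R.ra i k))) ^ 2 +
        n (Q.s (R.ra i N)) ^ 2) - n (Q.s (R.ra i 0)) ^ 2 := fun i => by
    have := two_mul_sum_sq (fun k => n (Q.s (R.ra i k))) N
    simpa only [R.src_succ] using this
  rw [Finset.sum_congr rfl fun i _ => this i, Finset.sum_sub_distrib]
  ring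

theorem sum_sq_le_two_mul_form (h : ∀ N, (R.shift N).PD) (n : Q.V → ℤ) :
    ∑ i, n (Q.s (R.ra i 0)) ^ 2 ≤ 2 * R.form n n := by
  by_contra hlt
  push Not at hlt
  set C := ∑ i, n (Q.s (R.ra i 0)) ^ 2 with hC
  have hC0 : 0 ≤ C := Finset.sum_nonneg fun i _ => sq_nonneg _
  set N : ℕ := C.toNat + 1 with hN
  have hNC : (N : ℤ) = C + 1 := by rw [hN]; push_cast; rw [Int.toNat_of_nonneg hC0]
  obtain ⟨f, hf1, hf2⟩ := R.exists_rec (C := fun _ => ℤ) (fun v _ => N * n v)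
    (fun i k _ => (N - (k + 1)) * n (Q.s (R.ra i 0)))
  have hray : ∀ i k, f (Q.s (R.ra i k)) = (N - k) * n (Q.s (R.ra i 0)) := by
    intro i k
    cases k with
    | zero => rw [hf1 _ (R.src0 i)]; simp
    | succ k => rw [R.src_succ, hf2]; push_cast; ring
  have h1 := two_mul_form_shift (R := R) N f
  have h2 := (h N).nonneg f
  have h3 : R.form f f = N * N * R.form n n := by
    rw [← form_mul]
    exact form_congr (fun v hv => hf1 v hv) (fun v hv => hf1 v hv)
  have h4 : ∀ i, (∑ k ∈ Finset.range N, (f (Q.t (R.ra i k)) - f (Q.s (R.ra i k))) ^ 2 +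
        f (Q.s (R.ra i N)) ^ 2) = N * n (Q.s (R.ra i 0)) ^ 2 := by
    intro i
    have : ∀ k, (f (Q.t (R.ra i k)) - f (Q.s (R.ra i k))) ^ 2 = n (Q.s (R.ra i 0)) ^ 2 := by
      intro k
      rw [← R.src_succ, hray, hray]; push_cast; ring
    rw [Finset.sum_congr rfl fun k _ => this k, hray]; simp
  have h5 : ∀ i, f (Q.s (R.ra i 0)) ^ 2 = N * N * n (Q.s (R.ra i 0)) ^ 2 := by
    intro i; rw [hray]; push_cast; ring
  simp only [h4, h5, h3, ← Finset.mul_sum] at h1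
  rw [← hC] at h1
  nlinarith

/-- A positive root supported on the core decreases along the rays and is bounded. -/
theorem root_bounds (h : ∀ N, (R.shift N).PD) {n : Q.V → ℤ} (hn : ∀ v, 0 ≤ n v) {N : ℕ}
    (hq : (R.shift N).form n n = 1) (h0 : ∃ v ∈ R.T, n v ≠ 0) :
    (∀ i, ∀ k < N, n (Q.t (R.ra i k)) ≤ n (Q.s (R.ra i k))) ∧
      (∀ i, n (Q.s (R.ra i 0)) ≤ 2) ∧ R.form n n ≤ 3 := by
  have h1 := two_mul_form_shift (R := R) N n
  have h2 := sum_sq_le_two_mul_form h n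
  rw [hq] at h1
  set G : R.ι → ℤ := fun i => ∑ k ∈ Finset.range N, (n (Q.t (R.ra i k)) - n (Q.s (R.ra i k))) ^ 2 +
        n (Q.s (R.ra i N)) ^ 2 with hG
  have hsum : ∑ i, G i ≤ 2 := by linarith
  have key : ∀ i, G i = n (Q.s (R.ra i 0)) + ∑ k ∈ Finset.range N,
      ((n (Q.t (R.ra i k)) - n (Q.s (R.ra i k))) ^ 2 + (n (Q.t (R.ra i k)) - n (Q.s (R.ra i k)))) +
      (n (Q.s (R.ra i N)) ^ 2 - n (Q.s (R.ra i N))) := by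
    intro i
    have := Finset.sum_range_sub (fun k => n (Q.s (R.ra i k))) N
    simp only [R.src_succ] at this
    rw [Finset.sum_add_distrib, this]
    simp only [hG]; ring
  have hsq : ∀ x : ℤ, 0 ≤ x ^ 2 + x := fun x => by
    rcases le_or_gt 0 x with hx | hx <;> nlinarith
  have hsq' : ∀ x : ℤ, 0 ≤ x ^ 2 - x := fun x => by have := hsq (-x); linarith [neg_sq x]
  have hge : ∀ i, n (Q.s (R.ra i 0)) ≤ G i := fun i => by
    rw [key]
    have := Finset.sum_nonneg (s := Finset.range N) fun k _ =>
      hsq (n (Q.t (R.ra i k)) - n (Q.s (R.ra i k)))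
    have := hsq' (n (Q.s (R.ra i N)))
    linarith
  have hG0 : ∀ i, 0 ≤ G i := fun i => (hn _).trans (hge i)
  have hGi : ∀ i, G i ≤ ∑ j, G j := fun i =>
    Finset.single_le_sum (f := G) (fun j _ => hG0 j) (Finset.mem_univ i)
  have hc2 : ∀ i, n (Q.s (R.ra i 0)) ≤ 2 := fun i => (hge i).trans ((hGi i).trans hsum)
  refine ⟨fun i k hk => ?_, hc2, ?_⟩
  · by_contra hlt
    push Not at hlt
    have hup : n (Q.s (R.ra i 0)) + 2 ≤ G i := by
      rw [key]
      have h3 := Finset.single_le_sum (f := fun k => (n (Q.t (R.ra i k)) - n (Q.s (R.ra i k))) ^ 2 +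
        (n (Q.t (R.ra i k)) - n (Q.s (R.ra i k)))) (fun j _ => hsq _) (Finset.mem_range.2 hk)
      have h4 := hsq' (n (Q.s (R.ra i N)))
      nlinarith
    have h5 : ∀ j, n (Q.s (R.ra j 0)) = 0 := by
      intro j
      by_cases hj : j = i
      · subst hj
        linarith [hn (Q.s (R.ra j 0)), hGi j]
      · classical
        have h6 : G i + G j ≤ ∑ j, G j := by
          rw [← Finset.sum_pair (Ne.symm hj)]
          exact Finset.sum_le_sum_of_subset_of_nonneg (Finset.subset_univ _) fun j _ _ => hG0 j
        linarith [hn (Q.s (R.ra j 0)), hn (Q.s (R.ra i 0)), hge j]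
    have h7 : R.form n n ≤ 0 := by
      have : ∑ i, n (Q.s (R.ra i 0)) ^ 2 = 0 := by simp [h5]
      linarith [hGi i, h5 i]
    obtain ⟨v, hv, hv0⟩ := h0
    exact hv0 ((PD.of_forall_shift h).eq_zero h7 v hv)
  · have h8 : ∑ i, n (Q.s (R.ra i 0)) ^ 2 ≤ ∑ i, 2 * G i :=
      Finset.sum_le_sum fun i _ => by nlinarith [hn (Q.s (R.ra i 0)), hc2 i, hge i]
    rw [← Finset.mul_sum] at h8
    have := Finset.sum_nonneg (s := Finset.univ) fun i _ => hG0 i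
    linarith

/-- Vectors with small form are determined by their residues modulo four. -/
theorem eq_of_mod_four (h : R.PD) {n m : Q.V → ℤ} (hn : R.form n n ≤ 3) (hm : R.form m m ≤ 3)
    (hmod : ∀ v ∈ R.T, ((n v : ℤ) : ZMod 4) = (m v : ℤ)) : ∀ v ∈ R.T, n v = m v := by
  have hdvd : ∀ v ∈ R.T, (4 : ℤ) ∣ n v - m v := fun v hv => by
    have := (ZMod.intCast_eq_intCast_iff_dvd_sub _ _ 4).1 (hmod v hv)
    rw [dvd_sub_comm]; exact_mod_cast this
  set g : Q.V → ℤ := fun v => (n v - m v) / 4 with hg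
  have hg4 : ∀ v ∈ R.T, n v - m v = 4 * g v := fun v hv => (Int.mul_ediv_cancel' (hdvd v hv)).symm
  have h1 : R.form (fun v => n v - m v) (fun v => n v - m v) = 4 * 4 * R.form g g := by
    rw [← form_mul]; exact form_congr hg4 hg4
  have h2 : R.form (fun v => n v - m v) (fun v => n v - m v) +
      R.form (fun v => n v - -m v) (fun v => n v - -m v) = 2 * R.form n n + 2 * R.form m m := by
    unfold form
    rw [sub_add_sub_comm, ← Finset.sum_add_distrib, ← Finset.sum_add_distrib, mul_sub, mul_sub,
      sub_add_sub_comm]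
    simp only [Finset.mul_sum, ← Finset.sum_add_distrib]
    congr 1 <;> refine Finset.sum_congr rfl fun _ _ => by ring
  have h3 := h.nonneg fun v => n v - -m v
  have h4 : R.form g g ≤ 0 := by omega
  intro v hv
  have := h.eq_zero h4 v hv
  have := hg4 v hv
  omega

end RayData

namespace RayData

open QRep

variable {F : Type} [Field F] {Q : Quiv} {R : RayData Q} {X Y Z : QRep F Q}

theorem Mem.bij {N : ℕ} (hX : (R.shift N).Mem X) (i : R.ι) {k : ℕ} (hk : N ≤ k) :
    Function.Bijective (X.map (R.ra i k)) := by
  have : Function.Bijective (X.map (R.ra i (N + (k - N)))) := hX.2 i (k - N)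
  rwa [Nat.add_sub_cancel' hk] at this

theorem indec_bounds (h : ∀ N, (R.shift N).PD) (hX : X.IsFLEI) (hXi : X.Indec)
    (h0 : ∃ v ∈ R.T, ∃ x : X.M v, x ≠ 0) :
    (∀ i k, Function.Surjective (X.map (R.ra i k))) ∧
      (∀ i, dimvec F X (Q.s (R.ra i 0)) ≤ 2) ∧ R.form (dimvec F X) (dimvec F X) ≤ 3 := by
  obtain ⟨N, hN⟩ := (flei_iff (R := R)).1 hX
  obtain ⟨-, h1, h2⟩ := Indec.one (h N) hN hXi
  obtain ⟨v, hv, x, hx⟩ := h0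
  obtain ⟨h3, h4, h5⟩ := root_bounds h (fun v => Int.natCast_nonneg _) h1
    ⟨v, hv, dimvec_ne_zero hN hx⟩
  refine ⟨fun i k => ?_, h4, h5⟩
  rcases lt_or_ge k N with hk | hk
  · rcases max_rank h2 (R.ra i k) with hi | hs
    · have := hN.1
      refine (LinearMap.injective_iff_surjective_of_finrank_eq_finrank ?_).1 hi
      exact le_antisymm (LinearMap.finrank_le_finrank_of_injective hi)
        (by exact_mod_cast h3 i k hk)
    · exact hs
  · exact (hN.bij i hk).2

/-- Indecomposables decreasing along the rays, agreeing on the core and comparable outside it, are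
isomorphic as soon as there is a nonzero morphism between them. -/
theorem iso_of_le (h : ∀ N, (R.shift N).PD) {N : ℕ} (hX : (R.shift N).Mem X)
    (hY : (R.shift N).Mem Y) (hXi : X.Indec) (hYi : Y.Indec)
    (hXs : ∀ i k, Function.Surjective (X.map (R.ra i k)))
    (hYs : ∀ i k, Function.Surjective (Y.map (R.ra i k)))
    (hT : ∀ v ∈ R.T, dimvec F X v = dimvec F Y v)
    (hle : ∀ i k, dimvec F X (Q.t (R.ra i k)) ≤ dimvec F Y (Q.t (R.ra i k)))
    {f : Mor X Y} (hf : f ≠ 0) : Iso X Y := by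
  obtain ⟨L, p, j, hL, hLi, hp, hj⟩ := exists_indec_image hX hY hf
  obtain ⟨-, hqX, hsX⟩ := Indec.one (h N) hX hXi
  obtain ⟨-, hqY, hsY⟩ := Indec.one (h N) hY hYi
  obtain ⟨-, hqL, -⟩ := Indec.one (h N) hL hLi
  have hLs : ∀ i k, Function.Surjective (L.map (R.ra i k)) := fun i k y => by
    obtain ⟨x, rfl⟩ := hp _ y
    obtain ⟨x, rfl⟩ := hXs i k x
    exact ⟨p.1 _ x, p.comm _ x⟩
  have hanti : ∀ i k, dimvec F L (Q.t (R.ra i k)) ≤ dimvec F L (Q.s (R.ra i k)) := fun i k => by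
    have := hL.1
    unfold dimvec
    exact_mod_cast LinearMap.finrank_le_finrank_of_surjective (hLs i k)
  have h1 : 1 ≤ (R.shift N).form (dimvec F X) (dimvec F L) :=
    one_le_form hX hL.1 (dmap_surj_right p hp hsX) (ne_zero_of_surj hp hLi.1)
  have h2 : 1 ≤ (R.shift N).form (dimvec F L) (dimvec F Y) :=
    one_le_form hL hY.1 (dmap_surj_left j hj hsY) (ne_zero_of_inj hj hLi.1)
  have h3 : (R.shift N).form (dimvec F L) (dimvec F Y) ≤
      (R.shift N).form (dimvec F L) (dimvec F X) := by
    rw [form_shift, form_shift, form_congr (R := R) (m' := dimvec F X) (fun v _ => rfl)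
      fun v hv => (hT v hv).symm]
    refine add_le_add le_rfl (Finset.sum_le_sum fun i _ => Finset.sum_le_sum fun k _ => ?_)
    nlinarith [hle i k, hanti i k]
  have h4 := (h N).eq_of_le (n := dimvec F X) (m := dimvec F L) (by linarith)
  have h5 : p.Bij := bij_of_surj hX hL hp (size_eq_of_dimvec h4).le
  refine iso_iff.2 ⟨Mor.comp j p, Mor.bij_iff.2 ⟨fun v => (hj v).comp (h5 v).1, ?_⟩⟩
  have := hX.1
  have := hY.1
  refine R.induct (fun v hv => ?_) fun i k hk y => ?_
  · refine (LinearMap.injective_iff_surjective_of_finrank_eq_finrank ?_).1 ((hj v).comp (h5 v).1)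
    have := hT v hv
    unfold dimvec at this
    exact_mod_cast this
  · obtain ⟨y, rfl⟩ := hYs i k y
    obtain ⟨x, rfl⟩ := hk y
    exact ⟨X.map _ x, ((Mor.comp j p).comm _ x).symm⟩

theorem exists_threshold (P : ℕ → Prop) (hP : ∀ k, P (k + 1) → P k) :
    ∃ p : ℕ∞, ∀ k : ℕ, P k ↔ (k : ℕ∞) < p := by
  classical
  have hmono : ∀ k l, k ≤ l → P l → P k := fun k l hkl => by
    induction hkl with
    | refl => exact fun h => h
    | step _ ih => exact fun h => ih (hP _ h)
  by_cases hex : ∃ k, ¬ P k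
  · refine ⟨(Nat.find hex : ℕ), fun k => ?_⟩
    rw [Nat.cast_lt, Nat.lt_find_iff]
    refine ⟨fun h m hm => not_not.2 (hmono m k hm h), fun h => not_not.1 (h k le_rfl)⟩
  · push Not at hex
    exact ⟨⊤, fun k => ⟨fun _ => ENat.natCast_lt_top k, fun _ => hex k⟩⟩

/-- The numerical data of a sequence of indecomposables contains a comparable pair. -/
theorem exists_comparable (h : ∀ N, (R.shift N).PD) (n : ℕ → Q.V → ℤ)
    (h0 : ∀ j v, 0 ≤ n j v) (h2 : ∀ j i, n j (Q.s (R.ra i 0)) ≤ 2)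
    (h3 : ∀ j, R.form (n j) (n j) ≤ 3)
    (hanti : ∀ j i k, n j (Q.t (R.ra i k)) ≤ n j (Q.s (R.ra i k))) :
    ∃ j l, j < l ∧ (∀ v ∈ R.T, n j v = n l v) ∧
      ∀ i k, n j (Q.t (R.ra i k)) ≤ n l (Q.t (R.ra i k)) := by
  have h2' : ∀ j i k, n j (Q.s (R.ra i k)) ≤ 2 := fun j i k => by
    induction k with
    | zero => exact h2 j i
    | succ k ih => rw [R.src_succ]; exact (hanti j i k).trans ih
  have hex : ∀ (j : ℕ) (q : R.ι × Fin 2), ∃ p : ℕ∞, ∀ k : ℕ,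
      ((q.2 : ℕ) : ℤ) < n j (Q.s (R.ra q.1 k)) ↔ (k : ℕ∞) < p := fun j q =>
    exists_threshold _ fun k hk => hk.trans_le (by rw [R.src_succ]; exact hanti j q.1 k)
  choose p hp using hex
  let Φ : ℕ → (R.T → ZMod 4) × (R.ι × Fin 2 → ℕ∞) := fun j => (fun v => ((n j v : ℤ) : ZMod 4), p j)
  have hwqo1 : WellQuasiOrdered (Eq : (R.T → ZMod 4) → (R.T → ZMod 4) → Prop) :=
    Finite.wellQuasiOrdered _
  have hwqo2 : WellQuasiOrdered ((· ≤ ·) : (R.ι × Fin 2 → ℕ∞) → (R.ι × Fin 2 → ℕ∞) → Prop) :=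
    wellQuasiOrdered_le
  obtain ⟨j, l, hjl, he, hle⟩ := (hwqo1.prod hwqo2) Φ
  refine ⟨j, l, hjl, eq_of_mod_four (PD.of_forall_shift h) (h3 j) (h3 l)
    fun v hv => congrFun he ⟨v, hv⟩, fun i k => ?_⟩
  have hmon : ∀ q : Fin 2, ((q : ℕ) : ℤ) < n j (Q.t (R.ra i k)) →
      ((q : ℕ) : ℤ) < n l (Q.t (R.ra i k)) := fun q hq => by
    rw [← R.src_succ] at hq ⊢
    exact (hp l (i, q) (k + 1)).2 (((hp j (i, q) (k + 1)).1 hq).trans_le (hle (i, q)))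
  have h4 := hmon 0
  have h5 := hmon 1
  have h6 := h2' j i (k + 1)
  rw [R.src_succ] at h6
  have h7 := h0 l (Q.t (R.ra i k))
  simp only [Fin.val_zero, Fin.val_one, Nat.cast_zero, Nat.cast_one] at h4 h5
  omega

/-- There are no infinite chains of non-isomorphisms between indecomposables whose composites with
a fixed morphism do not vanish. -/
theorem no_chain (h : ∀ N, (R.shift N).PD) (X : ℕ → QRep F Q) (hX : ∀ n, (X n).IsFLEI)
    (hXi : ∀ n, (X n).Indec) (g : ∀ n, Mor (X n) (X (n + 1))) (hg : ∀ n, ¬ (g n).Bij)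
    {P : QRep F Q} (hP : P.IsFLEI) (c : ∀ n, Mor P (X n)) (hc0 : ∀ n, c n ≠ 0)
    (hcn : ∀ n, c (n + 1) = Mor.comp (g n) (c n)) : False := by
  obtain ⟨N0, hN0⟩ := (flei_iff (R := R)).1 hP
  obtain ⟨R', hR', hPR⟩ : ∃ R' : RayData Q, (∀ N, (R'.shift N).PD) ∧ R'.Mem P :=
    ⟨_, PD.shift_shift h N0, hN0⟩
  have hnz : ∀ n, ∃ v ∈ R'.T, ∃ x : P.M v, (c n).1 v x ≠ 0 := fun n => by
    by_contra hno
    push Not at hno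
    exact hc0 n (R'.mor_eq_zero (fun i k => (hPR.2 i k).2) _ fun v hv => LinearMap.ext (hno v hv))
  have hb : ∀ n, _ := fun n => indec_bounds hR' (hX n) (hXi n) (by
    obtain ⟨v, hv, x, hx⟩ := hnz n
    exact ⟨v, hv, _, hx⟩)
  have hfd := fun n => (hX n).1
  obtain ⟨j, l, hjl, hT, hle⟩ := exists_comparable hR' (fun n => dimvec F (X n))
    (fun _ _ => Int.natCast_nonneg _) (fun n => (hb n).2.1) (fun n => (hb n).2.2)
    (fun n i k => by
      unfold dimvec
      exact_mod_cast LinearMap.finrank_le_finrank_of_surjective ((hb n).1 i k))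
  have hcomp : ∀ d, ∃ m : Mor (X (j + 1)) (X (j + 1 + d)),
      c (j + 1 + d) = Mor.comp m (c (j + 1)) := fun d => by
    induction d with
    | zero => exact ⟨Mor.id _, rfl⟩
    | succ d ih =>
      obtain ⟨m, hm⟩ := ih
      refine ⟨Mor.comp (g _) m, ?_⟩
      refine (hcn (j + 1 + d)).trans ?_
      rw [hm]; rfl
  obtain ⟨d, rfl⟩ : ∃ d, l = j + 1 + d := ⟨l - (j + 1), by omega⟩
  obtain ⟨m, hm⟩ := hcomp d
  rw [hcn j] at hm
  have hf : Mor.comp m (g j) ≠ 0 := fun h0 => by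
    refine hc0 (j + 1 + d) ?_
    rw [hm]
    refine Mor.ext' fun i x => ?_
    exact congrArg (fun f : Mor (X j) (X (j + 1 + d)) => f.1 i ((c j).1 i x)) h0
  obtain ⟨N1, hN1⟩ := (flei_iff (R := R')).1 (hX j)
  obtain ⟨N2, hN2⟩ := (flei_iff (R := R')).1 (hX (j + 1 + d))
  obtain ⟨φ, hφ⟩ := iso_iff.1 (iso_of_le hR' (Mem.shift R' hN1 (le_max_left N1 N2))
    (Mem.shift R' hN2 (le_max_right N1 N2)) (hXi _) (hXi _) (hb _).1 (hb _).1 hT hle hf)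
  have hne : Mor.comp (φ.inv hφ) (Mor.comp m (g j)) ≠ 0 := fun h0 => hf <| by
    refine Mor.eq_zero_iff.2 fun i x => ?_
    have := Mor.eq_zero_iff.1 h0 i x
    exact ((φ.inv_bij hφ) i).1 (this.trans (map_zero _).symm)
  have hbij := Indec.brick (hR' N1) hN1 (hXi j) _ hne
  refine hg j ?_
  refine (hXi (j + 1)).retract (hXi j).1 (g j)
    (Mor.comp (Mor.inv _ hbij) (Mor.comp (φ.inv hφ) m)) fun i x => ?_
  exact Mor.inv_app_left _ hbij i x

/-- A locally finite-dimensional representation with surjective ray maps is FLEI. -/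
theorem flei_of_surj (hfd : ∀ v, FiniteDimensional F (X.M v))
    (hs : ∀ i k, Function.Surjective (X.map (R.ra i k))) : X.IsFLEI := by
  have hex : ∀ i, ∃ N, ∀ k, N ≤ k → Module.finrank F (X.M (Q.s (R.ra i N))) =
      Module.finrank F (X.M (Q.s (R.ra i k))) := fun i => by
    have hanti : Antitone fun k => Module.finrank F (X.M (Q.s (R.ra i k))) := by
      refine antitone_nat_of_succ_le fun k => ?_
      rw [R.src_succ]
      exact LinearMap.finrank_le_finrank_of_surjective (hs i k)
    exact WellFoundedLT.antitone_chain_condition hanti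
  choose N hN using hex
  refine (flei_iff (R := R)).2 ⟨Finset.univ.sup N, hfd, fun (i : R.ι) k => ?_⟩
  have hle : N i ≤ Finset.univ.sup N := Finset.le_sup (Finset.mem_univ i)
  change Function.Bijective (X.map (R.ra i (Finset.univ.sup N + k)))
  refine ⟨(LinearMap.injective_iff_surjective_of_finrank_eq_finrank ?_).2 (hs i _), hs i _⟩
  rw [← hN i _ (by omega), ← R.src_succ]
  exact hN i _ (by omega)

end RayData

namespace RayData

open QRep

variable {F : Type} [Field F] {Q : Quiv} {R : RayData Q} {X Y Z : QRep F Q}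

/-- The vectors obtained from `x` by following paths. -/
inductive Reach {v : Q.V} (x : X.M v) : ∀ w, X.M w → Prop
  | base : Reach x v x
  | step (a : Q.A) (y : X.M (Q.s a)) : Reach x _ y → Reach x _ (X.map a y)

theorem arrows_into_finite (R : RayData Q) (w : Q.V) : {a : Q.A | Q.t a = w}.Finite := by
  classical
  by_cases h : ∃ i k, w = Q.t (R.ra i k)
  · obtain ⟨i, k, rfl⟩ := h
    refine ((R.B.finite_toSet).union (Set.finite_singleton (R.ra i k))).subset fun a ha => ?_
    rcases R.coverA a with hB | ⟨j, l, rfl⟩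
    · exact Or.inl hB
    · obtain ⟨rfl, rfl⟩ := R.tgt_inj _ _ _ _ ha
      exact Or.inr rfl
  · push Not at h
    refine R.B.finite_toSet.subset fun a ha => ?_
    rcases R.coverA a with hB | ⟨j, l, rfl⟩
    · exact hB
    · exact absurd (Eq.symm ha) (h j l)

theorem reach_finite (R : RayData Q) (h : Q.V → ℕ) (hh : ∀ a, h (Q.s a) < h (Q.t a)) {v : Q.V}
    (x : X.M v) : ∀ n w, h w = n → {y | Reach x w y}.Finite := by
  intro n
  induction n using Nat.strong_induction_on with
  | _ n ih =>
    rintro w rfl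
    let E : (w : Q.V) → X.M w → Σ w, X.M w := fun w y => ⟨w, y⟩
    have hfin : ({E v x} ∪ ⋃ a ∈ {a : Q.A | Q.t a = w},
        (fun y => E (Q.t a) (X.map a y)) '' {y | Reach x (Q.s a) y}).Finite := by
      refine (Set.finite_singleton _).union ((R.arrows_into_finite w).biUnion fun a ha => ?_)
      refine (ih _ ?_ _ rfl).image _
      rw [← show Q.t a = w from ha]
      exact hh a
    refine Set.Finite.of_finite_image (f := E w) (hfin.subset ?_)
      (fun y _ z _ hyz => eq_of_heq (Sigma.mk.inj hyz).2)
    rintro _ ⟨y, hy, rfl⟩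
    have hy' : Reach x w y := hy
    clear hy hfin ih
    cases hy' with
    | base => exact Or.inl rfl
    | step a y hy => exact Or.inr (Set.mem_biUnion (x := a) rfl ⟨y, hy, rfl⟩)

/-- The subrepresentation generated by a vector. -/
def genS {v : Q.V} (x : X.M v) : Subrep X where
  S w := Submodule.span F {y | Reach x w y}
  stable a y hy := by
    induction hy using Submodule.span_induction with
    | mem y hy => exact Submodule.subset_span (Reach.step a y hy)
    | zero => rw [map_zero]; exact Submodule.zero_mem _
    | add y z _ _ h1 h2 => rw [map_add]; exact Submodule.add_mem _ h1 h2
    | smul c y _ h1 => rw [map_smul]; exact Submodule.smul_mem _ c h1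

theorem mem_genS {v : Q.V} (x : X.M v) : x ∈ (genS x).S v := Submodule.subset_span Reach.base

theorem reach_ray {N : ℕ} {v : Q.V} (hv : v ∈ (R.shift N).T) (x : X.M v) (i : (R.shift N).ι) (k : ℕ)
    {w : Q.V} (hw : w = Q.t ((R.shift N).ra i k)) {y : X.M w} (hy : Reach x w y) :
    ∃ z, Reach x (Q.s ((R.shift N).ra i k)) z ∧ HEq y (X.map ((R.shift N).ra i k) z) := by
  cases hy with
  | base => exact absurd (hw ▸ hv) ((R.shift N).tgt_notin i k)
  | step a z hz =>
    rcases (R.shift N).coverA a with hB | ⟨j, l, rfl⟩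
    · exact absurd (hw ▸ (R.shift N).tgtB a hB) ((R.shift N).tgt_notin i k)
    · obtain ⟨rfl, rfl⟩ := (R.shift N).tgt_inj _ _ _ _ hw
      exact ⟨z, hz, HEq.rfl⟩

theorem flei_genS (R : RayData Q) (h : Q.V → ℕ) (hh : ∀ a, h (Q.s a) < h (Q.t a)) {v : Q.V}
    (x : X.M v) : (genS x).toRep.IsFLEI := by
  obtain ⟨N, hN⟩ : ∃ N, v ∈ (R.shift N).T := by
    rcases R.coverV v with hv | ⟨i, k, hk⟩
    · exact ⟨0, (R.mem_shift_T).2 (Or.inl hv)⟩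
    · exact ⟨k + 1, (R.mem_shift_T).2 (Or.inr ⟨i, k, by omega, hk⟩)⟩
  refine flei_of_surj (R := R.shift N) (fun w => ?_) fun i k => ?_
  · have := reach_finite R h hh x _ w rfl
    exact FiniteDimensional.span_of_finite F this
  · rintro ⟨y, hy⟩
    suffices hs : ∃ z ∈ (genS x).S (Q.s ((R.shift N).ra i k)), X.map ((R.shift N).ra i k) z = y by
      obtain ⟨z, hz, rfl⟩ := hs
      exact ⟨⟨z, hz⟩, rfl⟩
    induction hy using Submodule.span_induction with
    | mem y hy =>
      obtain ⟨z, hz, he⟩ := reach_ray hN x i k rfl hy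
      exact ⟨z, Submodule.subset_span hz, (eq_of_heq he).symm⟩
    | zero => exact ⟨0, Submodule.zero_mem _, map_zero _⟩
    | add y y' _ _ h1 h2 =>
      obtain ⟨z, hz, rfl⟩ := h1
      obtain ⟨z', hz', rfl⟩ := h2
      exact ⟨z + z', Submodule.add_mem _ hz hz', map_add _ _ _⟩
    | smul c y _ h1 =>
      obtain ⟨z, hz, rfl⟩ := h1
      exact ⟨c • z, Submodule.smul_mem _ c hz, map_smul _ _ _⟩

theorem flei_nonempty_idem (R : RayData Q) (hX : X.IsFLEI) (P : Mor X X → Prop) (h0 : ¬ P 0)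
    (h1 : P (Mor.id X)) (hadd : ∀ e e', P (e + e') → P e ∨ P e') :
    ∃ e : Mor X X, Mor.comp e e = e ∧ P e ∧ e.rangeS.toRep.Indec ∧ e.rangeS.toRep.IsFLEI := by
  obtain ⟨N, hN⟩ := (flei_iff (R := R)).1 hX
  obtain ⟨e, h2, h3, h4⟩ := exists_idem hN P h0 h1 hadd
  exact ⟨e, h2, h3, h4, (flei_iff (R := R)).2 ⟨N, hN.range hN e⟩⟩

/-- Every nonzero representation receives a nonzero morphism from an indecomposable FLEI one. -/
theorem exists_cover (R : RayData Q) (h : Q.V → ℕ) (hh : ∀ a, h (Q.s a) < h (Q.t a))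
    (hX : X.Nonzero) : ∃ (L : QRep F Q) (f : Mor L X), L.IsFLEI ∧ L.Indec ∧ f ≠ 0 := by
  obtain ⟨v, x, hx⟩ := hX
  let x' : (genS x).toRep.M v := ⟨x, mem_genS x⟩
  obtain ⟨e, h2, h3, h4, h5⟩ := flei_nonempty_idem R (flei_genS R h hh x)
    (fun e => e.1 v x' ≠ 0) (fun h0 => h0 rfl)
    (fun h0 => hx (congrArg Subtype.val h0)) (fun e e' h6 => by
      by_contra hc
      push Not at hc
      refine h6 ?_
      rw [Mor.add_app, hc.1, hc.2, add_zero])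
  refine ⟨_, Mor.comp (genS x).incl e.rangeS.incl, h5, h4, Mor.ne_zero_iff.2
    ⟨v, ⟨e.1 v x', _, rfl⟩, fun h0 => h3 (Subtype.ext h0)⟩⟩

end RayData

namespace QRep

variable {F : Type} [Field F] {Q : Quiv} {X Y Z V : QRep F Q}

theorem Mor.exists_factor (p : Mor X Y) (hp : p.Surj) (f : Mor X Z)
    (h : ∀ v x, p.1 v x = 0 → f.1 v x = 0) : ∃ g : Mor Y Z, ∀ v x, g.1 v (p.1 v x) = f.1 v x := by
  have hb : (p.kerS.desc p fun v x hx => hx).Bij := Mor.bij_iff.2 ⟨fun v => by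
    rw [← LinearMap.ker_eq_bot, LinearMap.ker_eq_bot']
    intro x hx
    obtain ⟨x, rfl⟩ := p.kerS.quo_surj v x
    exact (p.kerS.quo_eq_zero v x).2 hx, fun v y => by
      obtain ⟨x, rfl⟩ := hp v y
      exact ⟨p.kerS.quo.1 v x, rfl⟩⟩
  refine ⟨Mor.comp (p.kerS.desc f h) (Mor.inv _ hb), fun v x => ?_⟩
  have h2 : (Mor.inv _ hb).1 v (p.1 v x) = p.kerS.quo.1 v x :=
    Mor.inv_app_left (p.kerS.desc p fun v x hx => hx) hb v (p.kerS.quo.1 v x)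
  change (p.kerS.desc f h).1 v ((Mor.inv _ hb).1 v (p.1 v x)) = f.1 v x
  rw [h2]; rfl

/-- A subrepresentation is pure if morphisms from FLEI representations to the quotient lift. -/
def IsPure (S : Subrep V) : Prop :=
  ∀ X : QRep F Q, X.IsFLEI → ∀ f : Mor X S.quot, ∃ g : Mor X V, ∀ i x, S.quo.1 i (g.1 i x) = f.1 i x

/-- The sum of a set of subrepresentations. -/
def sumS (s : Set (Subrep V)) : Subrep V where
  S i := ⨆ W ∈ s, W.S i
  stable a x hx := by
    have : (⨆ W ∈ s, W.S (Q.s a)) ≤ (⨆ W ∈ s, W.S (Q.t a)).comap (V.map a) :=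
      iSup₂_le fun W hW y hy => (le_iSup₂ (f := fun W (_ : W ∈ s) => W.S (Q.t a)) W hW)
        (W.stable a y hy)
    exact this hx

theorem le_sumS {s : Set (Subrep V)} {W : Subrep V} (hW : W ∈ s) (i) : W.S i ≤ (sumS s).S i :=
  le_iSup₂ (f := fun W (_ : W ∈ s) => W.S i) W hW

/-- The canonical map between quotients. -/
def quoMap {S S' : Subrep V} (h : S ≤ S') : Mor S.quot S'.quot :=
  S.desc S'.quo fun i x hx => (S'.quo_eq_zero i x).2 (h i hx)

theorem quoMap_quo {S S' : Subrep V} (h : S ≤ S') (i) (x : V.M i) :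
    (quoMap h).1 i (S.quo.1 i x) = S'.quo.1 i x := rfl

end QRep

namespace RayData

open QRep

variable {F : Type} [Field F] {Q : Quiv} {R : RayData Q} {X Y Z V : QRep F Q}

/-- A directed union of pure subrepresentations is pure. -/
theorem isPure_of_directed (R : RayData Q) {c : Type} [Nonempty c] (S : c → Subrep V)
    (hd : Directed (· ≤ ·) S) (hS : ∀ j, IsPure (S j)) (U : Subrep V)
    (hU : ∀ i, U.S i = ⨆ j, (S j).S i) : IsPure U := by
  classical
  intro X hX f
  obtain ⟨N, hN⟩ := (flei_iff (R := R)).1 hX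
  generalize R.shift N = R' at hN
  have hfd := hN.1
  have hsec : ∀ v, ∃ ψ : X.M v →ₗ[F] V.M v, ∀ x, U.quo.1 v (ψ x) = f.1 v x := fun v => by
    obtain ⟨σ, hσ⟩ := LinearMap.exists_rightInverse_of_surjective (U.quo.1 v)
      (LinearMap.range_eq_top.2 (U.quo_surj v))
    exact ⟨σ.comp (f.1 v), fun x => LinearMap.congr_fun hσ (f.1 v x)⟩
  choose ψ hψ using hsec
  have hdef : ∀ a x, dmap X V ψ a x ∈ U.S (Q.t a) := fun a x => by
    rw [← U.quo_eq_zero, dmap_apply, map_sub, ← U.quo.comm a, hψ, hψ, f.comm, sub_self]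
  have hdir : ∀ v, Directed (· ≤ ·) fun j => (S j).S v := fun v i j => by
    obtain ⟨k, h1, h2⟩ := hd i j
    exact ⟨k, h1 v, h2 v⟩
  have hex : ∀ a, ∃ j, ∀ x, dmap X V ψ a x ∈ (S j).S (Q.t a) := fun a => by
    have := hfd (Q.s a)
    have := LinearMap.finiteDimensional_range (dmap X V ψ a)
    have hfg : (LinearMap.range (dmap X V ψ a)).FG := Module.Finite.iff_fg.1 this
    have hle : LinearMap.range (dmap X V ψ a) ≤ ⨆ j, (S j).S (Q.t a) := by
      rintro _ ⟨x, rfl⟩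
      rw [← hU]; exact hdef a x
    obtain ⟨s, hs⟩ := hfg
    have : ∀ s : Finset (V.M (Q.t a)), (∀ y ∈ s, y ∈ ⨆ j, (S j).S (Q.t a)) →
        ∃ j, ∀ y ∈ s, y ∈ (S j).S (Q.t a) := fun s => by
      induction s using Finset.induction_on with
      | empty => exact fun _ => ⟨Classical.arbitrary c, by simp⟩
      | insert y s _ ih =>
        intro hy
        obtain ⟨j, hj⟩ := ih fun z hz => hy z (Finset.mem_insert_of_mem hz)
        obtain ⟨k, hk⟩ := (Submodule.mem_iSup_of_directed _ (hdir _)).1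
          (hy y (Finset.mem_insert_self _ _))
        obtain ⟨l, h1, h2⟩ := hdir _ j k
        refine ⟨l, fun z hz => ?_⟩
        rcases Finset.mem_insert.1 hz with rfl | hz
        · exact h2 hk
        · exact h1 (hj z hz)
    obtain ⟨j, hj⟩ := this s fun y hy => hle (hs ▸ Submodule.subset_span hy)
    refine ⟨j, fun x => ?_⟩
    have hle2 : LinearMap.range (dmap X V ψ a) ≤ (S j).S (Q.t a) := by
      rw [← hs]; exact Submodule.span_le.2 hj
    exact hle2 ⟨x, rfl⟩
  choose j hj using hex
  obtain ⟨k, hk⟩ : ∃ k, ∀ a ∈ R'.B, S (j a) ≤ S k := by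
    obtain ⟨k, hk⟩ := hd.finset_le (R'.B.image j)
    exact ⟨k, fun a ha => hk _ (Finset.mem_image_of_mem _ ha)⟩
  have hkU : S k ≤ U := fun i => by rw [hU]; exact le_iSup (fun j => (S j).S i) k
  obtain ⟨φ, hφ1, hφ2⟩ := R'.exists_extend (Y := (S k).quot) hN.2
    (fun v => ((S k).quo.1 v).comp (ψ v)) 0
  have hφm : φ ∈ HomS X (S k).quot := mem_HomS.2 fun a x => by
    rcases R'.coverA a with ha | ⟨i, l, rfl⟩
    · rw [hφ1 _ (R'.srcB a ha), hφ1 _ (R'.tgtB a ha)]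
      change (S k).quot.map a ((S k).quo.1 _ (ψ _ x)) = (S k).quo.1 _ (ψ _ (X.map a x))
      rw [(S k).quo.comm a, ← sub_eq_zero, ← map_sub]
      exact ((S k).quo_eq_zero _ _).2 (hk a ha _ (hj a x))
    · exact sub_eq_zero.1 (LinearMap.congr_fun (hφ2 i l) x)
  obtain ⟨g, hg⟩ := hS k X hX ⟨φ, hφm⟩
  refine ⟨g, ?_⟩
  have hz : Mor.comp U.quo g - f = 0 := by
    refine R'.mor_eq_zero (fun i l => (hN.2 i l).2) _ fun v hv => LinearMap.ext fun x => ?_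
    change U.quo.1 v (g.1 v x) - f.1 v x = 0
    rw [← quoMap_quo hkU, hg, ← hψ, ← quoMap_quo hkU, sub_eq_zero]
    exact congrArg _ (LinearMap.congr_fun (hφ1 v hv) x)
  intro i x
  exact sub_eq_zero.1 (Mor.eq_zero_iff.1 hz i x)

theorem flei_quot (hX : X.IsFLEI) (R : RayData Q) (W : Subrep X) (hW : W.toRep.IsFLEI) :
    W.quot.IsFLEI := by
  obtain ⟨N1, hN1⟩ := (flei_iff (R := R)).1 hX
  obtain ⟨N2, hN2⟩ := (flei_iff (R := R)).1 hW
  have h1 := Mem.shift R hN1 (le_max_left N1 N2)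
  have h2 := Mem.shift R hN2 (le_max_right N1 N2)
  refine (flei_iff (R := R)).2 ⟨max N1 N2, fun v => ?_, fun i k => ⟨?_, fun y => ?_⟩⟩
  · have := h1.1 v
    exact inferInstanceAs (FiniteDimensional F (X.M v ⧸ W.S v))
  · rw [← LinearMap.ker_eq_bot, LinearMap.ker_eq_bot']
    intro y hy
    obtain ⟨y, rfl⟩ := W.quo_surj _ y
    rw [W.quo.comm] at hy
    obtain ⟨z, hz⟩ := (h2.2 i k).2 ⟨_, (W.quo_eq_zero _ _).1 hy⟩
    rw [W.quo_eq_zero, ← (h1.2 i k).1 (congrArg Subtype.val hz)]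
    exact z.2
  · obtain ⟨y, rfl⟩ := W.quo_surj _ y
    obtain ⟨y, rfl⟩ := (h1.2 i k).2 y
    exact ⟨W.quo.1 _ y, W.quo.comm _ y⟩

/-- A stage of the construction of a maximal morphism to `U`. -/
structure Stage (P U : QRep F Q) : Type 1 where
  X : QRep F Q
  flei : X.IsFLEI
  indec : X.Indec
  f : Mor X U
  c : Mor P X
  ne : Mor.comp f c ≠ 0

/-- A nonzero morphism from an indecomposable which only factors through split monomorphisms. -/
theorem exists_maximal_morphism (hR : ∀ N, (R.shift N).PD) (h : Q.V → ℕ)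
    (hh : ∀ a, h (Q.s a) < h (Q.t a)) {U : QRep F Q} (hU : U.Nonzero) :
    ∃ (X : QRep F Q) (f : Mor X U), X.IsFLEI ∧ X.Indec ∧ f ≠ 0 ∧
      ∀ (Y : QRep F Q) (g : Mor X Y) (k : Mor Y U), Y.IsFLEI → Mor.comp k g = f →
        ∃ r : Mor Y X, Mor.comp r g = Mor.id X := by
  by_contra hno
  push Not at hno
  obtain ⟨P, f0, hP, hPi, hf0⟩ := exists_cover R h hh hU
  have hstep : ∀ s : Stage P U, ∃ (s' : Stage P U) (g : Mor s.X s'.X), ¬ g.Bij ∧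
      s'.c = Mor.comp g s.c := fun s => by
    have hsf : s.f ≠ 0 := fun h0 => s.ne (by rw [h0]; rfl)
    obtain ⟨Y, g, k, hY, hk, hr⟩ := hno s.X s.f s.flei s.indec hsf
    obtain ⟨e, -, h3, h4, h5⟩ := flei_nonempty_idem R hY
      (fun e => Mor.comp k (Mor.comp e (Mor.comp g s.c)) ≠ 0)
      (fun h0 => h0 (Mor.ext' fun i x => map_zero (k.1 i)))
      (fun h0 => s.ne (by rw [← hk]; exact h0))
      (fun e e' h6 => by
        by_contra hc
        push Not at hc
        refine h6 ?_
        have : Mor.comp k (Mor.comp (e + e') (Mor.comp g s.c)) =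
            Mor.comp k (Mor.comp e (Mor.comp g s.c)) +
            Mor.comp k (Mor.comp e' (Mor.comp g s.c)) :=
          Mor.ext' fun i x => map_add (k.1 i) _ _
        rw [this, hc.1, hc.2, add_zero])
    refine ⟨⟨e.rangeS.toRep, h5, h4, Mor.comp k e.rangeS.incl,
      Mor.comp e.toRange (Mor.comp g s.c), h3⟩, Mor.comp e.toRange g, fun hb => ?_, rfl⟩
    refine hr (Mor.comp (Mor.inv _ hb) e.toRange) (Mor.ext' fun i x => ?_)
    exact Mor.inv_app_left _ hb i x
  choose next g hg hgc using hstep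
  let s : ℕ → Stage P U := fun n => Nat.rec ⟨P, hP, hPi, f0, Mor.id P, hf0⟩ (fun _ s => next s) n
  exact no_chain hR (fun n => (s n).X) (fun n => (s n).flei) (fun n => (s n).indec)
    (fun n => g (s n)) (fun n => hg (s n)) hP (fun n => (s n).c)
    (fun n h0 => (s n).ne (by rw [h0]; exact Mor.ext' fun i x => map_zero ((s n).f.1 i)))
    (fun n => hgc (s n))

/-- A proper pure subrepresentation can be enlarged by an indecomposable direct summand. -/
theorem exists_pure_extension (hR : ∀ N, (R.shift N).PD) (h : Q.V → ℕ)
    (hh : ∀ a, h (Q.s a) < h (Q.t a)) {S : Subrep V} (hS : IsPure S) (hne : S.quot.Nonzero) :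
    ∃ (X : QRep F Q) (φ : Mor X V), X.IsFLEI ∧ X.Indec ∧ φ.Inj ∧
      (∀ i, Disjoint (S.S i) (φ.rangeS.S i)) ∧
      ∀ S' : Subrep V, (∀ i, S'.S i = S.S i ⊔ φ.rangeS.S i) → IsPure S' := by
  obtain ⟨X, f, hX, hXi, hf, hmax⟩ := exists_maximal_morphism hR h hh hne
  have hinj : ∀ v x, f.1 v x = 0 → x = 0 := fun v x hx => by
    by_contra hx0
    have hz : ∀ i, ∀ y ∈ (genS x).S i, f.1 i y = 0 := by
      have hr : ∀ i y, Reach x i y → f.1 i y = 0 := fun i y hy => by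
        induction hy with
        | base => exact hx
        | step a y _ ih => rw [← f.comm, ih, map_zero]
      intro i y hy
      induction hy using Submodule.span_induction with
      | mem y hy => exact hr i y hy
      | zero => exact map_zero _
      | add y z _ _ h1 h2 => rw [map_add, h1, h2, add_zero]
      | smul c y _ h1 => rw [map_smul, h1, smul_zero]
    obtain ⟨r, hr⟩ := hmax _ (genS x).quo ((genS x).desc f hz)
      (flei_quot hX R _ (flei_genS R h hh x)) rfl
    have h1 := congrArg (fun f : Mor X X => f.1 v x) hr
    refine hx0 (h1.symm.trans ?_)
    change r.1 v ((genS x).quo.1 v x) = 0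
    rw [((genS x).quo_eq_zero v x).2 (mem_genS x), map_zero]
  obtain ⟨φ, hφ⟩ := hS X hX f
  refine ⟨X, φ, hX, hXi, fun v => ?_, fun i => ?_, fun S' hS' => ?_⟩
  · rw [← LinearMap.ker_eq_bot, LinearMap.ker_eq_bot']
    intro x hx
    refine hinj v x ?_
    rw [← hφ, hx, map_zero]
  · rw [Submodule.disjoint_def]
    rintro _ hx ⟨x, rfl⟩
    rw [← S.quo_eq_zero, hφ] at hx
    rw [hinj i x hx, map_zero]
  intro Y hY k
  have hle : S ≤ S' := fun i => by rw [hS']; exact le_sup_left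
  have hπf : ∀ i x, (quoMap hle).1 i (f.1 i x) = 0 := fun i x => by
    rw [← hφ, quoMap_quo, Subrep.quo_eq_zero, hS']
    exact Submodule.mem_sup_right ⟨x, rfl⟩
  have hπker : ∀ i u, (quoMap hle).1 i u = 0 → ∃ x, f.1 i x = u := fun i u hu => by
    obtain ⟨u, rfl⟩ := S.quo_surj i u
    rw [quoMap_quo, Subrep.quo_eq_zero, hS'] at hu
    obtain ⟨s, hs, _, ⟨x, rfl⟩, rfl⟩ := Submodule.mem_sup.1 hu
    refine ⟨x, ?_⟩
    rw [← hφ, map_add, (S.quo_eq_zero i s).2 hs, zero_add]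
  have hπs : (quoMap hle).Surj := fun i u => by
    obtain ⟨u, rfl⟩ := S'.quo_surj i u
    exact ⟨S.quo.1 i u, rfl⟩
  let δ : Mor (dsum Y S.quot) S'.quot :=
    Mor.comp k (fstM Y S.quot) - Mor.comp (quoMap hle) (sndM Y S.quot)
  let E : Subrep (dsum Y S.quot) := δ.kerS
  have hmem : ∀ i (p : Y.M i × S.quot.M i), p ∈ E.S i ↔ k.1 i p.1 = (quoMap hle).1 i p.2 :=
    fun i p => sub_eq_zero
  have hE : E.toRep.IsFLEI := by
    obtain ⟨N1, hN1⟩ := (flei_iff (R := R)).1 hX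
    obtain ⟨N2, hN2⟩ := (flei_iff (R := R)).1 hY
    have h1 := Mem.shift R hN1 (le_max_left N1 N2)
    have h2 := Mem.shift R hN2 (le_max_right N1 N2)
    refine (flei_iff (R := R)).2 ⟨max N1 N2, fun v => ?_, fun i l => ⟨?_, fun y => ?_⟩⟩
    · obtain ⟨σ, hσ⟩ := LinearMap.exists_rightInverse_of_surjective ((quoMap hle).1 v)
        (LinearMap.range_eq_top.2 (hπs v))
      have hσ' : ∀ w, (quoMap hle).1 v (σ w) = w := LinearMap.congr_fun hσ
      have h1v : FiniteDimensional F (X.M v) := h1.1 v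
      have h2v : FiniteDimensional F (Y.M v) := h2.1 v
      let Θ : Y.M v × X.M v →ₗ[F] Y.M v × S.quot.M v :=
        (LinearMap.fst F _ _).prod ((σ.comp (k.1 v)).comp (LinearMap.fst F _ _) +
          (f.1 v).comp (LinearMap.snd F _ _))
      have hΘ : E.S v ≤ LinearMap.range Θ := fun p hp => by
        have hp' := (hmem v p).1 hp
        obtain ⟨x, hx⟩ := hπker v (p.2 - σ (k.1 v p.1)) (by rw [map_sub, hσ', hp', sub_self])
        refine ⟨(p.1, x), Prod.ext rfl ?_⟩
        change σ (k.1 v p.1) + f.1 v x = p.2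
        rw [hx]; abel
      have hfr : FiniteDimensional F (LinearMap.range Θ) := LinearMap.finiteDimensional_range Θ
      exact @Submodule.finiteDimensional_of_le _ _ _ _ _ _ _ hfr hΘ
    · rw [← LinearMap.ker_eq_bot, LinearMap.ker_eq_bot']
      rintro ⟨⟨y, u⟩, hp⟩ h0
      have hp' := (hmem _ _).1 hp
      have h0y : Y.map _ y = 0 := congrArg (fun p => (Subtype.val p).1) h0
      have h0u : S.quot.map _ u = 0 := congrArg (fun p => (Subtype.val p).2) h0
      have hy : y = 0 := (h2.2 i l).1 (h0y.trans (map_zero _).symm)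
      subst hy
      obtain ⟨x, rfl⟩ := hπker _ u (hp'.symm.trans (map_zero _))
      rw [f.comm] at h0u
      have hx : x = 0 := (h1.2 i l).1 ((hinj _ _ h0u).trans (map_zero _).symm)
      subst hx
      exact Subtype.ext (Prod.ext rfl (map_zero _))
    · obtain ⟨⟨y, u⟩, hp⟩ := y
      have hp' := (hmem _ _).1 hp
      obtain ⟨y, rfl⟩ := (h2.2 i l).2 y
      obtain ⟨w, hw⟩ := hπs _ (k.1 _ y)
      obtain ⟨x, hx⟩ := hπker _ (u - S.quot.map _ w) (by
        rw [map_sub, ← hp', ← (quoMap hle).comm, hw, k.comm, sub_self])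
      obtain ⟨x, rfl⟩ := (h1.2 i l).2 x
      refine ⟨⟨(y, w + f.1 _ x), (hmem _ _).2 ?_⟩, Subtype.ext (Prod.ext rfl ?_)⟩
      · change k.1 _ y = (quoMap hle).1 _ (w + f.1 _ x)
        rw [map_add, hw, hπf, add_zero]
      · change S.quot.map _ (w + f.1 _ x) = u
        rw [map_add, f.comm, hx]; abel
  let ιX : Mor X E.toRep := E.cod (Mor.comp (inrM Y S.quot) f) fun i x => (hmem i _).2 (by
    change k.1 i 0 = (quoMap hle).1 i (f.1 i x)
    rw [hπf, map_zero])
  let pU : Mor E.toRep S.quot := Mor.comp (sndM Y S.quot) E.incl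
  let pY : Mor E.toRep Y := Mor.comp (fstM Y S.quot) E.incl
  obtain ⟨r, hr⟩ := hmax E.toRep ιX pU hE rfl
  have hpY : pY.Surj := fun i y => by
    obtain ⟨w, hw⟩ := hπs _ (k.1 _ y)
    exact ⟨⟨(y, w), (hmem _ _).2 hw.symm⟩, rfl⟩
  obtain ⟨χ, hχ⟩ := Mor.exists_factor pY hpY (pU - Mor.comp f r) fun v p hp => by
    obtain ⟨⟨y, u⟩, hpE⟩ := p
    have hy : y = 0 := hp
    subst hy
    obtain ⟨x, rfl⟩ := hπker _ u (((hmem _ _).1 hpE).symm.trans (map_zero _))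
    have h1 : r.1 v (ιX.1 v x) = x := congrArg (fun f : Mor X X => f.1 v x) hr
    change f.1 v x - f.1 v (r.1 v (ιX.1 v x)) = 0
    rw [h1, sub_self]
  obtain ⟨g, hg⟩ := hS Y hY χ
  refine ⟨g, fun i y => ?_⟩
  obtain ⟨p, rfl⟩ := hpY i y
  rw [← quoMap_quo hle, hg, hχ]
  change (quoMap hle).1 i (pU.1 i p - f.1 i (r.1 i p)) = k.1 i (pY.1 i p)
  rw [map_sub, hπf, sub_zero]
  exact ((hmem i p.1).1 p.2).symm

end RayData

namespace QRep

variable {F : Type} [Field F] {Q : Quiv} {X Y Z V : QRep F Q}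

theorem exists_proj {J : Type} {W : J → Subrep V} (hW : IsDecomp W) (j : J) :
    ∃ π : Mor V (W j).toRep, (∀ i, ∀ x ∈ (W j).S i, (W j).incl.1 i (π.1 i x) = x) ∧
      ∀ k, k ≠ j → ∀ i, ∀ x ∈ (W k).S i, π.1 i x = 0 := by
  have hc : ∀ i, IsCompl ((W j).S i) (⨆ (k : J) (_ : k ≠ j), (W k).S i) := fun i => by
    refine ⟨hW.1 i j, codisjoint_iff.2 (eq_top_iff.2 ?_)⟩
    rw [← hW.2 i]
    refine iSup_le fun k => ?_
    by_cases hk : k = j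
    · subst hk; exact le_sup_left
    · exact le_sup_of_le_right (le_iSup₂ (f := fun k (_ : k ≠ j) => (W k).S i) k hk)
  let p : ∀ i, V.M i →ₗ[F] (W j).toRep.M i := fun i => Submodule.projectionOnto _ _ (hc i)
  have hp1 : ∀ i, ∀ x (hx : x ∈ (W j).S i), p i x = ⟨x, hx⟩ := fun i x hx =>
    Submodule.projectionOnto_apply_left (hc i) ⟨x, hx⟩
  have hp2 : ∀ k, k ≠ j → ∀ i, ∀ x ∈ (W k).S i, p i x = 0 := fun k hk i x hx =>
    Submodule.projectionOnto_apply_right (hc i) ⟨x,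
      (le_iSup₂ (f := fun k (_ : k ≠ j) => (W k).S i) k hk) hx⟩
  refine ⟨⟨p, mem_HomS.2 fun a x => ?_⟩, fun i x hx => congrArg Subtype.val (hp1 i x hx), hp2⟩
  have hx : x ∈ ⨆ k, (W k).S (Q.s a) := by rw [hW.2]; trivial
  induction hx using Submodule.iSup_induction' with
  | mem k x hx =>
    by_cases hk : k = j
    · subst hk
      rw [hp1 _ x hx, hp1 _ _ ((W k).stable a x hx)]; rfl
    · rw [hp2 k hk _ x hx, hp2 k hk _ _ ((W k).stable a x hx), map_zero]
  | zero => simp only [map_zero]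
  | add x y _ _ h1 h2 => simp only [map_add, h1, h2]

theorem exists_support {J : Type} {W : J → Subrep V} (hW : IsDecomp W)
    (π : ∀ j, Mor V (W j).toRep)
    (h1 : ∀ j i, ∀ x ∈ (W j).S i, (W j).incl.1 i ((π j).1 i x) = x)
    (h2 : ∀ j k, k ≠ j → ∀ i, ∀ x ∈ (W k).S i, (π j).1 i x = 0) (i) (x : V.M i) :
    ∃ t : Finset J, x = ∑ j ∈ t, (W j).incl.1 i ((π j).1 i x) := by
  classical
  suffices h : ∃ t : Finset J, (∀ j ∉ t, (π j).1 i x = 0) ∧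
      x = ∑ j ∈ t, (W j).incl.1 i ((π j).1 i x) from h.imp fun _ h => h.2
  have hx : x ∈ ⨆ k, (W k).S i := by rw [hW.2]; trivial
  induction hx using Submodule.iSup_induction' with
  | mem k x hx =>
    refine ⟨{k}, fun j hj => h2 j k (fun h => hj (by simp [h])) i x hx, ?_⟩
    rw [Finset.sum_singleton, h1 k i x hx]
  | zero => exact ⟨∅, by simp, by simp⟩
  | add x y _ _ hx hy =>
    obtain ⟨t, ht0, ht⟩ := hx
    obtain ⟨u, hu0, hu⟩ := hy
    refine ⟨t ∪ u, fun j hj => ?_, ?_⟩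
    · rw [Finset.notMem_union] at hj
      rw [map_add, ht0 j hj.1, hu0 j hj.2, add_zero]
    · simp only [map_add, Finset.sum_add_distrib]
      congr 1
      · conv_lhs => rw [ht]
        refine Finset.sum_subset Finset.subset_union_left fun j _ hj => ?_
        rw [ht0 j hj, map_zero]
      · conv_lhs => rw [hu]
        refine Finset.sum_subset Finset.subset_union_right fun j _ hj => ?_
        rw [hu0 j hj, map_zero]

/-- Independence of a set of subrepresentations. -/
def Indep (m : Set (Subrep V)) : Prop :=
  ∀ i (t : Finset (Subrep V)), ↑t ⊆ m → ∀ x : Subrep V → V.M i, (∀ W ∈ t, x W ∈ W.S i) →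
    ∑ W ∈ t, x W = 0 → ∀ W ∈ t, x W = 0

theorem Indep.insert {m : Set (Subrep V)} (hm : Indep m) {U : Subrep V}
    (hU : ∀ i, Disjoint ((sumS m).S i) (U.S i)) : Indep (insert U m) := by
  classical
  intro i t ht x hx h0
  have hsub : ↑(t.erase U) ⊆ m := fun W hW => by
    have := Finset.mem_erase.1 hW
    exact (ht this.2).resolve_left this.1
  by_cases hUt : U ∈ t
  · rw [← Finset.add_sum_erase t x hUt] at h0
    have hmem : ∑ W ∈ t.erase U, x W ∈ (sumS m).S i := Submodule.sum_mem _ fun W hW =>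
      le_sumS (hsub hW) i (hx W (Finset.mem_of_mem_erase hW))
    have hU0 : x U = 0 := (Submodule.disjoint_def.1 (hU i)) _
      (by rw [eq_neg_of_add_eq_zero_left h0]; exact Submodule.neg_mem _ hmem) (hx U hUt)
    rw [hU0, zero_add] at h0
    intro W hW
    by_cases hWU : W = U
    · rw [hWU, hU0]
    · exact hm i _ hsub x (fun W hW => hx W (Finset.mem_of_mem_erase hW)) h0 W
        (Finset.mem_erase.2 ⟨hWU, hW⟩)
  · rw [Finset.erase_eq_of_notMem hUt] at hsub
    exact hm i t hsub x hx h0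

theorem Indep.sUnion {c : Set (Set (Subrep V))} (hc : IsChain (· ⊆ ·) c) (hne : c.Nonempty)
    (h : ∀ m ∈ c, Indep m) : Indep (⋃₀ c) := by
  intro i t ht
  obtain ⟨m, hm, htm⟩ := hc.directedOn.exists_mem_subset_of_finite_of_subset_sUnion hne
    t.finite_toSet ht
  exact h m hm i t htm

theorem Indep.isDecomp {m : Set (Subrep V)} (hm : Indep m) (h : ∀ i, (sumS m).S i = ⊤) :
    IsDecomp fun W : m => W.1 := by
  classical
  refine ⟨fun i => ?_, fun i => ?_⟩
  · change iSupIndep fun W : m => W.1.S i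
    rw [iSupIndep_iff_finsetSum_eq_zero_imp_eq_zero]
    intro t x hx h0 W hW
    let y : Subrep V → V.M i := fun W => if h : W ∈ m then x ⟨W, h⟩ else 0
    have hy : ∀ W : m, y W.1 = x W := fun W => dif_pos W.2
    rw [← hy]
    refine hm i (t.map (Function.Embedding.subtype _)) ?_ y ?_ ?_ W.1
      (Finset.mem_map_of_mem _ hW)
    · intro W hW
      obtain ⟨W, -, rfl⟩ := Finset.mem_map.1 hW
      exact W.2
    · intro W hW
      obtain ⟨U, hU, rfl⟩ := Finset.mem_map.1 hW
      exact (hy U).symm ▸ hx U hU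
    · rw [Finset.sum_map]
      exact (Finset.sum_congr rfl fun W _ => hy W).trans h0
  · rw [← h i]
    exact iSup_subtype' (f := fun W (_ : W ∈ m) => W.S i) |>.symm

end QRep

namespace RayData

open QRep

variable {F : Type} [Field F] {Q : Quiv} {R : RayData Q} {X Y Z V : QRep F Q}

/-- Every representation is a direct sum of FLEI indecomposables. -/
theorem exists_decomp (hR : ∀ N, (R.shift N).PD) (h : Q.V → ℕ)
    (hh : ∀ a, h (Q.s a) < h (Q.t a)) (V : QRep F Q) :
    ∃ m : Set (Subrep V), (∀ W ∈ m, W.toRep.IsFLEI ∧ W.toRep.Indec) ∧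
      IsDecomp fun W : m => W.1 := by
  obtain ⟨m, ⟨hm1, hm2, hm3⟩, hmax⟩ := zorn_subset
    {m : Set (Subrep V) | (∀ W ∈ m, W.toRep.IsFLEI ∧ W.toRep.Indec) ∧ Indep m ∧
      IsPure (sumS m)} fun c hc hch => by
    rcases c.eq_empty_or_nonempty with rfl | hne
    · refine ⟨∅, ⟨by simp, fun i t ht x _ _ W hW => absurd (ht hW) (by simp), ?_⟩, by simp⟩
      have hb : (sumS (∅ : Set (Subrep V))).quo.Bij := Mor.bij_iff.2
        ⟨fun i => by
          rw [← LinearMap.ker_eq_bot, LinearMap.ker_eq_bot']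
          intro x hx
          rw [Subrep.quo_eq_zero] at hx
          simpa [sumS] using hx, Subrep.quo_surj _⟩
      exact fun X _ f => ⟨Mor.comp (Mor.inv _ hb) f, fun i x => Mor.inv_app_right _ hb i _⟩
    · refine ⟨⋃₀ c, ⟨?_, Indep.sUnion hch hne fun m hm => (hc hm).2.1, ?_⟩,
        fun s hs => Set.subset_sUnion_of_mem hs⟩
      · rintro W ⟨m, hm, hW⟩
        exact (hc hm).1 W hW
      · have : Nonempty c := hne.to_subtype
        have hmono : ∀ m m' : Set (Subrep V), m ⊆ m' → sumS m ≤ sumS m' := fun m m' hmm i =>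
          iSup₂_le fun W hW => le_sumS (hmm hW) i
        refine isPure_of_directed R (fun m : c => sumS m.1) (fun m m' => ?_)
          (fun m => (hc m.2).2.2) _ fun i => le_antisymm (iSup₂_le ?_) (iSup_le fun m =>
            hmono _ _ (Set.subset_sUnion_of_mem m.2) i)
        · rcases hch.total m.2 m'.2 with hmm | hmm
          · exact ⟨m', hmono _ _ hmm, le_rfl⟩
          · exact ⟨m, le_rfl, hmono _ _ hmm⟩
        · rintro W ⟨m, hm, hW⟩
          exact le_iSup_of_le (⟨m, hm⟩ : c) (le_sumS hW i)
  refine ⟨m, hm1, hm2.isDecomp ?_⟩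
  by_contra hne
  have hnz : (sumS m).quot.Nonzero := by
    push Not at hne
    obtain ⟨i, hi⟩ := hne
    obtain ⟨x, -, hx⟩ := SetLike.exists_of_lt (lt_top_iff_ne_top.2 hi)
    exact ⟨i, (sumS m).quo.1 i x, fun h0 => hx (((sumS m).quo_eq_zero i x).1 h0)⟩
  obtain ⟨X, φ, hX, hXi, hφ, hd, hp⟩ := exists_pure_extension hR h hh hm3 hnz
  have hiso : Iso X φ.rangeS.toRep := iso_iff.2 ⟨φ.toRange, Mor.bij_iff.2
    ⟨fun i x y hxy => hφ i (congrArg Subtype.val hxy), φ.toRange_surj⟩⟩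
  obtain ⟨N, hN⟩ := (flei_iff (R := R)).1 hX
  have hmem : φ.rangeS ∈ m := hmax (y := insert φ.rangeS m) ⟨?_, hm2.insert hd, hp _ fun i => ?_⟩
    (Set.subset_insert _ _) (Set.mem_insert _ _)
  · obtain ⟨i, x, hx⟩ := hXi.1
    refine hx (hφ i ?_)
    rw [map_zero]
    exact Submodule.disjoint_def.1 (hd i) _ (le_sumS hmem i ⟨x, rfl⟩) ⟨x, rfl⟩
  · rintro W (rfl | hW)
    · exact ⟨(flei_iff (R := R)).2 ⟨N, hN.iso hiso⟩, hiso.indec hXi⟩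
    · exact hm1 W hW
  · simp only [sumS, iSup_insert, sup_comm]

/-- Every indecomposable representation is FLEI. -/
theorem Indec.flei (hR : ∀ N, (R.shift N).PD) (h : Q.V → ℕ)
    (hh : ∀ a, h (Q.s a) < h (Q.t a)) (hV : V.Indec) : V.IsFLEI := by
  obtain ⟨m, hm, hd⟩ := exists_decomp hR h hh V
  obtain ⟨W⟩ : Nonempty m := by
    by_contra hne
    rw [not_nonempty_iff] at hne
    obtain ⟨i, x, hx⟩ := hV.1
    have h2 := hd.2 i
    rw [iSup_of_empty] at h2
    exact hx ((Submodule.mem_bot F).1 (h2 ▸ Submodule.mem_top))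
  obtain ⟨π, hπ, -⟩ := exists_proj hd W
  obtain ⟨hf, hi⟩ := hm W.1 W.2
  have hb := hV.retract hi.1 W.1.incl π fun i x =>
    W.1.incl_inj i (hπ i _ x.2)
  obtain ⟨N, hN⟩ := (flei_iff (R := R)).1 hf
  exact (flei_iff (R := R)).2 ⟨N, hN.iso (iso_iff.2 ⟨_, hb⟩)⟩

/-- The quotient of `Hom(X, V)` by the morphisms killed by all morphisms to `X` has a basis
indexed by the summands of `V` isomorphic to `X`. -/
theorem exists_basis (hR : R.PD) (hX : R.Mem X) (hXi : X.Indec) {J : Type} {W : J → Subrep V}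
    (hW : IsDecomp W) (hi : ∀ j, (W j).toRep.Indec) :
    Nonempty (Module.Basis {j // Iso X (W j).toRep} F
      (Mor X V ⧸ ⨅ g : Mor V X, LinearMap.ker (Mor.compL X V X g))) := by
  classical
  set K : Submodule F (Mor X V) := ⨅ g : Mor V X, LinearMap.ker (Mor.compL X V X g) with hK
  have hKm : ∀ f, f ∈ K ↔ ∀ g : Mor V X, Mor.comp g f = 0 := fun f => by
    rw [hK, Submodule.mem_iInf]; rfl
  choose π hπ1 hπ2 using exists_proj hW
  choose θ hθ using fun j : {j // Iso X (W j).toRep} => iso_iff.1 j.2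
  let ι : {j // Iso X (W j).toRep} → Mor X V := fun j => Mor.comp (W j.1).incl (θ j)
  let q : {j // Iso X (W j).toRep} → Mor V X := fun j => Mor.comp (Mor.inv _ (hθ j)) (π j.1)
  have hqι : ∀ j, Mor.comp (q j) (ι j) = Mor.id X := fun j => Mor.ext' fun i x => by
    change (Mor.inv _ (hθ j)).1 i ((π j.1).1 i ((W j.1).incl.1 i ((θ j).1 i x))) = x
    have h1 : (π j.1).1 i ((W j.1).incl.1 i ((θ j).1 i x)) = (θ j).1 i x :=
      (W j.1).incl_inj i (hπ1 j.1 i _ ((θ j).1 i x).2)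
    rw [h1, Mor.inv_app_left]
  have hqι0 : ∀ j k, k ≠ j → Mor.comp (q j) (ι k) = 0 := fun j k hk => Mor.ext' fun i x => by
    change (Mor.inv _ (hθ j)).1 i ((π j.1).1 i ((W k.1).incl.1 i ((θ k).1 i x))) = 0
    have h1 : (π j.1).1 i ((W k.1).incl.1 i ((θ k).1 i x)) = 0 :=
      hπ2 j.1 k.1 (fun h => hk (Subtype.ext h)) i _ ((θ k).1 i x).2
    rw [h1, map_zero]
  obtain ⟨i0, x0, hx0⟩ := hXi.1
  have htest : ∀ f : Mor X X, f.1 i0 x0 = 0 → f = 0 := fun f hf => by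
    obtain ⟨c, rfl⟩ := Indec.scalar hR hX hXi f
    have : c • x0 = 0 := hf
    rw [(smul_eq_zero.1 this).resolve_right hx0, zero_smul]
  have hli : LinearIndependent F fun j => K.mkQ (ι j) := by
    rw [linearIndependent_iff']
    intro s c hc j hj
    have hc' : K.mkQ (∑ k ∈ s, c k • ι k) = 0 := by
      rw [map_sum, ← hc]
      exact Finset.sum_congr rfl fun k _ => map_smul _ _ _
    rw [Submodule.mkQ_apply, Submodule.Quotient.mk_eq_zero, hKm] at hc'
    have h1 := hc' (q j)
    have h2 : Mor.compL X V X (q j) (∑ k ∈ s, c k • ι k) = 0 := h1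
    rw [map_sum, Finset.sum_eq_single j] at h2
    · rw [map_smul] at h2
      have h3 : c j • Mor.id X = 0 := by rw [← hqι j]; exact h2
      exact (smul_eq_zero.1 h3).resolve_right (id_ne_zero hXi.1)
    · intro k _ hk
      rw [map_smul]
      exact (congrArg _ (hqι0 j k hk)).trans (smul_zero _)
    · exact fun h => absurd hj h
  refine ⟨Module.Basis.mk hli fun y _ => ?_⟩
  obtain ⟨f, rfl⟩ := K.mkQ_surjective y
  obtain ⟨t, ht⟩ := exists_support hW π hπ1 hπ2 i0 (f.1 i0 x0)
  choose c hc using fun j => Indec.scalar hR hX hXi (Mor.comp (q j) f)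
  have hcf : f - ∑ j ∈ t.subtype (fun j => Iso X (W j).toRep), c j • ι j ∈ K := by
    rw [hKm]
    intro g
    refine htest _ ?_
    change g.1 i0 ((f - ∑ j ∈ t.subtype (fun j => Iso X (W j).toRep), c j • ι j).1 i0 x0) = 0
    have hsum : (∑ j ∈ t.subtype (fun j => Iso X (W j).toRep), c j • ι j).1 i0 x0 =
        ∑ j ∈ t.subtype (fun j => Iso X (W j).toRep), c j • (ι j).1 i0 x0 := by
      let ev : Mor X V →ₗ[F] V.M i0 :=
        { toFun := fun f => f.1 i0 x0, map_add' := fun _ _ => rfl, map_smul' := fun _ _ => rfl }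
      change ev _ = _
      rw [map_sum]; rfl
    rw [Mor.sub_app, hsum, map_sub, sub_eq_zero]
    conv_lhs => rw [ht]
    rw [map_sum, map_sum]
    have hzero : ∀ j ∈ t, ¬ Iso X (W j).toRep →
        g.1 i0 ((W j).incl.1 i0 ((π j).1 i0 (f.1 i0 x0))) = 0 := fun j _ hj => by
      by_contra hne
      refine hj (iso_iff.2 ⟨Mor.comp (π j) f, ?_⟩)
      obtain ⟨d, hd⟩ := Indec.scalar hR hX hXi
        (Mor.comp (Mor.comp g (W j).incl) (Mor.comp (π j) f))
      have hd' : ∀ i x, g.1 i ((W j).incl.1 i ((π j).1 i (f.1 i x))) = d • x := fun i x =>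
        congrArg (fun f : Mor X X => f.1 i x) hd
      have hd0 : d ≠ 0 := fun h0 => hne (by rw [hd', h0, zero_smul])
      refine (hi j).retract hXi.1 _ (d⁻¹ • Mor.comp g (W j).incl) fun i x => ?_
      change d⁻¹ • g.1 i ((W j).incl.1 i ((π j).1 i (f.1 i x))) = x
      rw [hd', smul_smul, inv_mul_cancel₀ hd0, one_smul]
    rw [← Finset.sum_filter_of_ne (p := fun j => Iso X (W j).toRep) fun j hj hne => by
      by_contra hn; exact hne (hzero j hj hn), ← Finset.subtype_map, Finset.sum_map]
    refine Finset.sum_congr rfl fun j _ => congrArg _ ?_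
    have h1 : (q j).1 i0 (f.1 i0 x0) = c j • x0 :=
      congrArg (fun f : Mor X X => f.1 i0 x0) (hc j)
    rw [← map_smul, ← h1]
    change _ = (W j.1).incl.1 i0 ((θ j).1 i0 ((Mor.inv _ (hθ j)).1 i0 _))
    rw [Mor.inv_app_right]; rfl
  rw [← sub_add_cancel f (∑ j ∈ t.subtype (fun j => Iso X (W j).toRep), c j • ι j), map_add,
    show K.mkQ (f - _) = 0 from (Submodule.Quotient.mk_eq_zero K).2 hcf, zero_add, map_sum]
  exact Submodule.sum_mem _ fun j _ => by
    rw [map_smul]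
    exact Submodule.smul_mem _ _ (Submodule.subset_span ⟨j, rfl⟩)

theorem krull_schmidt (hR : ∀ N, (R.shift N).PD) (h : Q.V → ℕ)
    (hh : ∀ a, h (Q.s a) < h (Q.t a)) {J J' : Type} {W : J → Subrep V} {W' : J' → Subrep V}
    (hi : ∀ j, (W j).toRep.Indec) (hW : IsDecomp W)
    (hi' : ∀ j, (W' j).toRep.Indec) (hW' : IsDecomp W') :
    ∃ e : J ≃ J', ∀ j, Iso (W j).toRep (W' (e j)).toRep := by
  let st : Setoid (QRep F Q) := ⟨Iso, Iso.refl, Iso.symm, Iso.trans⟩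
  let f : J → Quotient st := fun j => ⟦(W j).toRep⟧
  let f' : J' → Quotient st := fun j => ⟦(W' j).toRep⟧
  have key : ∀ X : QRep F Q, X.Indec →
      Nonempty ({j // Iso X (W j).toRep} ≃ {j // Iso X (W' j).toRep}) := fun X hXi => by
    obtain ⟨N, hN⟩ := (flei_iff (R := R)).1 (Indec.flei hR h hh hXi)
    obtain ⟨b⟩ := exists_basis (hR N) hN hXi hW hi
    obtain ⟨b'⟩ := exists_basis (hR N) hN hXi hW' hi'
    exact ⟨b.indexEquiv b'⟩
  have hfib : ∀ y : Quotient st, Nonempty ({j // f j = y} ≃ {j // f' j = y}) := fun y => by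
    induction y using Quotient.inductionOn with
    | h X =>
      have h1 : ∀ j, f j = ⟦X⟧ ↔ Iso X (W j).toRep := fun j =>
        Quotient.eq.trans ⟨Iso.symm, Iso.symm⟩
      have h2 : ∀ j, f' j = ⟦X⟧ ↔ Iso X (W' j).toRep := fun j =>
        Quotient.eq.trans ⟨Iso.symm, Iso.symm⟩
      by_cases hXi : X.Indec
      · obtain ⟨e⟩ := key X hXi
        exact ⟨((Equiv.subtypeEquivRight h1).trans e).trans (Equiv.subtypeEquivRight h2).symm⟩
      · have : IsEmpty {j // f j = ⟦X⟧} := ⟨fun j => hXi (((h1 _).1 j.2).symm.indec (hi _))⟩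
        have : IsEmpty {j // f' j = ⟦X⟧} := ⟨fun j => hXi (((h2 _).1 j.2).symm.indec (hi' _))⟩
        exact ⟨Equiv.equivOfIsEmpty _ _⟩
  let e : ∀ y, {j // f j = y} ≃ {j // f' j = y} := fun y => (hfib y).some
  refine ⟨((Equiv.sigmaFiberEquiv f).symm.trans (Equiv.sigmaCongrRight e)).trans
    (Equiv.sigmaFiberEquiv f'), fun j => ?_⟩
  exact Quotient.exact ((e (f j) ⟨j, rfl⟩).2).symm

end RayData

/-- Distances from a set of points along a relation. -/
theorem exists_depth {α : Type} (rel : α → α → Prop) (Z : Set α) : ∃ d : α → ℕ,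
    (∀ z ∈ Z, d z = 0) ∧ ∀ v, (∃ z ∈ Z, Relation.ReflTransGen rel z v) → v ∉ Z →
      ∃ w, rel w v ∧ (∃ z ∈ Z, Relation.ReflTransGen rel z w) ∧ d w + 1 = d v := by
  let L : ℕ → Set α := fun n => Nat.rec Z (fun _ s => {v | ∃ w ∈ s, rel w v}) n
  have hL : ∀ n v, v ∈ L n → ∃ z ∈ Z, Relation.ReflTransGen rel z v := fun n => by
    induction n with
    | zero => exact fun v hv => ⟨v, hv, .refl⟩
    | succ n ih =>
      rintro v ⟨w, hw, hwv⟩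
      obtain ⟨z, hz, h⟩ := ih w hw
      exact ⟨z, hz, h.tail hwv⟩
  refine ⟨fun v => sInf {n | v ∈ L n}, fun z hz => ?_, fun v hv hvZ => ?_⟩
  · exact Nat.sInf_eq_zero.2 (Or.inl hz)
  have hne : {n | v ∈ L n}.Nonempty := by
    obtain ⟨z, hz, h⟩ := hv
    induction h with
    | refl => exact absurd hz hvZ
    | @tail b c hb hbc ih =>
      by_cases hbZ : b ∈ Z
      · exact ⟨1, b, hbZ, hbc⟩
      · obtain ⟨n, hn⟩ := ih hbZ
        exact ⟨n + 1, b, hn, hbc⟩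
  have hm := Nat.sInf_mem hne
  rcases h : sInf {n | v ∈ L n} with _ | n
  · rw [h] at hm
    exact absurd hm hvZ
  rw [h] at hm
  obtain ⟨w, hw, hwv⟩ := hm
  refine ⟨w, hwv, hL _ _ hw, ?_⟩
  have h1 : sInf {n | w ∈ L n} ≤ n := Nat.sInf_le hw
  have h2 : sInf {n | v ∈ L n} ≤ sInf {n | w ∈ L n} + 1 :=
    Nat.sInf_le ⟨w, Nat.sInf_mem (s := {n | w ∈ L n}) ⟨n, hw⟩, hwv⟩
  change sInf {n | w ∈ L n} + 1 = sInf {n | v ∈ L n}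
  omega

theorem Quiv.Adj.symm {Q : Quiv} {i j : Q.V} (h : Q.Adj i j) : Q.Adj j i :=
  h.imp fun _ h => h.symm

theorem Subquiv.Adj.symm {Q : Quiv} {S : Subquiv Q} {i j : Q.V} (h : S.Adj i j) : S.Adj j i :=
  h.imp fun _ h => ⟨h.1, h.2.symm⟩

/-- A rooted spanning tree of a quiver. -/
structure RTree (Q : Quiv) where
  r : Q.V
  par : Q.V → Q.V
  arr : ∀ v, v ≠ r → Q.A
  d : Q.V → ℕ
  d_r : d r = 0
  par_r : par r = r
  d_par : ∀ v, v ≠ r → d (par v) + 1 = d v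
  joins : ∀ v h, (Q.s (arr v h) = v ∧ Q.t (arr v h) = par v) ∨
    (Q.s (arr v h) = par v ∧ Q.t (arr v h) = v)

theorem Quiv.Connected.exists_tree {Q : Quiv} (hQ : Q.Connected) (r : Q.V) :
    ∃ T : RTree Q, T.r = r := by
  classical
  obtain ⟨d, hd, hp⟩ := exists_depth Q.Adj {r}
  have hp' : ∀ v, v ≠ r → ∃ w, Q.Adj w v ∧ d w + 1 = d v := fun v hv => by
    obtain ⟨w, h1, -, h2⟩ := hp v ⟨r, rfl, hQ r v⟩ hv
    exact ⟨w, h1, h2⟩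
  choose p hpa hpd using hp'
  choose a ha using hpa
  refine ⟨⟨r, fun v => if h : v = r then r else p v h, a, d, hd r rfl, by simp, fun v hv => ?_,
    fun v hv => ?_⟩, rfl⟩
  · rw [dif_neg hv]; exact hpd v hv
  · rw [dif_neg hv]; exact (ha v hv).symm

namespace RTree

variable {Q : Quiv} (T : RTree Q)

/-- The quiver has no arrows outside the spanning tree. -/
def Full : Prop := ∀ a, ∃ v h, T.arr v h = a

theorem induct {P : Q.V → Prop} (h0 : P T.r) (h1 : ∀ v, v ≠ T.r → P (T.par v) → P v) (v : Q.V) :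
    P v := by
  induction hn : T.d v using Nat.strong_induction_on generalizing v with
  | h n ih =>
    by_cases hv : v = T.r
    · exact hv ▸ h0
    · exact h1 v hv (ih _ (by have := T.d_par v hv; omega) _ rfl)

theorem par_ne {v : Q.V} (hv : v ≠ T.r) : T.par v ≠ v := fun h => by
  have := T.d_par v hv
  rw [h] at this
  omega

theorem arr_inj {v w : Q.V} {hv : v ≠ T.r} {hw : w ≠ T.r} (h : T.arr v hv = T.arr w hw) :
    v = w := by
  have h1 := T.d_par v hv
  have h2 := T.d_par w hw
  rcases T.joins v hv with ⟨h3, h4⟩ | ⟨h3, h4⟩ <;> rcases T.joins w hw with ⟨h5, h6⟩ | ⟨h5, h6⟩ <;>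
    rw [h] at h3 h4
  · exact h3.symm.trans h5
  · have e1 := congrArg T.d (h3.symm.trans h5)
    have e2 := congrArg T.d (h4.symm.trans h6)
    omega
  · have e1 := congrArg T.d (h3.symm.trans h5)
    have e2 := congrArg T.d (h4.symm.trans h6)
    omega
  · exact h4.symm.trans h6

/-- A finite set of vertices is contained in a finite set of vertices closed under parents. -/
theorem exists_closure (Z : Finset Q.V) : ∃ Y : Finset Q.V, Z ⊆ Y ∧ T.r ∈ Y ∧
    ∀ v ∈ Y, T.par v ∈ Y := by
  classical
  have h1 : ∀ v, ∃ Y : Finset Q.V, v ∈ Y ∧ ∀ w ∈ Y, T.par w ∈ Y := by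
    refine T.induct ⟨{T.r}, by simp, by simp [T.par_r]⟩ ?_
    rintro v - ⟨Y, h1, h2⟩
    refine ⟨insert v Y, Finset.mem_insert_self _ _, fun w hw => ?_⟩
    rcases Finset.mem_insert.1 hw with rfl | hw
    · exact Finset.mem_insert_of_mem h1
    · exact Finset.mem_insert_of_mem (h2 w hw)
  choose Y hY1 hY2 using h1
  refine ⟨(insert T.r Z).biUnion Y, fun v hv => Finset.mem_biUnion.2
    ⟨v, Finset.mem_insert_of_mem hv, hY1 v⟩, Finset.mem_biUnion.2
    ⟨T.r, Finset.mem_insert_self _ _, hY1 _⟩, fun v hv => ?_⟩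
  obtain ⟨w, hw, hv⟩ := Finset.mem_biUnion.1 hv
  exact Finset.mem_biUnion.2 ⟨w, hw, hY2 w v hv⟩

/-- A set of vertices closed under parents and a set of arrows containing the parent arrows form
an IC subquiver. -/
theorem isIC {S : Subquiv Q} (h1 : ∀ v ∈ S.verts, T.par v ∈ S.verts)
    (h2 : ∀ v h, v ∈ S.verts → T.arr v h ∈ S.arrows) : S.IsIC := by
  have key : ∀ v, v ∈ S.verts → Relation.ReflTransGen S.Adj T.r v := by
    refine T.induct (fun _ => .refl) fun v hv ih hvS => (ih (h1 v hvS)).tail ?_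
    exact ⟨_, h2 v hv hvS, (T.joins v hv).symm⟩
  have hsymm : Std.Symm S.Adj := ⟨fun _ _ h => h.symm⟩
  exact fun i hi j hj _ => (Std.Symm.symm _ _ (key i hi)).trans (key j hj)

theorem exists_finICSub (Z : Finset Q.V) (Y : Finset Q.A) : ∃ S : FinICSub Q,
    ↑Z ⊆ S.1.verts ∧ ↑Y ⊆ S.1.arrows ∧ T.r ∈ S.1.verts ∧
      ∀ v h, v ∈ S.1.verts → T.arr v h ∈ S.1.arrows := by
  classical
  obtain ⟨X, h1, h2, h3⟩ := T.exists_closure (Z ∪ (Y.image Q.s ∪ Y.image Q.t))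
  have hY : ∀ a ∈ Y, Q.s a ∈ X ∧ Q.t a ∈ X := fun a ha =>
    ⟨h1 (by simp only [Finset.mem_union, Finset.mem_image]; exact Or.inr (Or.inl ⟨a, ha, rfl⟩)),
      h1 (by simp only [Finset.mem_union, Finset.mem_image]; exact Or.inr (Or.inr ⟨a, ha, rfl⟩))⟩
  have hX : ∀ a, (∃ v h, v ∈ X ∧ T.arr v h = a) → Q.s a ∈ X ∧ Q.t a ∈ X := by
    rintro _ ⟨v, h, hv, rfl⟩
    rcases T.joins v h with ⟨h4, h5⟩ | ⟨h4, h5⟩ <;> rw [h4, h5]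
    · exact ⟨hv, h3 v hv⟩
    · exact ⟨h3 v hv, hv⟩
  let S : Subquiv Q := ⟨X, {a | a ∈ Y ∨ ∃ v h, v ∈ X ∧ T.arr v h = a},
    fun a ha => ha.elim (fun h => (hY a h).1) fun h => (hX a h).1,
    fun a ha => ha.elim (fun h => (hY a h).2) fun h => (hX a h).2⟩
  refine ⟨⟨S, ⟨X.finite_toSet, ?_⟩, T.isIC h3 fun v h hv => Or.inr ⟨v, h, hv, rfl⟩⟩,
    fun v hv => h1 (Finset.mem_union_left _ hv), fun a ha => Or.inl ha, h2,
    fun v h hv => Or.inr ⟨v, h, hv, rfl⟩⟩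
  refine Y.finite_toSet.union ?_
  refine (Set.finite_range fun v : X => if h : v.1 ≠ T.r then some (T.arr v.1 h) else none)
    |>.preimage (Option.some_injective _).injOn |>.subset ?_
  rintro _ ⟨v, h, hv, rfl⟩
  exact ⟨⟨v, hv⟩, dif_pos h⟩

theorem neBot (T : RTree Q) : (Filter.atTop : Filter (FinICSub Q)).NeBot := by
  classical
  have : Nonempty (FinICSub Q) := ⟨(T.exists_finICSub ∅ ∅).choose⟩
  have : IsDirectedOrder (FinICSub Q) := ⟨fun S1 S2 => by
    obtain ⟨S, h1, h2, -⟩ := T.exists_finICSub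
      (S1.2.1.1.toFinset ∪ S2.2.1.1.toFinset) (S1.2.1.2.toFinset ∪ S2.2.1.2.toFinset)
    simp only [Finset.coe_union, Set.Finite.coe_toFinset, Set.union_subset_iff] at h1 h2
    exact ⟨S, ⟨h1.1, h2.1⟩, ⟨h1.2, h2.2⟩⟩⟩
  infer_instance

theorem form_eq (n : Q.V → ℤ) (X : Finset Q.V) (Y : Finset Q.A) (hr : T.r ∈ X)
    (hY : ∀ a, a ∈ Y ↔ ∃ v h, v ∈ X ∧ T.arr v h = a) :
    ∑ v ∈ X, n v * n v - ∑ a ∈ Y, n (Q.s a) * n (Q.t a) =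
      n T.r ^ 2 + ∑ v ∈ X, n v * (n v - n (T.par v)) := by
  classical
  have h1 : ∑ a ∈ Y, n (Q.s a) * n (Q.t a) = ∑ v ∈ X.erase T.r, n v * n (T.par v) := by
    refine (Finset.sum_bij (fun v hv => T.arr v (Finset.ne_of_mem_erase hv)) ?_ ?_ ?_ ?_).symm
    · exact fun v hv => (hY _).2 ⟨v, _, Finset.mem_of_mem_erase hv, rfl⟩
    · exact fun v hv w hw h => T.arr_inj h
    · intro a ha
      obtain ⟨v, h, hv, rfl⟩ := (hY a).1 ha
      exact ⟨v, Finset.mem_erase.2 ⟨h, hv⟩, rfl⟩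
    · intro v hv
      rcases T.joins v (Finset.ne_of_mem_erase hv) with ⟨h3, h4⟩ | ⟨h3, h4⟩ <;> rw [h3, h4]
      ring
  rw [h1, ← Finset.add_sum_erase X _ hr, ← Finset.add_sum_erase X _ hr, T.par_r, sub_self,
    mul_zero, zero_add]
  simp only [mul_sub, Finset.sum_sub_distrib]
  ring

/-- The value of the Tits form computed along the tree. -/
noncomputable def q (n : Q.V → ℤ) : ℤ := n T.r ^ 2 + ∑ᶠ v, n v * (n v - n (T.par v))

variable {T}

theorem Full.mem_iff (hT : T.Full) {S : Subquiv Q} (hS : S.IsIC) (hQ : Q.Connected)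
    (hr : T.r ∈ S.verts) (a : Q.A) :
    a ∈ S.arrows ↔ ∃ v h, v ∈ S.verts ∧ T.arr v h = a := by
  constructor
  · intro ha
    obtain ⟨v, h, rfl⟩ := hT a
    refine ⟨v, h, ?_, rfl⟩
    rcases T.joins v h with ⟨h1, h2⟩ | ⟨h1, h2⟩
    · exact h1 ▸ S.src_mem _ ha
    · exact h2 ▸ S.tgt_mem _ ha
  · rintro ⟨v, h, hv, rfl⟩
    by_contra hna
    let D : Q.V → Prop := fun w => ∃ k, T.par^[k] w = v
    have hpD : ∀ w, D (T.par w) → D w := fun w ⟨k, hk⟩ => ⟨k + 1, hk⟩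
    have hDp : ∀ w, w ≠ v → D w → D (T.par w) := fun w hw ⟨k, hk⟩ => by
      cases k with
      | zero => exact absurd hk hw
      | succ k => exact ⟨k, hk⟩
    have hDr : ¬ D T.r := fun ⟨k, hk⟩ => h (by
      rw [← hk]; exact Function.iterate_fixed T.par_r k)
    have hadj : ∀ x y, S.Adj x y → ¬ D x → ¬ D y := by
      rintro x y ⟨a, ha, hxy⟩ hx hy
      obtain ⟨w, hw, rfl⟩ := hT a
      have hwv : w ≠ v := by rintro rfl; exact hna ha
      have h1 : ∀ x y, (x = w ∧ y = T.par w) ∨ (x = T.par w ∧ y = w) → ¬ D x → ¬ D y := by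
        rintro x y (⟨rfl, rfl⟩ | ⟨rfl, rfl⟩) hx hy
        · exact hx (hpD _ hy)
        · exact hx (hDp _ hwv hy)
      refine h1 x y ?_ hx hy
      rcases T.joins w hw with ⟨h3, h4⟩ | ⟨h3, h4⟩ <;> rw [h3, h4] at hxy <;> grind
    have hall : ∀ y, Relation.ReflTransGen S.Adj T.r y → ¬ D y := fun y hy => by
      induction hy with
      | refl => exact hDr
      | tail _ hbc ih => exact hadj _ _ hbc ih
    exact hall v (hS _ hr _ hv (hQ _ _)) ⟨0, rfl⟩

theorem tits_eq {S : Subquiv Q} (hf : S.Finite) (hr : T.r ∈ S.verts)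
    (hS : ∀ a, a ∈ S.arrows ↔ ∃ v h, v ∈ S.verts ∧ T.arr v h = a) (n : Q.V → ℤ) :
    tits Q n S = n T.r ^ 2 + ∑ v ∈ hf.1.toFinset, n v * (n v - n (T.par v)) := by
  rw [← T.form_eq n hf.1.toFinset hf.2.toFinset (by simpa using hr) (by simpa using hS), tits,
    ← finsum_mem_finset_eq_sum, ← finsum_mem_finset_eq_sum]
  simp only [Set.Finite.mem_toFinset, sq]

theorem isRoot_iff (hT : T.Full) {n : Q.V → ℤ} :
    IsRoot Q n ↔ {v | n v ≠ n (T.par v)}.Finite := by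
  classical
  constructor
  · intro h
    refine Set.Finite.of_finite_image (f := fun v => if h : v ≠ T.r then some (T.arr v h) else none)
      ((h.image some).subset ?_) fun v hv w hw hvw => ?_
    · rintro _ ⟨v, hv, rfl⟩
      have hvr : v ≠ T.r := by rintro rfl; exact hv (by rw [T.par_r])
      refine ⟨T.arr v hvr, ?_, by simp [hvr]⟩
      rcases T.joins v hvr with ⟨h1, h2⟩ | ⟨h1, h2⟩ <;> simp only [Set.mem_ofPred_eq, h1, h2]
      · exact hv
      · exact Ne.symm hv
    · have hvr : v ≠ T.r := by rintro rfl; exact hv (by rw [T.par_r])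
      have hwr : w ≠ T.r := by rintro rfl; exact hw (by rw [T.par_r])
      simp only [dif_pos hvr, dif_pos hwr, Option.some.injEq] at hvw
      exact T.arr_inj hvw
  · intro h
    refine ((h.image fun v => if h : v ≠ T.r then some (T.arr v h) else none).preimage
      (Option.some_injective _).injOn).subset fun a ha => ?_
    obtain ⟨v, hv, rfl⟩ := hT a
    refine ⟨v, ?_, dif_pos hv⟩
    rcases T.joins v hv with ⟨h1, h2⟩ | ⟨h1, h2⟩ <;> simp only [Set.mem_ofPred_eq, h1, h2] at ha
    · exact ha
    · exact Ne.symm ha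

theorem q_eq {n : Q.V → ℤ} (X : Finset Q.V) (hX : ∀ v, n v ≠ n (T.par v) → v ∈ X) :
    T.q n = n T.r ^ 2 + ∑ v ∈ X, n v * (n v - n (T.par v)) := by
  unfold q
  rw [finsum_eq_sum_of_support_subset]
  intro v hv
  refine hX v fun h => hv ?_
  simp only [h, sub_self, mul_zero]

theorem Full.tendsto (hT : T.Full) (hQ : Q.Connected) {n : Q.V → ℤ} (hn : IsRoot Q n) :
    Filter.Tendsto (titsNet Q n) Filter.atTop (nhds (((T.q n : ℤ) : ℝ) : EReal)) := by
  have hfin := (isRoot_iff hT).1 hn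
  obtain ⟨S0, h1, -, hr, -⟩ := T.exists_finICSub hfin.toFinset ∅
  refine tendsto_const_nhds.congr' ?_
  filter_upwards [Filter.eventually_ge_atTop S0] with S hS
  have hrS : T.r ∈ S.1.verts := hS.1 hr
  have : tits Q n S.1 = T.q n := by
    rw [tits_eq S.2.1 hrS (hT.mem_iff S.2.2 hQ hrS), q_eq]
    intro v hv
    rw [Set.Finite.mem_toFinset]
    exact hS.1 (h1 (by simpa using hv))
  unfold titsNet
  rw [this]

theorem Full.posDef (hT : T.Full) (hQ : Q.Connected)
    (h : ∀ n, IsRoot Q n → (∃ i, n i ≠ 0) → 0 < T.q n) : PosDefTits Q := by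
  intro n hn h0 L hL
  have := T.neBot
  rw [tendsto_nhds_unique hL (hT.tendsto hQ hn)]
  exact_mod_cast h n hn h0

theorem Full.q_pos (hT : T.Full) (hQ : Q.Connected) (h : PosDefTits Q) {n : Q.V → ℤ}
    (hn : IsRoot Q n) (h0 : ∃ i, n i ≠ 0) : 0 < T.q n := by
  exact_mod_cast h n hn h0 _ (hT.tendsto hQ hn)

theorem Full.isPosRoot_iff (hT : T.Full) (hQ : Q.Connected) {n : Q.V → ℤ} :
    IsPosRoot Q n ↔ IsRoot Q n ∧ (∀ i, 0 ≤ n i) ∧ T.q n = 1 := by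
  have := T.neBot
  refine and_congr_right fun hn => and_congr_right fun _ => ⟨fun h => ?_, fun h => ?_⟩
  · have := tendsto_nhds_unique h (hT.tendsto hQ hn)
    exact_mod_cast this.symm
  · rw [← h]; exact hT.tendsto hQ hn

end RTree

theorem tits_one {Q : Quiv} {S : Subquiv Q} (hf : S.Finite) :
    tits Q (fun _ => 1) S = S.verts.ncard - S.arrows.ncard := by
  rw [tits, finsum_mem_eq_finite_toFinset_sum _ hf.1, finsum_mem_eq_finite_toFinset_sum _ hf.2,
    Set.ncard_eq_toFinset_card _ hf.1, Set.ncard_eq_toFinset_card _ hf.2]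
  simp

/-- The Euler characteristic does not increase when a connected subquiver is enlarged. -/
theorem tits_one_antitone {Q : Quiv} (hQ : Q.Connected) {S S' : FinICSub Q} (h : S ≤ S')
    (hne : S.1.verts.Nonempty) : tits Q (fun _ => 1) S'.1 ≤ tits Q (fun _ => 1) S.1 := by
  classical
  obtain ⟨r, hr⟩ := hne
  obtain ⟨d, -, hd⟩ := exists_depth S'.1.Adj S.1.verts
  have hb : ∀ v : ↥(S'.1.verts \ S.1.verts), ∃ a ∈ S'.1.arrows, ∃ w,
      ((Q.s a = w ∧ Q.t a = v) ∨ (Q.s a = v ∧ Q.t a = w)) ∧ d w + 1 = d v := fun v => by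
    obtain ⟨w, ⟨a, ha, haw⟩, -, hw⟩ := hd v ⟨r, hr, S'.2.2 r (h.1 hr) v v.2.1 (hQ _ _)⟩ v.2.2
    exact ⟨a, ha, w, haw, hw⟩
  choose b hb1 w hb2 hb3 using hb
  have hbS : ∀ v, b v ∉ S.1.arrows := fun v hv => by
    rcases hb2 v with h1 | h1
    · exact v.2.2 (h1.2 ▸ S.1.tgt_mem _ hv)
    · exact v.2.2 (h1.1 ▸ S.1.src_mem _ hv)
  have hinj : Function.Injective b := fun v v' hv => by
    have h1 := hb2 v
    have h2 := hb2 v'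
    have h3 := hb3 v
    have h4 := hb3 v'
    rw [hv] at h1
    apply Subtype.ext
    rcases h1 with h1 | h1 <;> rcases h2 with h2 | h2
    · exact h1.2.symm.trans h2.2
    · rw [← h2.2, h1.2] at h4; rw [← h1.1, h2.1] at h3; omega
    · rw [← h2.1, h1.1] at h4; rw [← h1.2, h2.2] at h3; omega
    · exact h1.1.symm.trans h2.1
  have hle : (S'.1.verts \ S.1.verts).ncard ≤ (S'.1.arrows \ S.1.arrows).ncard := by
    have := (S'.2.1.2.sdiff (t := S.1.arrows)).to_subtype
    exact Nat.card_le_card_of_injective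
      (fun v => (⟨b v, hb1 v, hbS v⟩ : ↥(S'.1.arrows \ S.1.arrows)))
      fun v v' h => hinj (congrArg Subtype.val h)
  have h1 := Set.ncard_sdiff_add_ncard_of_subset h.1 S'.2.1.1
  have h2 := Set.ncard_sdiff_add_ncard_of_subset h.2 S'.2.1.2
  rw [tits_one S.2.1, tits_one S'.2.1]
  omega

namespace RTree

variable {Q : Quiv} {T : RTree Q}

theorem full_of_posDef (hQ : Q.Connected) (h : PosDefTits Q) (T : RTree Q) : T.Full := by
  classical
  intro a
  by_contra! hna
  obtain ⟨S0, -, ha, hr, hS0⟩ := T.exists_finICSub ∅ {a}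
  have ha : a ∈ S0.1.arrows := ha (by simp)
  have h0 : tits Q (fun _ => 1) S0.1 ≤ 0 := by
    have := S0.2.1.2.to_subtype
    have : S0.1.verts.ncard ≤ S0.1.arrows.ncard := by
      refine Nat.card_le_card_of_injective (fun v : S0.1.verts => if hv : v.1 = T.r then
        (⟨a, ha⟩ : S0.1.arrows) else ⟨T.arr v.1 hv, hS0 _ _ v.2⟩) fun v w hvw => ?_
      apply Subtype.ext
      by_cases hv : v.1 = T.r <;> by_cases hw : w.1 = T.r
      · rw [hv, hw]
      · simp only [hv, hw, dif_pos, dif_neg, not_false_eq_true, Subtype.mk.injEq] at hvw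
        exact absurd hvw.symm (hna _ _)
      · simp only [hv, hw, dif_pos, dif_neg, not_false_eq_true, Subtype.mk.injEq] at hvw
        exact absurd hvw (hna _ _)
      · simp only [hv, hw, dif_neg, not_false_eq_true, Subtype.mk.injEq] at hvw
        exact T.arr_inj hvw
    rw [tits_one S0.2.1]
    omega
  have hanti : ∀ S S' : FinICSub Q, S0 ≤ S → S ≤ S' →
      titsNet Q (fun _ => 1) S' ≤ titsNet Q (fun _ => 1) S := fun S S' h1 h2 => by
    have := tits_one_antitone hQ h2 ⟨T.r, h1.1 hr⟩
    unfold titsNet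
    exact_mod_cast this
  have hroot : IsRoot Q fun _ => 1 := by simp [IsRoot]
  have htend : Filter.Tendsto (titsNet Q fun _ => 1) Filter.atTop
      (nhds (⨅ S : {S // S0 ≤ S}, titsNet Q (fun _ => 1) S.1)) := by
    refine tendsto_order.2 ⟨fun b hb => ?_, fun b hb => ?_⟩
    · filter_upwards [Filter.eventually_ge_atTop S0] with S hS
      exact hb.trans_le (iInf_le (fun S : {S // S0 ≤ S} => titsNet Q (fun _ => 1) S.1) ⟨S, hS⟩)
    · obtain ⟨⟨S, hS⟩, hSb⟩ := iInf_lt_iff.1 hb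
      filter_upwards [Filter.eventually_ge_atTop S] with S' hS'
      exact (hanti S S' hS hS').trans_lt hSb
  have hpos := h _ hroot ⟨T.r, one_ne_zero⟩ _ htend
  have hle : titsNet Q (fun _ => 1) S0 ≤ 0 := by
    unfold titsNet
    exact_mod_cast h0
  exact absurd (hpos.trans_le ((iInf_le (fun S : {S // S0 ≤ S} => titsNet Q (fun _ => 1) S.1)
    ⟨S0, le_rfl⟩).trans hle)) (lt_irrefl _)

theorem iterate_par_r (k : ℕ) : T.par^[k] T.r = T.r := Function.iterate_fixed T.par_r k

theorem d_iterate_le (k : ℕ) (v : Q.V) : T.d (T.par^[k] v) ≤ T.d v := by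
  induction k generalizing v with
  | zero => exact le_rfl
  | succ k ih =>
    rw [Function.iterate_succ_apply]
    refine (ih _).trans ?_
    by_cases hv : v = T.r
    · rw [hv, T.par_r]
    · have := T.d_par v hv; omega

variable (T) in
/-- The parent relation on vertices other than the root. -/
def Child (v w : Q.V) : Prop := v ≠ T.r ∧ T.par v = w

theorem Child.d {v w : Q.V} (h : T.Child v w) : T.d v = T.d w + 1 := by
  rw [← T.d_par v h.1, h.2]

variable (T) in
/-- The tree contains an extended Dynkin diagram of type D. -/
def Bad : Prop := ∃ w1 w2 u u1 u2, w1 ≠ w2 ∧ u1 ≠ u2 ∧ T.Child w1 T.r ∧ T.Child w2 T.r ∧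
  T.Child u1 u ∧ T.Child u2 u ∧ (u1 ≠ w1 ∧ u1 ≠ w2 ∧ u2 ≠ w1 ∧ u2 ≠ w2) ∧
  ∀ k, T.par^[k] u ≠ w1 ∧ T.par^[k] u ≠ w2

theorem Full.not_bad (hT : T.Full) (hQ : Q.Connected) (h : PosDefTits Q) : ¬ T.Bad := by
  classical
  rintro ⟨w1, w2, u, u1, u2, hw, hu, hw1, hw2, hu1, hu2, ⟨h11, h12, h21, h22⟩, hk⟩
  let Z : Finset Q.V := {w1, w2, u1, u2}
  have hZ : ∀ z, z ∈ Z ↔ z = w1 ∨ z = w2 ∨ z = u1 ∨ z = u2 := by simp [Z]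
  have hZcard : Z.card = 4 := by
    rw [Finset.card_insert_of_notMem, Finset.card_insert_of_notMem, Finset.card_pair hu] <;> grind
  let n : Q.V → ℤ := fun v => if ∃ k, T.par^[k] v ∈ Z then 1 else 2
  have hn1 : ∀ z ∈ Z, n z = 1 := fun z hz => if_pos ⟨0, hz⟩
  have hr : n T.r = 2 := if_neg fun ⟨k, hk⟩ => by
    rw [iterate_par_r, hZ] at hk
    rcases hk with hk | hk | hk | hk
    · exact hw1.1 hk.symm
    · exact hw2.1 hk.symm
    · exact hu1.1 hk.symm
    · exact hu2.1 hk.symm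
  have hu : n u = 2 := if_neg fun ⟨k, hk'⟩ => by
    rw [hZ] at hk'
    have h1 := d_iterate_le (T := T) k u
    rcases hk' with hk' | hk' | hk' | hk'
    · exact (hk k).1 hk'
    · exact (hk k).2 hk'
    · rw [hk', hu1.d] at h1; omega
    · rw [hk', hu2.d] at h1; omega
  have hn2 : ∀ z ∈ Z, n (T.par z) = 2 := fun z hz => by
    rcases (hZ z).1 hz with rfl | rfl | rfl | rfl
    · rw [hw1.2, hr]
    · rw [hw2.2, hr]
    · rw [hu1.2, hu]
    · rw [hu2.2, hu]
  have hne : ∀ v, n v ≠ n (T.par v) → v ∈ Z := fun v hv => by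
    by_contra hvZ
    refine hv (if_congr ⟨fun ⟨k, hk⟩ => ?_, fun ⟨k, hk⟩ => ⟨k + 1, hk⟩⟩ rfl rfl)
    cases k with
    | zero => exact absurd hk hvZ
    | succ k => exact ⟨k, hk⟩
  have hpos := hT.q_pos hQ h (n := n) ((isRoot_iff hT).2 (Z.finite_toSet.subset hne))
    ⟨T.r, by rw [hr]; norm_num⟩
  rw [T.q_eq Z hne, hr, Finset.sum_congr rfl (g := fun _ => (-1 : ℤ))
    fun z hz => by rw [hn1 z hz, hn2 z hz]; norm_num] at hpos
  simp [hZcard] at hpos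

variable (T) in
/-- The root has at most three children and all other vertices have at most one. -/
def StarShaped : Prop := {v | T.Child v T.r}.encard ≤ 3 ∧
  ∀ u v w, u ≠ T.r → T.Child v u → T.Child w u → v = w

theorem ancestor_unique {c c' u : Q.V} (hc : T.Child c T.r) (hc' : T.Child c' T.r) {k l : ℕ}
    (h : T.par^[k] u = c) (h' : T.par^[l] u = c') : c = c' := by
  wlog hkl : k ≤ l generalizing c c' k l
  · exact (this hc' hc h' h (le_of_not_ge hkl)).symm
  obtain ⟨m, rfl⟩ := Nat.exists_eq_add_of_le hkl
  rw [add_comm, Function.iterate_add_apply, h] at h'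
  cases m with
  | zero => exact h'
  | succ m =>
    rw [Function.iterate_succ_apply, hc.2, iterate_par_r] at h'
    exact absurd h'.symm hc'.1

theorem starShaped_of_three_children (hT : ¬ T.Bad) {c1 c2 c3 : Q.V} (h1 : T.Child c1 T.r)
    (h2 : T.Child c2 T.r) (h3 : T.Child c3 T.r) (h12 : c1 ≠ c2) (h13 : c1 ≠ c3) (h23 : c2 ≠ c3) :
    T.StarShaped := by
  classical
  refine ⟨?_, fun u v w hu hv hw => ?_⟩
  · by_contra! h4
    obtain ⟨s, hs, hs4⟩ := Set.exists_subset_encard_eq (Order.add_one_le_of_lt h4)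
    have hs4 : s.encard = 4 := hs4.trans (by norm_num)
    obtain ⟨a, b, c, d, hab, hac, had, hbc, hbd, hcd, rfl⟩ := Set.encard_eq_four.1 hs4
    have ha : T.Child a T.r := hs (by simp)
    have hb : T.Child b T.r := hs (by simp)
    exact hT ⟨a, b, T.r, c, d, hab, hcd, ha, hb, hs (by simp), hs (by simp),
      ⟨hac.symm, hbc.symm, had.symm, hbd.symm⟩, fun k => by
        rw [iterate_par_r]; exact ⟨ha.1.symm, hb.1.symm⟩⟩
  · by_contra hvw
    have key : ∀ c c', T.Child c T.r → T.Child c' T.r → c ≠ c' → (∀ k, T.par^[k] u ≠ c) →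
        (∀ k, T.par^[k] u ≠ c') → False := fun c c' hc hc' hcc' hk hk' =>
      hT ⟨c, c', u, v, w, hcc', hvw, hc, hc', hv, hw,
        ⟨fun h => hu (by rw [← hv.2, h, hc.2]), fun h => hu (by rw [← hv.2, h, hc'.2]),
          fun h => hu (by rw [← hw.2, h, hc.2]), fun h => hu (by rw [← hw.2, h, hc'.2])⟩,
        fun k => ⟨hk k, hk' k⟩⟩
    by_cases hk1 : ∃ k, T.par^[k] u = c1
    · obtain ⟨k, hk⟩ := hk1
      exact key c2 c3 h2 h3 h23 (fun l hl => h12 (ancestor_unique h1 h2 hk hl))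
        fun l hl => h13 (ancestor_unique h1 h3 hk hl)
    · push Not at hk1
      by_cases hk2 : ∃ k, T.par^[k] u = c2
      · obtain ⟨k, hk⟩ := hk2
        exact key c1 c3 h1 h3 h13 hk1 fun l hl => h23 (ancestor_unique h2 h3 hk hl)
      · push Not at hk2
        exact key c1 c2 h1 h2 h12 hk1 hk2

theorem Full.child_of_adj (hT : T.Full) {x : Q.V} (h : Q.Adj T.r x) : T.Child x T.r := by
  obtain ⟨a, ha⟩ := h
  obtain ⟨v, hv, rfl⟩ := hT a
  have : v = x ∧ T.par v = T.r := by
    rcases T.joins v hv with ⟨h1, h2⟩ | ⟨h1, h2⟩ <;> rw [h1, h2] at ha <;> grind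
  exact this.1 ▸ ⟨hv, this.2⟩

theorem Child.adj {v w : Q.V} (h : T.Child v w) : Q.Adj w v := by
  obtain ⟨hv, rfl⟩ := h
  exact ⟨T.arr v hv, (T.joins v hv).symm⟩

theorem exists_starShaped (hQ : Q.Connected) (r : Q.V)
    (h : ∀ T : RTree Q, T.Full ∧ ¬ T.Bad) : ∃ T : RTree Q, T.StarShaped := by
  obtain ⟨T, hr⟩ := hQ.exists_tree r
  by_cases hb : ∃ u v w, u ≠ T.r ∧ T.Child v u ∧ T.Child w u ∧ v ≠ w
  · obtain ⟨u, v, w, hu, hv, hw, hvw⟩ := hb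
    obtain ⟨T', rfl⟩ := hQ.exists_tree u
    have hp : T.Child T'.r (T.par T'.r) := ⟨hu, rfl⟩
    have h1 := hp.d
    exact ⟨T', starShaped_of_three_children (h T').2 ((h T').1.child_of_adj hv.adj)
      ((h T').1.child_of_adj hw.adj) ((h T').1.child_of_adj hp.adj.symm) hvw
      (fun e => by have h2 := hv.d; rw [e] at h2; omega)
      (fun e => by have h2 := hw.d; rw [e] at h2; omega)⟩
  · refine ⟨T, ?_⟩
    push Not at hb
    by_cases h3 : {v | T.Child v T.r}.encard ≤ 3
    · exact ⟨h3, fun u v w hu hv hw => hb u v w hu hv hw⟩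
    · obtain ⟨s, hs, hs3⟩ := Set.exists_subset_encard_eq (not_le.1 h3).le
      obtain ⟨a, b, c, hab, hac, hbc, rfl⟩ := Set.encard_eq_three.1 hs3
      exact starShaped_of_three_children (h T).2 (hs (by simp)) (hs (by simp)) (hs (by simp))
        hab hac hbc

end RTree

/-- The contribution of an arm of length `m` to the Tits form of a star. -/
def armForm (m : ℕ) (g : ℕ → ℤ) : ℤ := ∑ k ∈ Finset.range m, g (k + 1) * (g (k + 1) - g k)

theorem armForm_succ (m : ℕ) (g : ℕ → ℤ) :
    armForm (m + 1) g = armForm m (fun k => g (k + 1)) + g 1 * (g 1 - g 0) :=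
  Finset.sum_range_succ' _ _

theorem armForm_ge (m : ℕ) (g : ℕ → ℤ) : 0 ≤ (m + 1) * (2 * armForm m g) + m * g 0 ^ 2 := by
  induction m generalizing g with
  | zero => simp [armForm]
  | succ m ih =>
    have h := ih fun k => g (k + 1)
    rw [armForm_succ]
    push_cast
    simp only [zero_add] at h
    set A := armForm m fun k => g (k + 1)
    have h1 : 0 ≤ ((m : ℤ) + 1) * ((m + 1 + 1) * (2 * (A + g 1 * (g 1 - g 0))) +
        (m + 1) * g 0 ^ 2) := by
      have h2 := mul_nonneg (by positivity : (0 : ℤ) ≤ m + 2) h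
      nlinarith [sq_nonneg (((m : ℤ) + 2) * g 1 - (m + 1) * g 0)]
    exact nonneg_of_mul_nonneg_right h1 (by positivity)

theorem armForm_eq_zero {m : ℕ} {g : ℕ → ℤ} (h0 : g 0 = 0) (h : armForm m g ≤ 0) :
    ∀ k ≤ m, g k = 0 := by
  induction m generalizing g with
  | zero => intro k hk; rw [Nat.le_zero.1 hk, h0]
  | succ m ih =>
    have h1 := armForm_ge m fun k => g (k + 1)
    rw [armForm_succ, h0] at h
    simp only [zero_add] at h1
    set A := armForm m fun k => g (k + 1) with hA
    have h2 : g 1 = 0 := by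
      have : ((m : ℤ) + 2) * g 1 ^ 2 ≤ 0 := by
        have h2 := mul_nonneg (by positivity : (0 : ℤ) ≤ m + 1)
          (sub_nonneg.2 h)
        nlinarith
      have h3 : g 1 ^ 2 ≤ 0 := by
        by_contra! h3
        have : 0 < ((m : ℤ) + 2) * g 1 ^ 2 := by positivity
        omega
      exact pow_eq_zero_iff two_ne_zero |>.1 (le_antisymm h3 (sq_nonneg _))
    rw [h2] at h
    rintro (_ | k) hk
    · exact h0
    · exact ih (g := fun k => g (k + 1)) h2 (by simpa using h) k (by omega)

theorem star_pos {m : Fin 3 → ℕ} (hm : 1 < ∑ i, (1 : ℚ) / (m i + 1)) {f : Fin 3 → ℕ → ℤ} {c : ℤ}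
    (h0 : ∀ i, f i 0 = c) (hf : ∃ i k, k ≤ m i ∧ f i k ≠ 0) :
    0 < c ^ 2 + ∑ i, armForm (m i) (f i) := by
  have key : ∀ i, -(c : ℚ) ^ 2 * (1 - 1 / (m i + 1)) ≤ 2 * armForm (m i) (f i) := fun i => by
    have h1 : (0 : ℚ) ≤ (m i + 1) * (2 * armForm (m i) (f i)) + m i * c ^ 2 := by
      exact_mod_cast (h0 i) ▸ armForm_ge (m i) (f i)
    have h2 : (0 : ℚ) < m i + 1 := by positivity
    have h3 : -(c : ℚ) ^ 2 * (1 - 1 / (m i + 1)) = -(m i * c ^ 2) / (m i + 1) := by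
      field_simp; ring
    rw [h3, div_le_iff₀ h2]
    linarith
  have hsum : (∑ i, -(c : ℚ) ^ 2 * (1 - 1 / ((m i : ℚ) + 1))) ≤
      ∑ i, 2 * (armForm (m i) (f i) : ℚ) := Finset.sum_le_sum fun i _ => key i
  rw [← Finset.mul_sum, ← Finset.mul_sum, Finset.sum_sub_distrib] at hsum
  simp only [Finset.sum_const, Finset.card_univ, Fintype.card_fin, nsmul_eq_mul, mul_one] at hsum
  by_cases hc : c = 0
  · subst hc
    have hnn : ∀ i, 0 ≤ armForm (m i) (f i) := fun i => by
      have := key i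
      simp only [Int.cast_zero, ne_eq, OfNat.ofNat_ne_zero, not_false_eq_true, zero_pow, neg_zero,
        zero_mul] at this
      have : (0 : ℚ) ≤ armForm (m i) (f i) := by linarith
      exact_mod_cast this
    obtain ⟨i, k, hk, hne⟩ := hf
    have hi : 0 < armForm (m i) (f i) := by
      by_contra! h
      exact hne (armForm_eq_zero (h0 i) h k hk)
    simpa using Finset.sum_pos' (fun i _ => hnn i) ⟨i, Finset.mem_univ _, hi⟩
  · have hc2 : (0 : ℚ) < (c : ℚ) ^ 2 := by positivity
    have : (0 : ℚ) < c ^ 2 + ∑ i, (armForm (m i) (f i) : ℚ) := by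
      push_cast at hsum
      nlinarith
    exact_mod_cast this

namespace RTree

variable {Q : Quiv}

/-- Three disjoint (possibly infinite) arms starting at the root of a tree; `al i k` says that the
`i`-th arm has length at least `k`. -/
structure Arms (T : RTree Q) where
  x : Fin 3 → ℕ → Q.V
  al : Fin 3 → ℕ → Prop
  x_zero : ∀ i, x i 0 = T.r
  al_zero : ∀ i, al i 0
  al_of_succ : ∀ i k, al i (k + 1) → al i k
  child : ∀ i k, al i (k + 1) → T.Child (x i (k + 1)) (x i k)
  inj : ∀ i j, al i 1 → al j 1 → x i 1 = x j 1 → i = j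

namespace Arms

variable {T : RTree Q} (A : T.Arms)

/-- The arms contain all vertices. -/
def Covers : Prop := ∀ v, v ≠ T.r → ∃ i k, A.al i (k + 1) ∧ A.x i (k + 1) = v

variable {A}

theorem al_of_le {i : Fin 3} {k l : ℕ} (h : A.al i l) (hkl : k ≤ l) : A.al i k := by
  obtain ⟨m, rfl⟩ := Nat.exists_eq_add_of_le hkl
  clear hkl
  induction m with
  | zero => exact h
  | succ m ih => exact ih (A.al_of_succ i _ h)

theorem d_x {i : Fin 3} {k : ℕ} (h : A.al i k) : T.d (A.x i k) = k := by
  induction k with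
  | zero => rw [A.x_zero, T.d_r]
  | succ k ih => rw [(A.child i k h).d, ih (A.al_of_succ i k h)]

theorem x_inj {i j : Fin 3} {k l : ℕ} (hi : A.al i (k + 1)) (hj : A.al j (l + 1))
    (h : A.x i (k + 1) = A.x j (l + 1)) : i = j ∧ k = l := by
  have hkl : k = l := by
    have h1 := d_x hi
    rw [h, d_x hj] at h1
    omega
  subst hkl
  refine ⟨?_, rfl⟩
  induction k with
  | zero => exact A.inj i j hi hj h
  | succ k ih =>
    refine ih (A.al_of_succ i _ hi) (A.al_of_succ j _ hj) ?_
    rw [← (A.child i _ hi).2, ← (A.child j _ hj).2, h]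

theorem x_ne_r {i : Fin 3} {k : ℕ} (hi : A.al i (k + 1)) : A.x i (k + 1) ≠ T.r := (A.child i k hi).1

open Classical in
variable (A) in
/-- The vertices of the star with arms of length `m`. -/
noncomputable def fin (m : Fin 3 → ℕ) : Finset Q.V :=
  insert T.r ((Finset.univ.sigma fun i => Finset.range (m i)).image fun p => A.x p.1 (p.2 + 1))

theorem mem_fin {m : Fin 3 → ℕ} {v : Q.V} :
    v ∈ A.fin m ↔ v = T.r ∨ ∃ i k, k < m i ∧ A.x i (k + 1) = v := by
  classical
  simp [fin]

theorem mem_fin' {m : Fin 3 → ℕ} {v : Q.V} : v ∈ A.fin m ↔ ∃ i k, k ≤ m i ∧ A.x i k = v := by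
  rw [mem_fin]
  constructor
  · rintro (rfl | ⟨i, k, hk, rfl⟩)
    · exact ⟨0, 0, Nat.zero_le _, A.x_zero 0⟩
    · exact ⟨i, k + 1, hk, rfl⟩
  · rintro ⟨i, _ | k, hk, rfl⟩
    · exact Or.inl (A.x_zero i)
    · exact Or.inr ⟨i, k, hk, rfl⟩

theorem sum_fin {m : Fin 3 → ℕ} (hm : ∀ i, A.al i (m i)) (n : Q.V → ℤ) :
    ∑ v ∈ A.fin m, n v * (n v - n (T.par v)) = ∑ i, armForm (m i) fun k => n (A.x i k) := by
  classical
  rw [fin, Finset.sum_insert, T.par_r, sub_self, mul_zero, zero_add, Finset.sum_image,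
    Finset.sum_sigma]
  · refine Finset.sum_congr rfl fun i _ => Finset.sum_congr rfl fun k hk => ?_
    rw [(A.child i k (al_of_le (hm i) (Finset.mem_range.1 hk))).2]
  · rintro ⟨i, k⟩ hk ⟨j, l⟩ hl h
    simp only [Finset.coe_sigma, Finset.coe_range, Set.mem_sigma_iff, Finset.coe_univ,
      Set.mem_univ, Set.mem_Iio, true_and] at hk hl
    obtain ⟨rfl, rfl⟩ := x_inj (al_of_le (hm i) hk) (al_of_le (hm j) hl) h
    rfl
  · simp only [Finset.mem_image, Finset.mem_sigma, Finset.mem_univ, Finset.mem_range, true_and,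
      not_exists, not_and]
    exact fun p hp => x_ne_r (al_of_le (hm _) hp)

theorem par_mem_fin {m : Fin 3 → ℕ} (hm : ∀ i, A.al i (m i)) {v : Q.V} (hv : v ∈ A.fin m) :
    T.par v ∈ A.fin m := by
  rcases mem_fin.1 hv with rfl | ⟨i, k, hk, rfl⟩
  · rwa [T.par_r]
  · rw [(A.child i k (al_of_le (hm i) hk)).2]
    exact mem_fin'.2 ⟨i, k, hk.le, rfl⟩

theorem exists_cut (A : T.Arms) (N : ℕ) : ∃ m : Fin 3 → ℕ, ∀ i, m i ≤ N ∧ A.al i (m i) ∧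
    (m i = N ∨ ¬ A.al i (m i + 1)) := by
  have key : ∀ i, ∃ m, m ≤ N ∧ A.al i m ∧ (m = N ∨ ¬ A.al i (m + 1)) := fun i => by
    induction N with
    | zero => exact ⟨0, le_rfl, A.al_zero i, Or.inl rfl⟩
    | succ N ih =>
      obtain ⟨m, h1, h2, h3⟩ := ih
      by_cases h : A.al i (m + 1)
      · obtain rfl : m = N := h3.resolve_right (not_not.2 h)
        exact ⟨m + 1, le_rfl, h, Or.inl rfl⟩
      · exact ⟨m, by omega, h2, Or.inr h⟩
  choose m hm using key
  exact ⟨m, hm⟩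

theorem Covers.posDef (hA : A.Covers) (hT : T.Full) (hQ : Q.Connected)
    (h : ∀ m : Fin 3 → ℕ, (∀ i, A.al i (m i)) → 1 < ∑ i, (1 : ℚ) / (m i + 1)) : PosDefTits Q := by
  refine hT.posDef hQ fun n hn ⟨v, hv⟩ => ?_
  obtain ⟨N, hN⟩ := (((isRoot_iff hT).1 hn).image T.d).bddAbove
  obtain ⟨m, hm⟩ := A.exists_cut N
  have hX : ∀ v, n v ≠ n (T.par v) → v ∈ A.fin m := fun v hv => by
    by_cases hr : v = T.r
    · exact mem_fin.2 (Or.inl hr)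
    obtain ⟨i, k, hal, rfl⟩ := hA v hr
    refine mem_fin.2 (Or.inr ⟨i, k, ?_, rfl⟩)
    have h1 : k + 1 ≤ N := d_x hal ▸ hN ⟨_, hv, rfl⟩
    by_contra! h2
    rcases (hm i).2.2 with h3 | h3
    · omega
    · exact h3 (al_of_le hal (by omega))
  rw [T.q_eq _ hX, sum_fin fun i => (hm i).2.1]
  refine star_pos (h m fun i => (hm i).2.1) (fun i => by rw [A.x_zero]) ?_
  have : ∀ v, n v ≠ 0 → ∃ w ∈ A.fin m, n w ≠ 0 := by
    refine T.induct (fun h => ⟨_, mem_fin.2 (Or.inl rfl), h⟩) fun v _ ih hv => ?_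
    by_cases hvm : v ∈ A.fin m
    · exact ⟨v, hvm, hv⟩
    · have : n v = n (T.par v) := by_contra fun h => hvm (hX v h)
      exact ih (this ▸ hv)
  obtain ⟨w, hw, hw0⟩ := this v hv
  obtain ⟨i, k, hk, rfl⟩ := mem_fin'.1 hw
  exact ⟨i, k, hk, hw0⟩

end Arms

theorem StarShaped.exists_arms {T : RTree Q} (h : T.StarShaped) : ∃ A : T.Arms, A.Covers := by
  classical
  have hfin : {v | T.Child v T.r}.Finite :=
    Set.finite_of_encard_le_coe (k := 3) (by exact_mod_cast h.1)
  obtain ⟨c, a, hc, hinj⟩ : ∃ (c : Fin 3 → Q.V) (a : Fin 3 → Prop),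
      (∀ v, T.Child v T.r ↔ ∃ i, a i ∧ c i = v) ∧ ∀ i j, a i → a j → c i = c j → i = j := by
    have := hfin.to_subtype
    have h3 : Nat.card {v | T.Child v T.r} ≤ 3 := by
      have := h.1
      rw [← hfin.cast_ncard_eq] at this
      exact_mod_cast this
    let e := Finite.equivFin {v | T.Child v T.r}
    refine ⟨fun i => if h : i.1 < Nat.card {v | T.Child v T.r} then e.symm ⟨i, h⟩ else T.r,
      fun i => i.1 < Nat.card {v | T.Child v T.r}, fun v => ⟨fun hv => ?_, ?_⟩, ?_⟩
    · exact ⟨⟨e ⟨v, hv⟩, (e ⟨v, hv⟩).2.trans_le h3⟩, (e ⟨v, hv⟩).2, by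
        simp only [Fin.eta, Fin.is_lt, dif_pos]
        exact congrArg Subtype.val (e.symm_apply_apply ⟨v, hv⟩)⟩
    · rintro ⟨i, hi, rfl⟩
      simp only [dif_pos hi]
      exact (e.symm ⟨i, hi⟩).2
    · intro i j hi hj hij
      simp only [dif_pos hi, dif_pos hj] at hij
      have := e.symm.injective (Subtype.ext hij)
      exact Fin.ext (Fin.mk.inj this)
  let nx : Q.V → Q.V := fun u => if h : ∃ v, T.Child v u then h.choose else u
  have hnx : ∀ u v, T.Child v u → T.Child (nx u) u := fun u v hv => by
    have : ∃ v, T.Child v u := ⟨v, hv⟩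
    simp only [nx, dif_pos this]
    exact this.choose_spec
  let x : Fin 3 → ℕ → Q.V := fun i k => Nat.casesOn k T.r fun k => nx^[k] (c i)
  have hx2 : ∀ i k, x i (k + 2) = nx (x i (k + 1)) := fun i k =>
    Function.iterate_succ_apply' nx k (c i)
  refine ⟨⟨x, fun i k => ∀ j < k, (j = 0 → a i) ∧ (j ≠ 0 → ∃ v, T.Child v (x i j)), fun _ => rfl,
    fun i j hj => absurd hj (Nat.not_lt_zero _), fun i k hk j hj => hk j (by omega), ?_, ?_⟩, ?_⟩
  · rintro i (_ | k) hk
    · exact (hc _).2 ⟨i, (hk 0 (by omega)).1 rfl, rfl⟩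
    · obtain ⟨v, hv⟩ := (hk (k + 1) (by omega)).2 (by omega)
      rw [hx2]
      exact hnx _ v hv
  · exact fun i j hi hj hij => hinj i j ((hi 0 (by omega)).1 rfl) ((hj 0 (by omega)).1 rfl) hij
  · refine T.induct (fun h => absurd rfl h) fun v hv ih _ => ?_
    by_cases hp : T.par v = T.r
    · obtain ⟨i, hi, rfl⟩ := (hc v).1 ⟨hv, hp⟩
      exact ⟨i, 0, fun j hj => ⟨fun _ => hi, fun h => absurd (by omega) h⟩, rfl⟩
    · obtain ⟨i, k, hk, hik⟩ := ih hp
      change x i (k + 1) = _ at hik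
      have hch : T.Child v (x i (k + 1)) := ⟨hv, hik.symm⟩
      refine ⟨i, k + 1, fun j hj => ?_, ?_⟩
      · rcases Nat.lt_succ_iff_lt_or_eq.1 hj with hj | rfl
        · exact hk j hj
        · exact ⟨fun h => absurd h (by omega), fun _ => ⟨v, hch⟩⟩
      · change x i (k + 2) = v
        rw [hx2]
        exact h.2 _ _ _ (hik ▸ hp) (hnx _ v hch) hch

end RTree

/-- The tree `T` is compatible with the core and the rays of `R`. -/
structure RayData.Fits {Q : Quiv} (R : RayData Q) (T : RTree Q) : Prop where
  r_mem : T.r ∈ R.T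
  par_mem : ∀ v ∈ R.T, T.par v ∈ R.T
  mem_B : ∀ a, a ∈ R.B ↔ ∃ v h, v ∈ R.T ∧ T.arr v h = a
  par_tgt : ∀ i k, T.par (Q.t (R.ra i k)) = Q.s (R.ra i k)
  arr_tgt : ∀ i k h, T.arr (Q.t (R.ra i k)) h = R.ra i k

namespace RayData.Fits

variable {Q : Quiv} {R : RayData Q} {T : RTree Q}

theorem tgt_ne (h : R.Fits T) (i k) : Q.t (R.ra i k) ≠ T.r := fun e =>
  R.tgt_notin i k (e ▸ h.r_mem)

theorem src_mem_shift (R : RayData Q) {N k : ℕ} (i : R.ι) (hk : k < N) :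
    Q.s (R.ra i k) ∈ (R.shift N).T := by
  rw [R.mem_shift_T]
  cases k with
  | zero => exact Or.inl (R.src0 i)
  | succ k => exact Or.inr ⟨i, k, by omega, R.src_succ i k⟩

theorem shift (h : R.Fits T) (N : ℕ) : (R.shift N).Fits T where
  r_mem := R.mem_shift_T.2 (Or.inl h.r_mem)
  par_mem v hv := by
    rcases R.mem_shift_T.1 hv with hv | ⟨i, k, hk, rfl⟩
    · exact R.mem_shift_T.2 (Or.inl (h.par_mem v hv))
    · rw [h.par_tgt]
      exact src_mem_shift R i hk
  mem_B a := by
    rw [R.mem_shift_B]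
    constructor
    · rintro (ha | ⟨i, k, hk, rfl⟩)
      · obtain ⟨v, hv, hvT, rfl⟩ := (h.mem_B a).1 ha
        exact ⟨v, hv, R.mem_shift_T.2 (Or.inl hvT), rfl⟩
      · exact ⟨_, h.tgt_ne i k, R.mem_shift_T.2 (Or.inr ⟨i, k, hk, rfl⟩), h.arr_tgt i k _⟩
    · rintro ⟨v, hv, hvT, rfl⟩
      rcases R.mem_shift_T.1 hvT with hvT | ⟨i, k, hk, rfl⟩
      · exact Or.inl ((h.mem_B _).2 ⟨v, hv, hvT, rfl⟩)
      · exact Or.inr ⟨i, k, hk, h.arr_tgt i k hv⟩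
  par_tgt i k := h.par_tgt i (N + k)
  arr_tgt i k := h.arr_tgt i (N + k)

theorem mem_of_ne (h : R.Fits T) {n : Q.V → ℤ}
    (hn : ∀ i k, n (Q.s (R.ra i k)) = n (Q.t (R.ra i k))) {v : Q.V} (hv : n v ≠ n (T.par v)) :
    v ∈ R.T := by
  rcases R.coverV v with hvT | ⟨i, k, rfl⟩
  · exact hvT
  · exact absurd (by rw [h.par_tgt, hn]) hv

theorem form_eq_q (h : R.Fits T) {n : Q.V → ℤ}
    (hn : ∀ i k, n (Q.s (R.ra i k)) = n (Q.t (R.ra i k))) : R.form n n = T.q n := by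
  rw [T.q_eq R.T fun v hv => h.mem_of_ne hn hv]
  exact T.form_eq n R.T R.B h.r_mem h.mem_B

theorem pd (h : R.Fits T) (hT : T.Full) (hQ : Q.Connected) (hp : PosDefTits Q) : R.PD := by
  rintro n ⟨v, hv, hn0⟩
  obtain ⟨n', h1, h2⟩ := R.exists_rec (C := fun _ => ℤ) (fun v _ => n v) fun i k c => c
  have h3 : ∀ i k, n' (Q.s (R.ra i k)) = n' (Q.t (R.ra i k)) := fun i k => (h2 i k).symm
  rw [RayData.form_congr (n' := n') (m' := n') (fun v hv => (h1 v hv).symm)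
    fun v hv => (h1 v hv).symm, h.form_eq_q h3]
  exact hT.q_pos hQ hp ((RTree.isRoot_iff hT).2 (R.T.finite_toSet.subset
    fun v hv => h.mem_of_ne h3 hv)) ⟨v, by rwa [h1 v hv]⟩

end RayData.Fits

theorem RTree.Full.exists_height {Q : Quiv} {T : RTree Q} (hT : T.Full) (R : RayData Q) :
    ∃ f : Q.V → ℕ, ∀ a, f (Q.s a) < f (Q.t a) := by
  classical
  let ε : Q.V → ℤ := fun v => if ∃ hv, Q.t (T.arr v hv) = v then 1 else -1
  let g : Q.V → ℤ := fun v => ∑ k ∈ Finset.range (T.d v), ε (T.par^[k] v)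
  have hg : ∀ v, v ≠ T.r → g v = g (T.par v) + ε v := fun v hv => by
    simp only [g, ← T.d_par v hv, Finset.sum_range_succ', Function.iterate_succ_apply,
      Function.iterate_zero, id]
  have hst : ∀ a, g (Q.t a) = g (Q.s a) + 1 := fun a => by
    obtain ⟨v, hv, rfl⟩ := hT a
    rcases T.joins v hv with ⟨h1, h2⟩ | ⟨h1, h2⟩
    · have : ε v = -1 := if_neg fun ⟨_, h3⟩ => T.par_ne hv (h2.symm.trans h3)
      rw [h1, h2, hg v hv, this]; ring
    · have : ε v = 1 := if_pos ⟨hv, h2⟩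
      rw [h1, h2, hg v hv, this]
  obtain ⟨c, hc⟩ := (R.T.image g).bddBelow
  have hle : ∀ v, c ≤ g v := R.induct (fun v hv => hc (Finset.mem_image_of_mem g hv))
    fun i k hk => by rw [hst]; omega
  refine ⟨fun v => (g v - c).toNat, fun a => ?_⟩
  have h1 := hle (Q.s a)
  have h2 := hst a
  change (g (Q.s a) - c).toNat < (g (Q.t a) - c).toNat
  omega

namespace RTree.Arms

variable {Q : Quiv} {T : RTree Q} {A : T.Arms}

theorem exists_outward (hEO : Q.EventuallyOutward) {i : Fin 3} (hi : ∀ k, A.al i k) :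
    ∃ N, ∀ k, N ≤ k → Q.s (T.arr (A.x i (k + 1)) (x_ne_r (hi _))) = A.x i k ∧
      Q.t (T.arr (A.x i (k + 1)) (x_ne_r (hi _))) = A.x i (k + 1) := by
  have hj : ∀ k, (Q.s (T.arr (A.x i (k + 1)) (x_ne_r (hi _))) = A.x i k ∧
      Q.t (T.arr (A.x i (k + 1)) (x_ne_r (hi _))) = A.x i (k + 1)) ∨
      (Q.s (T.arr (A.x i (k + 1)) (x_ne_r (hi _))) = A.x i (k + 1) ∧
      Q.t (T.arr (A.x i (k + 1)) (x_ne_r (hi _))) = A.x i k) := fun k => by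
    have := T.joins (A.x i (k + 1)) (x_ne_r (hi _))
    rw [(A.child i k (hi _)).2] at this
    exact this.symm
  let j : Journey Q := ⟨⊤, A.x i, fun k _ => T.arr (A.x i (k + 1)) (x_ne_r (hi _)),
    fun m n _ _ h => by rw [← d_x (hi m), h, d_x (hi n)], fun k _ => hj k⟩
  obtain ⟨N, hN⟩ := (hEO j).bddAbove
  refine ⟨N + 1, fun k hk => (hj k).resolve_right fun h => ?_⟩
  have : k ≤ N := hN ⟨ENat.natCast_lt_top k, h⟩
  omega

theorem Covers.exists_rayData (hA : A.Covers) (hT : T.Full) (hEO : Q.EventuallyOutward) :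
    ∃ R : RayData Q, R.Fits T := by
  classical
  have hN : ∀ i, ∃ N, (¬ A.al i (N + 1)) ∨ ∃ hi : ∀ k, A.al i k, ∀ k, N ≤ k →
      Q.s (T.arr (A.x i (k + 1)) (x_ne_r (hi _))) = A.x i k ∧
      Q.t (T.arr (A.x i (k + 1)) (x_ne_r (hi _))) = A.x i (k + 1) := fun i => by
    by_cases hi : ∀ k, A.al i k
    · obtain ⟨N, hN⟩ := exists_outward hEO hi
      exact ⟨N, Or.inr ⟨hi, hN⟩⟩
    · push Not at hi
      obtain ⟨k, hk⟩ := hi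
      exact ⟨k, Or.inl fun h => hk (A.al_of_succ i k h)⟩
  choose N hN using hN
  let N0 := ∑ i, N i
  have hN0 : ∀ i, N i ≤ N0 := fun i => Finset.single_le_sum (f := N) (by simp) (Finset.mem_univ i)
  have hout : ∀ i (hi : ∀ k, A.al i k) k,
      Q.s (T.arr (A.x i (N0 + k + 1)) (x_ne_r (hi _))) = A.x i (N0 + k) ∧
      Q.t (T.arr (A.x i (N0 + k + 1)) (x_ne_r (hi _))) = A.x i (N0 + k + 1) := fun i hi k => by
    rcases hN i with h | ⟨_, h⟩
    · exact absurd (hi _) h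
    · exact h _ ((hN0 i).trans (Nat.le_add_right _ _))
  obtain ⟨m, hm⟩ := A.exists_cut N0
  have hm1 : ∀ i, A.al i (m i) := fun i => (hm i).2.1
  have hminf : ∀ i, (∀ k, A.al i k) → m i = N0 := fun i hi =>
    (hm i).2.2.resolve_right (not_not.2 (hi _))
  have hmfin : ∀ i k, m i ≤ k → A.al i (k + 1) → ∀ l, A.al i l := fun i k hk hal => by
    rcases hN i with h | ⟨h, _⟩
    · rcases (hm i).2.2 with h' | h'
      · exact absurd (al_of_le hal (by have := hN0 i; omega)) h
      · exact absurd (al_of_le hal (by omega)) h'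
    · exact h
  have hnotin : ∀ i (hi : ∀ k, A.al i k) k, A.x i (N0 + k + 1) ∉ A.fin m := fun i hi k hmem => by
    rcases mem_fin.1 hmem with h | ⟨j, l, hl, h⟩
    · exact x_ne_r (hi _) h
    · obtain ⟨rfl, rfl⟩ := x_inj (al_of_le (hm1 j) hl) (hi _) h
      have := hminf j hi
      omega
  have hcov : ∀ v, v ∈ A.fin m ∨ ∃ i, ∃ _ : ∀ k, A.al i k, ∃ k, v = A.x i (N0 + k + 1) := by
    intro v
    by_cases hv : v = T.r
    · exact Or.inl (mem_fin.2 (Or.inl hv))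
    obtain ⟨i, k, hal, rfl⟩ := hA v hv
    by_cases hk : k < m i
    · exact Or.inl (mem_fin.2 (Or.inr ⟨i, k, hk, rfl⟩))
    · have hi := hmfin i k (not_lt.1 hk) hal
      have := hminf i hi
      exact Or.inr ⟨i, hi, k - N0, by rw [Nat.add_sub_cancel' (by omega)]⟩
  let B : Finset Q.A := ((A.fin m).subtype (· ≠ T.r)).image fun v => T.arr v.1 v.2
  have hB : ∀ a, a ∈ B ↔ ∃ v h, v ∈ A.fin m ∧ T.arr v h = a := by
    intro a
    simp only [B, Finset.mem_image, Finset.mem_subtype, Subtype.exists, exists_and_left]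
  have hBT : ∀ a ∈ B, Q.s a ∈ A.fin m ∧ Q.t a ∈ A.fin m := fun a ha => by
    obtain ⟨v, h, hv, rfl⟩ := (hB a).1 ha
    have hp := par_mem_fin hm1 hv
    rcases T.joins v h with ⟨h1, h2⟩ | ⟨h1, h2⟩ <;> rw [h1, h2]
    · exact ⟨hv, hp⟩
    · exact ⟨hp, hv⟩
  let R : RayData Q :=
    { T := A.fin m
      B := B
      ι := {i // ∀ k, A.al i k}
      ra := fun i k => T.arr (A.x i.1 (N0 + k + 1)) (x_ne_r (i.2 _))
      srcB := fun a ha => (hBT a ha).1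
      tgtB := fun a ha => (hBT a ha).2
      src0 := fun i => by
        rw [(hout i.1 i.2 0).1]
        exact mem_fin'.2 ⟨i.1, N0, (hminf i.1 i.2).ge, rfl⟩
      src_succ := fun i k => by
        rw [(hout i.1 i.2 (k + 1)).1, (hout i.1 i.2 k).2]; rfl
      tgt_notin := fun i k => by
        rw [(hout i.1 i.2 k).2]
        exact hnotin i.1 i.2 k
      tgt_inj := fun i j k l h => by
        rw [(hout i.1 i.2 k).2, (hout j.1 j.2 l).2] at h
        obtain ⟨h1, h2⟩ := x_inj (i.2 _) (j.2 _) h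
        exact ⟨Subtype.ext h1, by omega⟩
      coverV := fun v => (hcov v).imp_right fun ⟨i, hi, k, h⟩ =>
        ⟨⟨i, hi⟩, k, h.trans (hout i hi k).2.symm⟩
      coverA := fun a => by
        obtain ⟨v, hv, rfl⟩ := hT a
        rcases hcov v with h | ⟨i, hi, k, rfl⟩
        · exact Or.inl ((hB _).2 ⟨v, hv, h, rfl⟩)
        · exact Or.inr ⟨⟨i, hi⟩, k, rfl⟩ }
  refine ⟨R, mem_fin.2 (Or.inl rfl), fun v hv => par_mem_fin hm1 hv, hB, fun i k => ?_,
    fun i k h => ?_⟩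
  · change T.par (Q.t (T.arr (A.x i.1 (N0 + k + 1)) _)) = Q.s (T.arr (A.x i.1 (N0 + k + 1)) _)
    rw [(hout i.1 i.2 k).1, (hout i.1 i.2 k).2, (A.child _ _ (i.2 _)).2]
  · have key : ∀ v w hv hw, v = w → T.arr v hv = T.arr w hw := by rintro v _ hv hw rfl; rfl
    exact key _ _ _ _ (hout i.1 i.2 k).2

end RTree.Arms

theorem exists_fits {Q : Quiv} (hQ : Q.Connected) (r : Q.V) (hEO : Q.EventuallyOutward)
    (hp : PosDefTits Q) : ∃ (T : RTree Q) (R : RayData Q), T.Full ∧ R.Fits T := by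
  obtain ⟨T, hT⟩ := RTree.exists_starShaped hQ r fun T =>
    ⟨RTree.full_of_posDef hQ hp T, (RTree.full_of_posDef hQ hp T).not_bad hQ hp⟩
  obtain ⟨A, hA⟩ := hT.exists_arms
  obtain ⟨R, hR⟩ := hA.exists_rayData (RTree.full_of_posDef hQ hp T) hEO
  exact ⟨T, R, RTree.full_of_posDef hQ hp T, hR⟩

section Finite

open QRep RayData

variable {F : Type} [Field F] {Q : Quiv} {R : RayData Q} {T : RTree Q}

theorem RayData.dimvec_const {X : QRep F Q} (hX : R.Mem X) (i k) :
    dimvec F X (Q.s (R.ra i k)) = dimvec F X (Q.t (R.ra i k)) :=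
  congrArg Nat.cast (LinearEquiv.ofBijective _ (hX.2 i k)).finrank_eq

theorem QRep.Indec.iso_of_dimvec (hR : ∀ N, (R.shift N).PD) {X Y : QRep F Q} (hX : X.IsFLEI)
    (hY : Y.IsFLEI) (hXi : X.Indec) (hYi : Y.Indec) (h : dimvec F X = dimvec F Y) : Iso X Y := by
  obtain ⟨N, hN⟩ := (R.flei_iff).1 hX
  obtain ⟨M, hM⟩ := (R.flei_iff).1 hY
  exact RayData.Indec.unique (hR (max N M)) (Mem.shift R hN (le_max_left _ _))
    (Mem.shift R hM (le_max_right _ _)) hXi hYi fun v _ => congrFun h v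

theorem QRep.Indec.isPosRoot (hQ : Q.Connected) (hT : T.Full) (hf : R.Fits T)
    (hR : ∀ N, (R.shift N).PD) {X : QRep F Q} (hX : X.IsFLEI) (hXi : X.Indec) :
    IsPosRoot Q (dimvec F X) := by
  obtain ⟨N, hN⟩ := (R.flei_iff).1 hX
  have hc := RayData.dimvec_const hN
  refine (hT.isPosRoot_iff hQ).2 ⟨(RTree.isRoot_iff hT).2 ((R.shift N).T.finite_toSet.subset
    fun v hv => (hf.shift N).mem_of_ne hc hv), fun i => Int.natCast_nonneg _, ?_⟩
  rw [← (hf.shift N).form_eq_q hc]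
  exact (RayData.Indec.one (hR N) hN hXi).2.1

theorem exists_indec_of_isPosRoot (F : Type) [Field F] (hQ : Q.Connected) (hT : T.Full)
    (hf : R.Fits T) (hR : ∀ N, (R.shift N).PD) {n : Q.V → ℤ} (hn : IsPosRoot Q n) :
    ∃ X : QRep F Q, X.Indec ∧ dimvec F X = n := by
  obtain ⟨h1, h2, h3⟩ := (hT.isPosRoot_iff hQ).1 hn
  have hfin : {p : R.ι × ℕ | n (Q.s (R.ra p.1 p.2)) ≠ n (Q.t (R.ra p.1 p.2))}.Finite :=
    Set.Finite.of_finite_image (f := fun p : R.ι × ℕ => R.ra p.1 p.2)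
      (h1.subset (by rintro _ ⟨p, hp, rfl⟩; exact hp))
      fun p _ p' _ h => Prod.ext (R.ra_inj h).1 (R.ra_inj h).2
  obtain ⟨N, hN⟩ := (hfin.image Prod.snd).bddAbove
  have hc : ∀ i k, n (Q.s ((R.shift (N + 1)).ra i k)) = n (Q.t ((R.shift (N + 1)).ra i k)) :=
    fun i k => by
      by_contra hne
      have : N + 1 + k ≤ N := hN ⟨(i, N + 1 + k), hne, rfl⟩
      omega
  obtain ⟨X, -, hXi, hX⟩ := RayData.exists_indec F (hR (N + 1)) n h2 hc
    (by rw [(hf.shift (N + 1)).form_eq_q hc, h3])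
  exact ⟨X, hXi, hX⟩

theorem ksUniqueType_of_pd (hR : ∀ N, (R.shift N).PD) (h : Q.V → ℕ)
    (hh : ∀ a, h (Q.s a) < h (Q.t a)) : KSUniqueType F Q := by
  refine ⟨fun V => ?_, fun V J J' W W' hi hW hi' hW' => krull_schmidt hR h hh hi hW hi' hW',
    fun V W hV hW hd => Indec.iso_of_dimvec hR (Indec.flei hR h hh hV) (Indec.flei hR h hh hW)
      hV hW (funext fun i => by rw [dimvec, dimvec, Module.finrank, Module.finrank, hd i])⟩
  obtain ⟨m, hm, hd⟩ := exists_decomp hR h hh V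
  exact ⟨m, fun W => W.1, fun W => (hm W.1 W.2).2, hd⟩

end Finite

namespace QRep

variable {F : Type} [Field F] {Q : Quiv}

/-- The representation with one-dimensional vertex spaces whose arrows act by given scalars. -/
def scalarRep (μ : Q.A → F) : QRep F Q where
  M _ := F
  map a := LinearMap.lsmul F F (μ a)

theorem exists_coeff {μ ν : Q.A → F} (f : Mor (scalarRep μ) (scalarRep ν)) :
    ∃ g : Q.V → F, (∀ v (x : F), f.1 v x = (x * g v : F)) ∧
      ∀ a, ν a * g (Q.s a) = μ a * g (Q.t a) := by
  let φ : ∀ v, F →ₗ[F] F := fun v => f.1 v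
  have h : ∀ v x, φ v x = x * φ v 1 := fun v x => by
    rw [← smul_eq_mul, ← map_smul, smul_eq_mul, mul_one]
  refine ⟨fun v => φ v 1, h, fun a => ?_⟩
  have h1 : ν a * φ (Q.s a) 1 = φ (Q.t a) (μ a * 1) := f.comm a (1 : F)
  rw [h1, h, mul_one]

theorem scalarRep_indec (T : RTree Q) {μ : Q.A → F} (h : ∀ v hv, μ (T.arr v hv) = 1) :
    (scalarRep μ).Indec := by
  refine indec_iff.2 ⟨⟨T.r, (1 : F), one_ne_zero (α := F)⟩, fun e he => ?_⟩
  obtain ⟨g, hg1, hg2⟩ := exists_coeff e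
  have hc : ∀ v, g v = g T.r := by
    refine T.induct rfl fun v hv ih => ?_
    have := hg2 (T.arr v hv)
    rw [h, one_mul, one_mul] at this
    rcases T.joins v hv with ⟨h1, h2⟩ | ⟨h1, h2⟩ <;> rw [h1, h2] at this
    · rw [this, ih]
    · rw [← this, ih]
  have h2 : g T.r * g T.r = g T.r := by
    have h3 : e.1 T.r (e.1 T.r (1 : F)) = e.1 T.r (1 : F) :=
      congrArg (fun f : Mor _ _ => f.1 T.r (1 : F)) he
    have h4 : e.1 T.r (1 : F) = g T.r := (hg1 T.r 1).trans (one_mul (g T.r))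
    rw [h4] at h3
    exact (hg1 T.r (g T.r)).symm.trans h3
  rcases IsIdempotentElem.iff_eq_zero_or_one.1 (show IsIdempotentElem (g T.r) from h2) with h0 | h1
  · exact Or.inl (Mor.ext' fun v x => (hg1 v x).trans (by rw [hc, h0]; exact mul_zero (M₀ := F) x))
  · exact Or.inr (Mor.ext' fun v x => (hg1 v x).trans (by rw [hc, h1]; exact mul_one (M := F) x))

end QRep

namespace KSUniqueType

open QRep

variable {F : Type} [Field F] {Q : Quiv}

theorem full (h : KSUniqueType F Q) (T : RTree Q) : T.Full := by
  classical
  by_contra hT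
  simp only [RTree.Full, not_forall, not_exists] at hT
  obtain ⟨a, ha⟩ := hT
  obtain ⟨f, hf⟩ := iso_iff.1 (h.2.2 (scalarRep fun _ => (1 : F))
    (scalarRep fun b => if b = a then 0 else 1) (scalarRep_indec T fun _ _ => rfl)
    (scalarRep_indec T fun v hv => if_neg (ha v hv)) fun _ => rfl)
  obtain ⟨g, hg1, hg2⟩ := exists_coeff f
  have := hg2 a
  rw [if_pos rfl, zero_mul, one_mul] at this
  have h1 : f.1 (Q.t a) (1 : F) = (0 : F) := (hg1 _ 1).trans (by rw [← this, mul_zero])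
  exact one_ne_zero (α := F) ((hf (Q.t a)).1 (h1.trans (map_zero _).symm))

end KSUniqueType

namespace QRep

variable {F : Type} [Field F] {Q : Quiv} {E : Type} [AddCommGroup E] [Module F E]

open Classical in
/-- The representation on a family of subspaces of a fixed space, in which an arrow acts by the
inclusion when there is one, and by zero otherwise. -/
noncomputable def inclRep (U : Q.V → Submodule F E) : QRep F Q where
  M v := ↥(U v)
  map a := if h : U (Q.s a) ≤ U (Q.t a) then Submodule.inclusion h else 0

variable (U : Q.V → Submodule F E)

/-- The embedding of the vertex spaces of `inclRep U` in the ambient space. -/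
noncomputable def ambient (v : Q.V) : (inclRep U).M v →ₗ[F] E := (U v).subtype

variable {U}

theorem ambient_inj (v : Q.V) : Function.Injective (ambient U v) := Subtype.val_injective

theorem ambient_mem {v : Q.V} (x : (inclRep U).M v) : ambient U v x ∈ U v :=
  (show ↥(U v) from x).2

theorem exists_ambient {v : Q.V} {x : E} (hx : x ∈ U v) : ∃ z, ambient U v z = x :=
  ⟨(⟨x, hx⟩ : U v), rfl⟩

theorem inclRep_map (a : Q.A) (h : U (Q.s a) ≤ U (Q.t a)) (x) :
    ambient U (Q.t a) ((inclRep U).map a x) = ambient U (Q.s a) x := by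
  have : (inclRep U).map a = Submodule.inclusion h := dif_pos h
  rw [this]; rfl

theorem inclRep_map_eq_zero (a : Q.A) (h : ¬ U (Q.s a) ≤ U (Q.t a)) : (inclRep U).map a = 0 :=
  dif_neg h

/-- The embedding of the vertex spaces of a subrepresentation of `inclRep U` in the ambient
space. -/
noncomputable def subAmbient (W : Subrep (inclRep U)) (v : Q.V) : W.toRep.M v →ₗ[F] E :=
  ambient U v ∘ₗ W.incl.1 v

variable {W : Subrep (inclRep U)}

theorem subAmbient_inj (v : Q.V) : Function.Injective (subAmbient W v) :=
  (ambient_inj v).comp (W.incl_inj v)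

theorem subAmbient_mem {v : Q.V} (x : W.toRep.M v) : subAmbient W v x ∈ U v := ambient_mem _

theorem toRep_map (a : Q.A) (h : U (Q.s a) ≤ U (Q.t a)) (x) :
    subAmbient W (Q.t a) (W.toRep.map a x) = subAmbient W (Q.s a) x := by
  change ambient U _ (W.incl.1 _ _) = _
  rw [← W.incl.comm, inclRep_map a h]; rfl

theorem toRep_map_eq_zero (a : Q.A) (h : ¬ U (Q.s a) ≤ U (Q.t a)) : W.toRep.map a = 0 :=
  LinearMap.ext fun x => W.incl_inj _ (by
    rw [← W.incl.comm, inclRep_map_eq_zero a h, LinearMap.zero_apply, LinearMap.zero_apply,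
      map_zero])

/-- In an indecomposable subrepresentation of `inclRep U`, a vector `x` normalised by a functional
`c` spans, provided that `x` lies in it wherever `c` does not vanish. -/
theorem eq_smul_of_indec (hW : W.toRep.Indec) (c : E →ₗ[F] F) {x : E}
    (hcx : c x = 1) (h0 : ∃ v z, subAmbient W v z = x)
    (hx : ∀ v y, c (subAmbient W v y) ≠ 0 → ∃ z, subAmbient W v z = x)
    {v : Q.V} (y : W.toRep.M v) : subAmbient W v y = c (subAmbient W v y) • x := by
  classical
  let φ : ∀ v, W.toRep.M v →ₗ[F] W.toRep.M v := fun v =>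
    if h : ∃ z, subAmbient W v z = x then (c ∘ₗ subAmbient W v).smulRight h.choose else 0
  have hφ : ∀ v y, subAmbient W v (φ v y) = c (subAmbient W v y) • x := fun v y => by
    by_cases h : ∃ z, subAmbient W v z = x
    · have : φ v = (c ∘ₗ subAmbient W v).smulRight h.choose := dif_pos h
      rw [this, LinearMap.smulRight_apply, map_smul, h.choose_spec, LinearMap.comp_apply]
    · have h1 : φ v = 0 := dif_neg h
      have h2 : c (subAmbient W v y) = 0 := by_contra fun h2 => h (hx v y h2)
      rw [h1, h2, zero_smul, LinearMap.zero_apply, map_zero]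
  have hmem : φ ∈ HomS W.toRep W.toRep := mem_HomS.2 fun a y => by
    by_cases h : U (Q.s a) ≤ U (Q.t a)
    · apply subAmbient_inj
      rw [toRep_map a h, hφ, hφ, toRep_map a h]
    · rw [toRep_map_eq_zero a h, LinearMap.zero_apply, LinearMap.zero_apply, map_zero]
  rcases hW.idem ⟨φ, hmem⟩ (Mor.ext' fun v y => subAmbient_inj v (by
    change subAmbient W v (φ v (φ v y)) = subAmbient W v (φ v y)
    rw [hφ, hφ, map_smul, hcx, smul_eq_mul, mul_one])) with h | h
  · obtain ⟨v, z, rfl⟩ := h0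
    have h1 := hφ v z
    rw [show φ v z = 0 from congrArg (fun f : Mor _ _ => f.1 v z) h, hcx, one_smul,
      map_zero] at h1
    rw [← h1, map_zero] at hcx
    exact absurd hcx zero_ne_one
  · have h1 := hφ v y
    rwa [show φ v y = y from congrArg (fun f : Mor _ _ => f.1 v y) h] at h1

end QRep

namespace KSUniqueType

open QRep

variable {F : Type} [Field F] {Q : Quiv}

theorem not_inward_ray (h : KSUniqueType F Q) {x : ℕ → Q.V} {ar : ℕ → Q.A} {I : Set ℕ}
    (hI : I.Infinite) (hx : Function.Injective x)
    (hin : ∀ k ∈ I, Q.s (ar k) = x (k + 1) ∧ Q.t (ar k) = x k)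
    (hout : ∀ k ∉ I, Q.s (ar k) = x k ∧ Q.t (ar k) = x (k + 1)) : False := by
  classical
  let U : Q.V → Submodule F (ℕ → F) := fun v =>
    { carrier := {f | ∀ m, f m ≠ 0 → m ∈ I ∧ ∃ k ≤ m, x k = v}
      zero_mem' := fun m hm => absurd rfl hm
      add_mem' := fun {f g} hf hg m hm => by
        by_cases h0 : f m = 0
        · exact hg m fun h1 => hm (by rw [Pi.add_apply, h0, h1, add_zero])
        · exact hf m h0
      smul_mem' := fun c f hf m hm => hf m fun h0 => hm (by
        rw [Pi.smul_apply, h0, smul_zero]) }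
  have hU : ∀ k (f : ℕ → F), f ∈ U (x k) ↔ ∀ m, f m ≠ 0 → m ∈ I ∧ k ≤ m := fun k f =>
    forall₂_congr fun m _ => and_congr_right fun _ =>
      ⟨fun ⟨l, hl, h1⟩ => hx h1 ▸ hl, fun hk => ⟨k, hk, rfl⟩⟩
  have hUle : ∀ {k l}, k ≤ l → U (x l) ≤ U (x k) := fun hkl f hf =>
    (hU _ f).2 fun m hm => ⟨((hU _ f).1 hf m hm).1, hkl.trans ((hU _ f).1 hf m hm).2⟩
  have hUout : ∀ k ∉ I, U (x k) ≤ U (x (k + 1)) := fun k hk f hf =>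
    (hU _ f).2 fun m hm => by
      obtain ⟨h1, h2⟩ := (hU _ f).1 hf m hm
      refine ⟨h1, lt_of_le_of_ne h2 ?_⟩
      rintro rfl
      exact hk h1
  obtain ⟨J, W, hWi, hW⟩ := h.1 (inclRep U)
  choose π h1 h2 using exists_proj hW
  let P : ∀ j v, (inclRep U).M v →ₗ[F] (ℕ → F) := fun j v => subAmbient (W j) v ∘ₗ (π j).1 v
  have hP1 : ∀ j v (y : (W j).toRep.M v), P j v ((W j).incl.1 v y) = subAmbient (W j) v y :=
    fun j v y => congrArg (ambient U v) (h1 j v ((W j).incl.1 v y) y.2)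
  have hP2 : ∀ i j v (y : (W i).toRep.M v), i ≠ j → P j v ((W i).incl.1 v y) = 0 :=
    fun i j v y hij =>
      (congrArg (subAmbient (W j) v) (h2 j i hij v _ y.2)).trans (map_zero _)
  have harr : ∀ j a v w, Q.s a = v → Q.t a = w → U v ≤ U w → ∀ z z',
      ambient U v z = ambient U w z' → P j v z = P j w z' := by
    rintro j a _ _ rfl rfl hle z z' hz
    have : (inclRep U).map a z = z' := ambient_inj _ ((inclRep_map a hle z).trans hz)
    rw [← this]
    change subAmbient (W j) _ ((π j).1 _ z) = subAmbient (W j) _ ((π j).1 _ _)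
    rw [← (π j).comm, toRep_map a hle]
  have hP0 : ∀ j k z z', ambient U (x k) z = ambient U (x 0) z' → P j (x k) z = P j (x 0) z' := by
    intro j k
    induction k with
    | zero => intro z z' hz; rw [ambient_inj _ hz]
    | succ k ih =>
      intro z z' hz
      obtain ⟨y, hy⟩ := exists_ambient (hUle k.le_succ (ambient_mem z))
      rw [← ih y z' (hy.trans hz)]
      by_cases hk : k ∈ I
      · exact harr j (ar k) _ _ (hin k hk).1 (hin k hk).2 (hUle k.le_succ) z y hy.symm
      · exact (harr j (ar k) _ _ (hout k hk).1 (hout k hk).2 (hUout k hk) y z hy).symm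
  have hPk : ∀ j k l z z', ambient U (x k) z = ambient U (x l) z' → P j (x k) z = P j (x l) z' :=
    fun j k l z z' hz => by
      obtain ⟨y, hy⟩ := exists_ambient (hUle k.zero_le (ambient_mem z))
      rw [hP0 j k z y hy.symm, hP0 j l z' y (hz.symm.trans hy.symm)]
  have hw : ∀ n ∈ I, ∃ j, ∃ y : (W j).toRep.M (x n), subAmbient (W j) _ y n = 1 := by
    intro n hn
    obtain ⟨z, hz⟩ := exists_ambient (U := U) (v := x n) (x := Pi.single n 1)
      ((hU n _).2 fun m hm => by
        obtain rfl : m = n := by_contra fun hmn => hm (Pi.single_eq_of_ne hmn _)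
        exact ⟨hn, le_rfl⟩)
    obtain ⟨t, ht⟩ := exists_support hW π h1 h2 (x n) z
    have h3 : (1 : F) = ∑ j ∈ t, P j (x n) z n := by
      have := congrFun (congrArg (ambient U (x n)) ht) n
      rw [hz, Pi.single_eq_same, map_sum, Finset.sum_apply] at this
      exact this
    obtain ⟨j, -, hj⟩ := Finset.exists_ne_zero_of_sum_ne_zero (h3 ▸ one_ne_zero)
    refine ⟨j, (P j (x n) z n)⁻¹ • (π j).1 (x n) z, ?_⟩
    rw [map_smul, Pi.smul_apply, smul_eq_mul]
    exact inv_mul_cancel₀ hj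
  have hline : ∀ n ∈ I, ∀ j (y : (W j).toRep.M (x n)), subAmbient (W j) _ y n = 1 → ∀ v y',
      subAmbient (W j) v y' = subAmbient (W j) v y' n • subAmbient (W j) _ y := by
    intro n hn j y hy v y'
    refine eq_smul_of_indec (hWi j) (LinearMap.proj n) hy ⟨_, y, rfl⟩ (fun v y' hv => ?_) y'
    obtain ⟨-, k, hk, rfl⟩ := subAmbient_mem y' n hv
    obtain ⟨z, hz⟩ := exists_ambient (hUle hk (subAmbient_mem y))
    exact ⟨(π j).1 _ z, (hPk j k n z ((W j).incl.1 _ y) hz).trans (hP1 j _ y)⟩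
  choose jn yn hyn using hw
  have hinj : ∀ m hm n hn, m < n → jn m hm ≠ jn n hn := by
    intro m hm n hn hmn hj
    have key : ∀ j (y : (W j).toRep.M (x n)), j = jn m hm → subAmbient (W j) _ y n = 1 → False := by
      rintro _ y rfl hy
      have h3 := hline m hm _ _ (hyn m hm) _ y
      have h4 : subAmbient _ _ y m = 0 := by
        by_contra h4
        exact absurd ((hU n _).1 (subAmbient_mem y) m h4).2 (not_le.2 hmn)
      rw [h4, zero_smul] at h3
      rw [h3] at hy
      exact zero_ne_one hy
    exact key _ _ hj.symm (hyn n hn)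
  let w : ℕ → ℕ → F := fun n => if hn : n ∈ I then subAmbient (W (jn n hn)) _ (yn n hn) else 0
  have hw1 : ∀ n (hn : n ∈ I), w n = subAmbient (W (jn n hn)) _ (yn n hn) := fun n hn => dif_pos hn
  have hwU : ∀ n, w n ∈ U (x n) := fun n => by
    by_cases hn : n ∈ I
    · rw [hw1 n hn]; exact subAmbient_mem _
    · rw [show w n = 0 from dif_neg hn]; exact Submodule.zero_mem _
  choose z hz using fun n => exists_ambient (hUle n.zero_le (hwU n))
  let s : ℕ → F := fun m => ∑ n ∈ Finset.range (m + 1), w n m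
  obtain ⟨zs, hzs⟩ := exists_ambient (U := U) (v := x 0) (x := s) ((hU 0 s).2 fun m hm => by
    obtain ⟨n, -, hn⟩ := Finset.exists_ne_zero_of_sum_ne_zero hm
    exact ⟨((hU n _).1 (hwU n) m hn).1, m.zero_le⟩)
  obtain ⟨t, ht⟩ := exists_support hW π h1 h2 (x 0) zs
  have hmem : ∀ n hn, jn n hn ∈ t := by
    intro n hn
    by_contra hj
    have h3 : P (jn n hn) (x 0) zs = 0 := by
      conv_lhs => rw [ht]
      rw [map_sum]
      exact Finset.sum_eq_zero fun i hi => hP2 i _ _ _ fun hij => hj (hij ▸ hi)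
    have h4 : ∀ i ∈ Finset.range n, P (jn n hn) (x 0) (z i) = 0 := fun i hi => by
      by_cases hi' : i ∈ I
      · rw [← hPk _ i 0 ((W (jn i hi')).incl.1 _ (yn i hi')) (z i) ((hw1 i hi').symm.trans
          (hz i).symm)]
        exact hP2 _ _ _ _ (hinj i hi' n hn (Finset.mem_range.1 hi))
      · have : z i = 0 := ambient_inj _ (by
          rw [hz, map_zero]; exact dif_neg hi')
        rw [this, map_zero]
    have h5 : P (jn n hn) (x 0) (z n) = w n := by
      rw [← hPk _ n 0 ((W (jn n hn)).incl.1 _ (yn n hn)) (z n) ((hw1 n hn).symm.trans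
        (hz n).symm), hP1, hw1 n hn]
    have h6 : P (jn n hn) (x 0) (zs - ∑ i ∈ Finset.range (n + 1), z i) = -w n := by
      rw [map_sub, map_sum, h3, Finset.sum_range_succ, Finset.sum_eq_zero h4, h5, zero_add,
        zero_sub]
    have h7 : ambient U (x 0) (zs - ∑ i ∈ Finset.range (n + 1), z i) ∈ U (x (n + 1)) := by
      refine (hU _ _).2 fun m hm => ⟨((hU 0 _).1 (ambient_mem _) m hm).1, ?_⟩
      by_contra! hmn
      refine hm ?_
      rw [map_sub, map_sum, hzs, Pi.sub_apply, Finset.sum_apply, sub_eq_zero]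
      simp only [hz]
      refine Finset.sum_subset (Finset.range_mono hmn) fun i _ hi => ?_
      by_contra h8
      have := ((hU i _).1 (hwU i) m h8).2
      exact hi (Finset.mem_range.2 (by omega))
    obtain ⟨y, hy⟩ := exists_ambient h7
    have h8 := h6.symm.trans (hPk (jn n hn) (n + 1) 0 y _ hy).symm
    have h9 : w n n = 0 := by
      by_contra h9
      have h10 : P (jn n hn) (x (n + 1)) y n ≠ 0 := by
        rw [← h8, Pi.neg_apply]; exact neg_ne_zero.2 h9
      have := ((hU (n + 1) _).1 (subAmbient_mem _) n h10).2
      omega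
    rw [hw1 n hn, hyn] at h9
    exact one_ne_zero h9
  have := hI.to_subtype
  exact not_injective_infinite_finite (fun n : I => (⟨jn n n.2, hmem n n.2⟩ : t))
    fun m n hmn => by
      have hmn := congrArg Subtype.val hmn
      rcases lt_trichotomy m.1 n.1 with hlt | heq | hlt
      · exact absurd hmn (hinj _ _ _ _ hlt)
      · exact Subtype.ext heq
      · exact absurd hmn.symm (hinj _ _ _ _ hlt)

theorem eventuallyOutward (h : KSUniqueType F Q) : Q.EventuallyOutward := by
  intro j
  by_contra hI
  have hlen : ∀ k : ℕ, (k : ℕ∞) < j.len := fun k => by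
    obtain ⟨m, ⟨hm, -⟩, hkm⟩ := Set.Infinite.exists_gt hI k
    exact lt_trans (by exact_mod_cast hkm) hm
  exact h.not_inward_ray (x := j.vert) (ar := fun k => j.edge k (hlen k)) hI
    (fun m n hmn => j.inj m n (hlen m).le (hlen n).le hmn) (fun k hk => hk.2)
    fun k hk => (j.adj k (hlen k)).resolve_right fun h => hk ⟨hlen k, h⟩

end KSUniqueType

namespace Subquiv

variable {Q : Quiv} {S : Subquiv Q}

/-- A vertex of a subquiver. -/
def vertex {v : Q.V} (h : v ∈ S.verts) : S.toQuiv.V := ⟨v, h⟩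

/-- An arrow of a subquiver. -/
def arrow {a : Q.A} (h : a ∈ S.arrows) : S.toQuiv.A := ⟨a, h⟩

end Subquiv

namespace QRep

open Subquiv

variable {F : Type} [Field F] {Q : Quiv} {S : Subquiv Q}

/-- The vertex spaces of a representation of a subquiver extended by zero, with a line added at one
vertex. -/
abbrev ExtSpace (X : QRep F S.toQuiv) (e v : Q.V) : Type :=
  (∀ h : PLift (v ∈ S.verts), X.M (vertex h.down)) × (PLift (v = e) → F)

variable {X : QRep F S.toQuiv} {e : Q.V}

namespace ExtSpace

/-- The projection to the space of the original representation. -/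
def prS {v : Q.V} (h : v ∈ S.verts) : ExtSpace X e v →ₗ[F] X.M (vertex h) :=
  LinearMap.proj (φ := fun h : PLift (v ∈ S.verts) => X.M (vertex h.down)) ⟨h⟩ ∘ₗ LinearMap.fst F _ _

/-- The inclusion of the space of the original representation. -/
def inS {v : Q.V} (h : v ∈ S.verts) : X.M (vertex h) →ₗ[F] ExtSpace X e v :=
  LinearMap.inl F _ _ ∘ₗ
    LinearMap.pi (φ := fun h : PLift (v ∈ S.verts) => X.M (vertex h.down)) fun _ => LinearMap.id

/-- The projection to the added line. -/
def prE : ExtSpace X e e →ₗ[F] F := LinearMap.proj ⟨rfl⟩ ∘ₗ LinearMap.snd F _ _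

/-- The inclusion of the added line. -/
def inE : F →ₗ[F] ExtSpace X e e := LinearMap.inr F _ _ ∘ₗ LinearMap.pi fun _ => LinearMap.id

theorem ext {v : Q.V} {y z : ExtSpace X e v} (h1 : ∀ h : v ∈ S.verts, prS h y = prS h z)
    (h2 : ∀ h : v = e, y.2 ⟨h⟩ = z.2 ⟨h⟩) : y = z :=
  Prod.ext (funext fun h => h1 h.down) (funext fun h => h2 h.down)

theorem prS_inj (he : e ∉ S.verts) {v : Q.V} (h : v ∈ S.verts) {y z : ExtSpace X e v} (hyz : prS h y = prS h z) :
    y = z :=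
  ext (fun _ => hyz) fun h1 => absurd h (h1 ▸ he)

theorem inS_prS (he : e ∉ S.verts) {v : Q.V} (h : v ∈ S.verts) (y : ExtSpace X e v) : inS h (prS h y) = y :=
  prS_inj he h rfl

theorem inE_prE (he : e ∉ S.verts) (y : ExtSpace X e e) : inE (prE y) = y :=
  ext (fun h => absurd h he) fun _ => rfl

theorem finrank_S (he : e ∉ S.verts) {v : Q.V} (h : v ∈ S.verts) :
    Module.finrank F (ExtSpace X e v) = Module.finrank F (X.M (vertex h)) :=
  (LinearEquiv.ofLinearMap (prS h) (inS h) (LinearMap.ext fun _ => rfl)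
    (LinearMap.ext fun y => inS_prS he h y)).finrank_eq

theorem finrank_E (he : e ∉ S.verts) : Module.finrank F (ExtSpace X e e) = 1 :=
  ((LinearEquiv.ofLinearMap prE inE (LinearMap.ext fun _ => rfl)
    (LinearMap.ext fun y => inE_prE he y)).finrank_eq).trans (Module.finrank_self F)

end ExtSpace

open ExtSpace

open Classical in
/-- The representation obtained from a representation of a subquiver by adding a line at `e` and
letting the arrow `a` act by `θ`. -/
noncomputable def gluedRep (X : QRep F S.toQuiv) (e : Q.V) (a : Q.A)
    (θ : ExtSpace X e (Q.s a) →ₗ[F] ExtSpace X e (Q.t a)) : QRep F Q where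
  M v := ExtSpace X e v
  map b := if hb : b ∈ S.arrows then
      inS (S.tgt_mem b hb) ∘ₗ X.map (arrow hb) ∘ₗ prS (S.src_mem b hb)
    else if hba : b = a then hba ▸ θ else 0

variable {a : Q.A} {θ θ' : ExtSpace X e (Q.s a) →ₗ[F] ExtSpace X e (Q.t a)}

theorem gluedRep_map {b : Q.A} (hb : b ∈ S.arrows) (y : ExtSpace X e (Q.s b)) :
    (gluedRep X e a θ).map b y = inS (S.tgt_mem b hb) (X.map (arrow hb) (prS (S.src_mem b hb) y)) := by
  have : (gluedRep X e a θ).map b =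
    inS (S.tgt_mem b hb) ∘ₗ X.map (arrow hb) ∘ₗ prS (S.src_mem b hb) := dif_pos hb
  rw [this]; rfl

theorem gluedRep_map_self (ha : a ∉ S.arrows) : (gluedRep X e a θ).map a = θ :=
  (dif_neg ha).trans (dif_pos rfl)

theorem exists_scalars (he : e ∉ S.verts) (hX : ∀ g : Mor X X, ∃ c : F, ∀ p x, g.1 p x = c • x)
    (f : Mor (gluedRep X e a θ) (gluedRep X e a θ')) :
    ∃ c d : F, (∀ v ∈ S.verts, ∀ y : ExtSpace X e v, f.1 v y = (c • y : ExtSpace X e v)) ∧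
      ∀ y : ExtSpace X e e, f.1 e y = (d • y : ExtSpace X e e) := by
  let φ : ∀ v, ExtSpace X e v →ₗ[F] ExtSpace X e v := fun v => f.1 v
  let g : ∀ p, X.M p →ₗ[F] X.M p := fun p => prS p.2 ∘ₗ φ p.1 ∘ₗ inS p.2
  have hg : g ∈ HomS X X := mem_HomS.2 fun b x => by
    have h1 : (gluedRep X e a θ').map b.1 (φ _ (inS (S.src_mem _ b.2) x)) =
      φ _ ((gluedRep X e a θ).map b.1 (inS (S.src_mem _ b.2) x)) := f.comm b.1 _
    rw [gluedRep_map b.2, gluedRep_map b.2] at h1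
    exact congrArg (prS (S.tgt_mem _ b.2)) h1
  obtain ⟨c, hc⟩ := hX ⟨g, hg⟩
  refine ⟨c, prE (φ e (inE 1)), fun v hv y => ?_, fun y => ?_⟩
  · refine prS_inj he hv ?_
    rw [map_smul]
    refine .trans ?_ (hc (vertex hv) (prS hv y))
    change prS hv (φ v y) = prS hv (φ v (inS hv (prS hv y)))
    rw [inS_prS he hv]
  · change φ e y = _
    have h1 : y = prE y • inE 1 := by
      conv_lhs => rw [← inE_prE he y, ← mul_one (prE y), ← smul_eq_mul, map_smul]
    conv_lhs => rw [h1, map_smul, ← inE_prE he (φ e (inE 1))]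
    conv_rhs => rw [h1]
    rw [← mul_one (prE (φ e (inE 1))), ← smul_eq_mul, map_smul, smul_comm, smul_eq_mul, mul_one]

end QRep

namespace QRep

open Subquiv ExtSpace

variable {F : Type} [Field F] {Q : Quiv} {S : Subquiv Q} {X : QRep F S.toQuiv} {e : Q.V} {a : Q.A}
  {θ θ' : ExtSpace X e (Q.s a) →ₗ[F] ExtSpace X e (Q.t a)}

theorem exists_scalars_rel (he : e ∉ S.verts)
    (hX : ∀ g : Mor X X, ∃ c : F, ∀ p x, g.1 p x = c • x)
    (ha : Q.s a ∈ S.verts ∧ Q.t a = e ∨ Q.s a = e ∧ Q.t a ∈ S.verts)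
    (f : Mor (gluedRep X e a θ) (gluedRep X e a θ')) :
    ∃ c d : F, (∀ v ∈ S.verts, ∀ y : ExtSpace X e v, f.1 v y = (c • y : ExtSpace X e v)) ∧
      (∀ y : ExtSpace X e e, f.1 e y = (d • y : ExtSpace X e e)) ∧
      (c • θ' = d • θ ∨ d • θ' = c • θ) := by
  obtain ⟨c, d, hc, hd⟩ := exists_scalars he hX f
  have haS : a ∉ S.arrows := fun h => by
    rcases ha with ⟨-, rfl⟩ | ⟨rfl, -⟩
    · exact he (S.tgt_mem a h)
    · exact he (S.src_mem a h)
  have hcomm : ∀ y : ExtSpace X e (Q.s a), θ' (f.1 (Q.s a) y) = f.1 (Q.t a) (θ y) := fun y => by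
    have h1 := f.comm a y
    rw [gluedRep_map_self haS, gluedRep_map_self haS] at h1
    exact h1
  refine ⟨c, d, hc, hd, ?_⟩
  rcases ha with ⟨h1, rfl⟩ | ⟨rfl, h1⟩
  · refine Or.inl (LinearMap.ext fun y => ?_)
    have h2 := hcomm y
    rw [hc _ h1] at h2
    rw [LinearMap.smul_apply, ← map_smul]
    exact h2.trans (hd _)
  · refine Or.inr (LinearMap.ext fun y => ?_)
    have h2 := hcomm y
    rw [hd] at h2
    rw [LinearMap.smul_apply, ← map_smul]
    exact h2.trans (hc _ h1 _)

theorem gluedRep_indec (he : e ∉ S.verts)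
    (hX : ∀ g : Mor X X, ∃ c : F, ∀ p x, g.1 p x = c • x)
    (ha : Q.s a ∈ S.verts ∧ Q.t a = e ∨ Q.s a = e ∧ Q.t a ∈ S.verts) (h0 : X.Nonzero)
    (hθ : θ ≠ 0) : (gluedRep X e a θ).Indec := by
  obtain ⟨p, x, hx⟩ := h0
  have hx' : inS (e := e) p.2 x ≠ 0 := fun h => hx (congrArg (prS p.2) h)
  refine indec_iff.2 ⟨⟨p.1, inS p.2 x, hx'⟩, fun f hf => ?_⟩
  obtain ⟨c, d, hc, hd, h⟩ := exists_scalars_rel he hX ha f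
  have hcd : c = d := by
    rcases h with h | h
    · exact smul_left_injective F hθ h
    · exact (smul_left_injective F hθ h).symm
  subst hcd
  have hcc : c = 0 ∨ c = 1 := by
    have h1 : f.1 p.1 (f.1 p.1 (inS p.2 x)) = f.1 p.1 (inS p.2 x) :=
      congrArg (fun g : Mor (gluedRep X e a θ) (gluedRep X e a θ) => g.1 p.1 (inS p.2 x)) hf
    rw [hc _ p.2] at h1
    have h2 : (c • c • inS (e := e) p.2 x) = c • inS p.2 x := (hc _ p.2 _).symm.trans h1
    rw [smul_smul] at h2
    have h3 : c * c = c := smul_left_injective F hx' h2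
    exact IsIdempotentElem.iff_eq_zero_or_one.1 h3
  have hall : ∀ v (y : ExtSpace X e v), f.1 v y = (c • y : ExtSpace X e v) := fun v y => by
    by_cases hv : v ∈ S.verts
    · exact hc v hv y
    · by_cases hve : v = e
      · subst hve; exact hd y
      · exact ExtSpace.ext (fun h => absurd h hv) fun h => absurd h hve
  rcases hcc with rfl | rfl
  · exact Or.inl (Mor.ext' fun v y => (hall v y).trans (zero_smul F (y : ExtSpace X e v)))
  · exact Or.inr (Mor.ext' fun v y => (hall v y).trans (one_smul F (y : ExtSpace X e v)))

theorem not_iso_gluedRep (he : e ∉ S.verts)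
    (hX : ∀ g : Mor X X, ∃ c : F, ∀ p x, g.1 p x = c • x)
    (ha : Q.s a ∈ S.verts ∧ Q.t a = e ∨ Q.s a = e ∧ Q.t a ∈ S.verts) (h0 : X.Nonzero)
    (h : LinearIndependent F ![θ, θ']) :
    ¬ Iso (gluedRep X e a θ) (gluedRep X e a θ') := fun hi => by
  obtain ⟨f, hf⟩ := iso_iff.1 hi
  obtain ⟨p, x, hx⟩ := h0
  have hx' : inS (e := e) p.2 x ≠ 0 := fun h => hx (congrArg (prS p.2) h)
  obtain ⟨c, d, hc, hd, h1⟩ := exists_scalars_rel he hX ha f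
  have hc0 : c = 0 := by
    rcases h1 with h1 | h1
    · exact (LinearIndependent.pair_iff.1 h (-d) c (by rw [h1, neg_smul, neg_add_cancel])).2
    · exact (LinearIndependent.pair_iff.1 h c (-d) (by rw [← h1, neg_smul, add_neg_cancel])).1
  refine hx' ((hf p.1).1 ?_)
  refine (hc _ p.2 _).trans ?_
  rw [hc0, zero_smul]
  exact ((f.1 p.1).map_zero).symm

end QRep

/-- Gluing a line to a brick of a subquiver at a vertex of dimension at least two yields
nonisomorphic indecomposables of the same dimension. -/
theorem KSUniqueType.not_glue {F : Type} [Field F] {Q : Quiv} (h : KSUniqueType F Q)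
    {S : Subquiv Q} {X : QRep F S.toQuiv} {e : Q.V} {a : Q.A} (he : e ∉ S.verts)
    (hX : ∀ g : QRep.Mor X X, ∃ c : F, ∀ p x, g.1 p x = c • x) {p : S.toQuiv.V}
    (hp : 2 ≤ Module.finrank F (X.M p)) :
    ¬ (Q.s a = p.1 ∧ Q.t a = e ∨ Q.s a = e ∧ Q.t a = p.1) := fun ha => by
  have h0 : X.Nonzero := by
    by_contra hn
    have : Subsingleton (X.M p) := ⟨fun x y => by
      simp only [QRep.Nonzero, not_exists, not_not] at hn
      rw [hn p x, hn p y]⟩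
    rw [Module.finrank_zero_of_subsingleton] at hp
    omega
  have ha' : Q.s a ∈ S.verts ∧ Q.t a = e ∨ Q.s a = e ∧ Q.t a ∈ S.verts := by
    rcases ha with ⟨h1, h2⟩ | ⟨h1, h2⟩
    · exact Or.inl ⟨h1 ▸ p.2, h2⟩
    · exact Or.inr ⟨h1, h2 ▸ p.2⟩
  have hr : 1 < Module.finrank F (QRep.ExtSpace X e (Q.s a) →ₗ[F] QRep.ExtSpace X e (Q.t a)) := by
    obtain ⟨v, hv⟩ := p
    have hE := QRep.ExtSpace.finrank_E (X := X) he
    have hS := QRep.ExtSpace.finrank_S (X := X) he hv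
    have : Module.Finite F (QRep.ExtSpace X e e) :=
      Module.finite_of_finrank_pos (by rw [hE]; exact one_pos)
    have h2 : 2 ≤ Module.finrank F (QRep.ExtSpace X e v) := by rw [hS]; exact hp
    have : Module.Finite F (QRep.ExtSpace X e v) := Module.finite_of_finrank_pos (by omega)
    rcases ha with ⟨h3, h4⟩ | ⟨h3, h4⟩
    · change Q.s a = v at h3
      rw [h3, h4, Module.finrank_linearMap, hE]
      omega
    · change Q.t a = v at h4
      rw [h3, h4, Module.finrank_linearMap, hE]
      omega
  obtain ⟨θ, hθ⟩ : ∃ θ : QRep.ExtSpace X e (Q.s a) →ₗ[F] QRep.ExtSpace X e (Q.t a), θ ≠ 0 := by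
    have := Module.nontrivial_of_finrank_pos (R := F) (zero_lt_one.trans hr)
    exact exists_ne 0
  obtain ⟨θ', hθ'⟩ := exists_linearIndependent_pair_of_one_lt_finrank hr hθ
  exact QRep.not_iso_gluedRep he hX ha' h0 hθ' (h.2.2 _ _
    (QRep.gluedRep_indec he hX ha' h0 hθ)
    (QRep.gluedRep_indec he hX ha' h0 (hθ'.ne_zero 1)) fun _ => rfl)

/-- A finite quiver, without rays. -/
def RayData.ofFintype (Q : Quiv) [Fintype Q.V] [Fintype Q.A] : RayData Q where
  T := Finset.univ
  B := Finset.univ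
  ι := Empty
  ra i := i.elim
  srcB _ _ := Finset.mem_univ _
  tgtB _ _ := Finset.mem_univ _
  src0 i := i.elim
  src_succ i := i.elim
  tgt_notin i := i.elim
  tgt_inj i := i.elim
  coverV v := Or.inl (Finset.mem_univ v)
  coverA a := Or.inl (Finset.mem_univ a)

namespace RTree

variable {Q : Quiv} {T : RTree Q}

/-- The subquiver of edges to parents on a set of vertices closed under taking parents. -/
def below (T : RTree Q) (X : Finset Q.V) (hX : ∀ v ∈ X, T.par v ∈ X) : Subquiv Q where
  verts := {v | v ∈ X}
  arrows := {a | ∃ v h, v ∈ X ∧ T.arr v h = a}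
  src_mem := by
    rintro _ ⟨v, h, hv, rfl⟩
    rcases T.joins v h with ⟨h1, -⟩ | ⟨h1, -⟩
    · rw [h1]; exact hv
    · rw [h1]; exact hX v hv
  tgt_mem := by
    rintro _ ⟨v, h, hv, rfl⟩
    rcases T.joins v h with ⟨-, h1⟩ | ⟨-, h1⟩
    · rw [h1]; exact hX v hv
    · rw [h1]; exact hv

theorem finite_below {X : Finset Q.V} {hX : ∀ v ∈ X, T.par v ∈ X} :
    Finite (T.below X hX).toQuiv.V ∧ Finite (T.below X hX).toQuiv.A := by
  have h1 : Finite X := inferInstance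
  refine ⟨inferInstanceAs (Finite X), Set.Finite.to_subtype ?_⟩
  classical
  refine (Set.finite_range fun v : X => if h : v.1 ≠ T.r then some (T.arr v.1 h) else none).preimage
    (f := fun a : Q.A => some a) ((Option.some_injective _).injOn) |>.subset ?_
  rintro _ ⟨v, h, hv, rfl⟩
  exact ⟨⟨v, hv⟩, dif_pos h⟩

theorem form_below {X : Finset Q.V} {hX : ∀ v ∈ X, T.par v ∈ X} [Fintype (T.below X hX).toQuiv.V]
    [Fintype (T.below X hX).toQuiv.A] (hr : T.r ∈ X) (n : Q.V → ℤ) :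
    (RayData.ofFintype (T.below X hX).toQuiv).form (fun p => n p.1) (fun p => n p.1) =
      n T.r ^ 2 + ∑ v ∈ X, n v * (n v - n (T.par v)) := by
  classical
  let Y : Finset Q.A := (Finset.univ : Finset (T.below X hX).toQuiv.A).image Subtype.val
  have hY : ∀ a, a ∈ Y ↔ a ∈ (T.below X hX).arrows := fun a => by
    refine Finset.mem_image.trans ⟨?_, fun h => ⟨⟨a, h⟩, Finset.mem_univ (α := (T.below X hX).toQuiv.A) _, rfl⟩⟩
    rintro ⟨b, -, rfl⟩
    exact b.2
  rw [← T.form_eq n X Y hr hY]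
  have h1 := Finset.sum_subtype (F := ‹_›) X (p := fun v => v ∈ (T.below X hX).verts)
    (fun _ => Iff.rfl) fun v => n v * n v
  have h2 := Finset.sum_subtype (F := ‹_›) Y hY fun a => n (Q.s a) * n (Q.t a)
  rw [h1, h2]
  rfl

namespace Arms

variable {A : T.Arms}

theorem exists_values {m : Fin 3 → ℕ} (hm : ∀ i, A.al i (m i)) {f : Fin 3 → ℕ → ℤ} {c : ℤ}
    (h0 : ∀ i, f i 0 = c) :
    ∃ n : Q.V → ℤ, ((∀ i k, 0 ≤ f i k) → ∀ v, 0 ≤ n v) ∧ ∀ i k, k ≤ m i → n (A.x i k) = f i k := by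
  classical
  refine ⟨fun v => if h : ∃ p : Fin 3 × ℕ, p.2 ≤ m p.1 ∧ A.x p.1 p.2 = v then
    f h.choose.1 h.choose.2 else 0, fun hf v => ?_, fun i k hk => ?_⟩
  · dsimp only
    split_ifs
    · exact hf _ _
    · exact le_rfl
  · have h : ∃ p : Fin 3 × ℕ, p.2 ≤ m p.1 ∧ A.x p.1 p.2 = A.x i k := ⟨(i, k), hk, rfl⟩
    dsimp only
    rw [dif_pos h]
    obtain ⟨h1, h2⟩ := h.choose_spec
    generalize h.choose = p at h1 h2
    obtain ⟨j, l⟩ := p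
    dsimp only at h1 h2 ⊢
    have h3 : l = k := by
      rw [← d_x (al_of_le (hm j) h1), h2, d_x (al_of_le (hm i) hk)]
    subst h3
    rcases l with _ | l
    · rw [h0, h0]
    · rw [(x_inj (al_of_le (hm j) h1) (al_of_le (hm i) hk) h2).1]

theorem not_extended {F : Type} [Field F] (h : KSUniqueType F Q) {m : Fin 3 → ℕ}
    (hm : ∀ i, A.al i (m i)) (hm' : 1 < ∑ i, (1 : ℚ) / (m i + 1)) {f : Fin 3 → ℕ → ℤ} {c : ℤ}
    (h0 : ∀ i, f i 0 = c) (hf : ∀ i k, 0 ≤ f i k) (hq : c ^ 2 + ∑ i, armForm (m i) (f i) = 1)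
    {i : Fin 3} {k : ℕ} (hk : k ≤ m i) (hik : 2 ≤ f i k) {e : Q.V} (he : e ∉ A.fin m) {a : Q.A} :
    ¬ (Q.s a = A.x i k ∧ Q.t a = e ∨ Q.s a = e ∧ Q.t a = A.x i k) := by
  classical
  obtain ⟨hV, hA⟩ := finite_below (T := T) (X := A.fin m) (hX := fun v => par_mem_fin hm)
  set S := T.below (A.fin m) (fun v => par_mem_fin hm) with hS
  have := Fintype.ofFinite S.toQuiv.V
  have := Fintype.ofFinite S.toQuiv.A
  have hr : T.r ∈ A.fin m := mem_fin.2 (Or.inl rfl)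
  have hform : ∀ n : Q.V → ℤ, (RayData.ofFintype S.toQuiv).form (fun p => n p.1) (fun p => n p.1) =
      n T.r ^ 2 + ∑ i, armForm (m i) fun k => n (A.x i k) := fun n => by
    rw [← sum_fin hm]
    exact form_below hr n
  have hPD : (RayData.ofFintype S.toQuiv).PD := fun n ⟨p, _, hp⟩ => by
    have h1 := hform fun v => if h : v ∈ S.verts then n ⟨v, h⟩ else 0
    have h2 : (fun p : S.toQuiv.V => if h : p.1 ∈ S.verts then n ⟨p.1, h⟩ else 0) = n :=
      funext fun p => dif_pos p.2
    rw [h2] at h1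
    rw [h1]
    refine star_pos hm' (fun i => by rw [A.x_zero]) ?_
    obtain ⟨i, k, hk, hx⟩ := mem_fin'.1 p.2
    refine ⟨i, k, hk, ?_⟩
    rw [hx, dif_pos p.2]
    exact hp
  obtain ⟨n, hn0, hn⟩ := exists_values hm h0
  have hnr : n T.r = c := by rw [← A.x_zero 0, hn 0 0 (Nat.zero_le _), h0]
  obtain ⟨X, hX, hXi, hXn⟩ := RayData.exists_indec F hPD (fun p => n p.1) (fun p => hn0 hf _)
    (fun i => i.elim) (by
      rw [hform, hnr, ← hq]
      congr 1
      refine Finset.sum_congr rfl fun i _ => Finset.sum_congr rfl fun k hk => ?_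
      dsimp only
      rw [hn i _ (Finset.mem_range.1 hk), hn i _ (Finset.mem_range.1 hk).le])
  have hp : A.x i k ∈ S.verts := mem_fin'.2 ⟨i, k, hk, rfl⟩
  refine h.not_glue (S := S) (X := X) (p := ⟨A.x i k, hp⟩) (fun h => he h) (fun g => ?_) ?_
  · obtain ⟨c, rfl⟩ := RayData.Indec.scalar hPD hX hXi g
    exact ⟨c, fun p x => rfl⟩
  · have h1 := congrFun hXn ⟨A.x i k, hp⟩
    have h2 := hn i k hk
    change (Module.finrank F (X.M _) : ℤ) = n (A.x i k) at h1
    omega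

end Arms

end RTree

namespace RTree

variable {Q : Quiv} {T : RTree Q}

theorem eq_r_of_d {v : Q.V} (h : T.d v = 0) : v = T.r := by
  by_contra hv
  have := T.d_par v hv
  omega

theorem d_iterate (k : ℕ) (v : Q.V) : T.d (T.par^[k] v) = T.d v - k := by
  induction k with
  | zero => rfl
  | succ k ih =>
    rw [Function.iterate_succ_apply']
    by_cases h : T.par^[k] v = T.r
    · rw [h, T.d_r] at ih
      rw [h, T.par_r, T.d_r]
      omega
    · have := T.d_par _ h
      omega

namespace Arms

/-- Reordering of the arms. -/
def perm (A : T.Arms) (σ : Equiv.Perm (Fin 3)) : T.Arms where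
  x i := A.x (σ i)
  al i := A.al (σ i)
  x_zero _ := A.x_zero _
  al_zero _ := A.al_zero _
  al_of_succ _ := A.al_of_succ _
  child _ := A.child _
  inj _ _ hi hj h := σ.injective (A.inj _ _ hi hj h)

variable {A : T.Arms}

theorem x_succ_notMem {m : Fin 3 → ℕ} (hm : ∀ i, A.al i (m i)) {i : Fin 3}
    (hi : A.al i (m i + 1)) : A.x i (m i + 1) ∉ A.fin m := fun h => by
  rcases mem_fin.1 h with h | ⟨j, k, hk, h⟩
  · exact x_ne_r hi h
  · obtain ⟨rfl, rfl⟩ := x_inj (al_of_le (hm j) hk) hi h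
    exact lt_irrefl _ hk

theorem not_al_succ {F : Type} [Field F] (h : KSUniqueType F Q) {m : Fin 3 → ℕ}
    (hm : ∀ i, A.al i (m i)) (hm' : 1 < ∑ i, (1 : ℚ) / (m i + 1)) {c : ℕ} {s : Fin 3 → ℕ}
    (hq : (c : ℤ) ^ 2 + ∑ i, armForm (m i) (fun k => ((c - s i * k : ℕ) : ℤ)) = 1)
    {i : Fin 3} (hik : 2 ≤ c - s i * m i) : ¬ A.al i (m i + 1) := fun hi => by
  obtain ⟨a, ha⟩ := (A.child i _ hi).adj
  exact not_extended h hm hm' (f := fun i k => ((c - s i * k : ℕ) : ℤ)) (c := c)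
    (fun i => by rw [mul_zero]; rfl) (fun i k => Int.natCast_nonneg _) hq le_rfl
    (by exact_mod_cast hik) (x_succ_notMem hm hi) ha

theorem sum_gt_of_monotone {F : Type} [Field F] (h : KSUniqueType F Q) {m : Fin 3 → ℕ}
    (hm : ∀ i, A.al i (m i)) (h01 : m 0 ≤ m 1) (h12 : m 1 ≤ m 2) :
    1 < ∑ i, (1 : ℚ) / (m i + 1) := by
  rw [Fin.sum_univ_three]
  have h2 : (0 : ℚ) < 1 / (m 2 + 1) := by positivity
  have hal : ∀ i k, k ≤ m i → A.al i k := fun i k hk => al_of_le (hm i) hk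
  rcases Nat.lt_or_ge 1 (m 0) with h0 | h0
  · refine absurd (hal 0 2 h0) (not_al_succ h (m := ![1, 2, 2]) (c := 3) (s := ![1, 1, 1]) (i := 0)
      ?_ ?_ ?_ ?_)
    · exact Fin.forall_fin_succ.2 ⟨hal _ _ (by change 1 ≤ m 0; omega), Fin.forall_fin_two.2
        ⟨hal _ _ (by change 2 ≤ m 1; omega), hal _ _ (by change 2 ≤ m 2; omega)⟩⟩
    · simp [Fin.sum_univ_three]; norm_num
    · decide
    · decide
  interval_cases h0' : m 0
  · have h1 : (0 : ℚ) < 1 / (m 1 + 1) := by positivity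
    rw [Nat.cast_zero, zero_add, div_one]
    linarith
  rcases Nat.lt_or_ge 2 (m 1) with h1 | h1
  · refine absurd (hal 1 3 h1) (not_al_succ h (m := ![1, 2, 3]) (c := 4) (s := ![2, 1, 1]) (i := 1)
      ?_ ?_ ?_ ?_)
    · exact Fin.forall_fin_succ.2 ⟨hal _ _ (by change 1 ≤ m 0; omega), Fin.forall_fin_two.2
        ⟨hal _ _ (by change 2 ≤ m 1; omega), hal _ _ (by change 3 ≤ m 2; omega)⟩⟩
    · simp [Fin.sum_univ_three]; norm_num
    · decide
    · decide
  interval_cases h1' : m 1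
  · norm_num at h2 ⊢
    linarith
  rcases Nat.lt_or_ge 4 (m 2) with h3 | h3
  · refine absurd (hal 2 5 h3) (not_al_succ h (m := ![1, 2, 4]) (c := 6) (s := ![3, 2, 1]) (i := 2)
      ?_ ?_ ?_ ?_)
    · exact Fin.forall_fin_succ.2 ⟨hal _ _ (by change 1 ≤ m 0; omega), Fin.forall_fin_two.2
        ⟨hal _ _ (by change 2 ≤ m 1; omega), hal _ _ (by change 4 ≤ m 2; omega)⟩⟩
    · simp [Fin.sum_univ_three]; norm_num
    · decide
    · decide
  interval_cases m 2 <;> norm_num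

theorem sum_gt {F : Type} [Field F] (h : KSUniqueType F Q) {m : Fin 3 → ℕ}
    (hm : ∀ i, A.al i (m i)) : 1 < ∑ i, (1 : ℚ) / (m i + 1) := by
  have hσ := Tuple.monotone_sort m
  rw [← Equiv.sum_comp (Tuple.sort m)]
  exact sum_gt_of_monotone (A := A.perm (Tuple.sort m)) (m := m ∘ Tuple.sort m) h (fun i => hm _)
    (hσ (by decide)) (hσ (by decide))

end Arms

theorem not_bad_of_ksUniqueType {F : Type} [Field F] (h : KSUniqueType F Q) : ¬ T.Bad := by
  rintro ⟨w1, w2, u, u1, u2, hw, hu, hw1, hw2, hu1, hu2, ⟨h11, h12, h21, h22⟩, hk⟩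
  obtain ⟨q, hq⟩ : ∃ q, T.d u = q := ⟨_, rfl⟩
  have hd1 : T.d u1 = q + 1 := by rw [hu1.d, hq]
  have hu1i : ∀ k, T.par^[k + 1] u1 = T.par^[k] u := fun k => by
    rw [Function.iterate_succ_apply, hu1.2]
  have hx1 : T.par^[q] u1 ≠ w1 ∧ T.par^[q] u1 ≠ w2 := by
    rcases q with _ | q
    · exact ⟨h11, h12⟩
    · rw [hu1i]; exact hk q
  have hd : ∀ k ≤ q + 1, T.d (T.par^[q + 1 - k] u1) = k := fun k hk => by
    rw [d_iterate, hd1]; omega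
  let x : Fin 3 → ℕ → Q.V := ![fun k => if k = 0 then T.r else w1,
    fun k => if k = 0 then T.r else w2, fun k => T.par^[q + 1 - k] u1]
  let m : Fin 3 → ℕ := ![1, 1, q + 1]
  have hx0 : ∀ i, x i 0 = T.r :=
    Fin.forall_fin_succ.2 ⟨rfl, Fin.forall_fin_two.2 ⟨rfl, eq_r_of_d (hd 0 (Nat.zero_le _))⟩⟩
  have hchild : ∀ i k, k + 1 ≤ m i → T.Child (x i (k + 1)) (x i k) := by
    refine Fin.forall_fin_succ.2 ⟨fun k hk => ?_, Fin.forall_fin_two.2 ⟨fun k hk => ?_,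
      fun k hk => ?_⟩⟩
    · obtain rfl : k = 0 := Nat.le_zero.1 (Nat.succ_le_succ_iff.1 hk)
      exact hw1
    · obtain rfl : k = 0 := Nat.le_zero.1 (Nat.succ_le_succ_iff.1 hk)
      exact hw2
    · change k + 1 ≤ q + 1 at hk
      refine ⟨fun h => ?_, ?_⟩
      · have h1 := hd (k + 1) hk
        change T.par^[q + 1 - (k + 1)] u1 = T.r at h
        rw [h, T.d_r] at h1
        omega
      · change T.par (T.par^[q + 1 - (k + 1)] u1) = T.par^[q + 1 - k] u1
        rw [← Function.iterate_succ_apply' T.par]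
        congr 2
        omega
  have hinj : Function.Injective fun i => x i 1 := by
    have h01 : x 0 1 ≠ x 1 1 := hw
    have h02 : x 0 1 ≠ x 2 1 := hx1.1.symm
    have h12 : x 1 1 ≠ x 2 1 := hx1.2.symm
    intro i j h
    fin_cases i <;> fin_cases j
    exacts [rfl, absurd h h01, absurd h h02, absurd h h01.symm, rfl, absurd h h12,
      absurd h h02.symm, absurd h h12.symm, rfl]
  let A : T.Arms :=
    { x := x
      al := fun i k => k ≤ m i
      x_zero := hx0
      al_zero := fun i => Nat.zero_le _
      al_of_succ := fun i k h => (Nat.le_succ k).trans h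
      child := hchild
      inj := fun i j _ _ h => hinj h }
  have he : u2 ∉ A.fin m := fun h => by
    rw [Arms.mem_fin] at h
    rcases h with h | ⟨i, k, hk, h⟩
    · exact hu2.1 h
    · revert i
      refine Fin.forall_fin_succ.2 ⟨fun hk h => h21 h.symm, Fin.forall_fin_two.2
        ⟨fun hk h => h22 h.symm, fun hk h => hu ?_⟩⟩
      change k < q + 1 at hk
      change T.par^[q + 1 - (k + 1)] u1 = u2 at h
      have h1 := hd (k + 1) hk
      rw [h, hu2.d, hq] at h1
      obtain rfl : q = k := by omega
      rwa [Nat.sub_self] at h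
  obtain ⟨a, ha⟩ := hu2.adj
  have hxu : A.x 2 q = u := by
    change T.par^[q + 1 - q] u1 = _
    rw [Nat.add_sub_cancel_left, ← hu1.2]
    rfl
  rw [← hxu] at ha
  refine Arms.not_extended (A := A) h (m := m) (fun i => le_rfl) ?_
    (f := ![fun k => if k = 0 then 2 else 1, fun k => if k = 0 then 2 else 1,
      fun k => if k ≤ q then 2 else 1]) (c := 2)
    (Fin.forall_fin_succ.2 ⟨rfl, Fin.forall_fin_two.2 ⟨rfl, show (if 0 ≤ q then (2 : ℤ) else 1) = 2 from
      if_pos (Nat.zero_le q)⟩⟩) ?_ ?_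
    (i := 2) (k := q) (Nat.le_succ q) (show (2 : ℤ) ≤ if q ≤ q then 2 else 1 from
      (if_pos le_rfl).ge) he ha
  · have : (0 : ℚ) < 1 / ((q + 1 : ℕ) + 1) := by positivity
    rw [Fin.sum_univ_three]
    change 1 < 1 / (((1 : ℕ) : ℚ) + 1) + 1 / (((1 : ℕ) : ℚ) + 1) + 1 / (((q + 1 : ℕ) : ℚ) + 1)
    norm_num at this ⊢
    linarith
  · refine Fin.forall_fin_succ.2 ⟨fun k => ?_, Fin.forall_fin_two.2 ⟨fun k => ?_, fun k => ?_⟩⟩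
    all_goals
      change (0 : ℤ) ≤ ite _ _ _
      split_ifs <;> norm_num
  · have h1 : armForm (q + 1) (fun k => if k ≤ q then 2 else 1) = -1 := by
      rw [armForm, Finset.sum_range_succ, Finset.sum_eq_zero fun k hk => ?_]
      · simp
      · have := Finset.mem_range.1 hk
        rw [if_pos (by omega), if_pos (by omega), sub_self, mul_zero]
    have h2 : armForm 1 (fun k => if k = 0 then 2 else 1) = -1 := rfl
    rw [Fin.sum_univ_three]
    change 2 ^ 2 + (armForm 1 (fun k => if k = 0 then 2 else 1) +
      armForm 1 (fun k => if k = 0 then 2 else 1) +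
      armForm (q + 1) (fun k => if k ≤ q then 2 else 1)) = 1
    rw [h1, h2]
    norm_num

end RTree

theorem not_isPosRoot_of_isEmpty {Q : Quiv} [IsEmpty Q.V] (n : Q.V → ℤ) : ¬ IsPosRoot Q n := by
  rintro ⟨-, -, h⟩
  have : IsEmpty Q.A := Function.isEmpty Q.s
  have : Nonempty (FinICSub Q) :=
    ⟨⟨⟨∅, ∅, fun _ h => h.elim, fun _ h => h.elim⟩, ⟨Set.finite_empty, Set.finite_empty⟩,
      fun i => isEmptyElim i⟩⟩
  have : IsDirectedOrder (FinICSub Q) :=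
    ⟨fun S _ => ⟨S, le_rfl, fun v => isEmptyElim v, fun a => isEmptyElim a⟩⟩
  have h0 : titsNet Q n = fun _ => 0 := funext fun S => by
    rw [titsNet, tits, finsum_of_isEmpty, finsum_of_isEmpty]
    simp
  rw [h0] at h
  have h1 := tendsto_nhds_unique tendsto_const_nhds h
  norm_num at h1

theorem ksUniqueType_of_isEmpty (F : Type) [Field F] {Q : Quiv} [IsEmpty Q.V] :
    KSUniqueType F Q := by
  refine ⟨fun V => ⟨Empty, Empty.elim, fun j => j.elim, fun i => isEmptyElim i,
    fun i => isEmptyElim i⟩, fun V J J' W W' hi _ hi' _ => ?_,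
    fun V W hV => isEmptyElim hV.1.choose⟩
  have : IsEmpty J := ⟨fun j => isEmptyElim (α := Q.V) (hi j).1.choose⟩
  have : IsEmpty J' := ⟨fun j => isEmptyElim (α := Q.V) (hi' j).1.choose⟩
  exact ⟨Equiv.equivOfIsEmpty J J', fun j => isEmptyElim j⟩

theorem KSUniqueType.posDefTits {F : Type} [Field F] {Q : Quiv} (h : KSUniqueType F Q)
    (hQ : Q.Connected) (r : Q.V) : PosDefTits Q := by
  obtain ⟨T, hT⟩ := RTree.exists_starShaped hQ r fun T => ⟨h.full T, T.not_bad_of_ksUniqueType h⟩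
  obtain ⟨A, hA⟩ := hT.exists_arms
  exact hA.posDef (h.full T) hQ fun m hm => RTree.Arms.sum_gt h hm

/-- **Gabriel's theorem for infinite quivers.** For a connected quiver
`Ω`: the representation theory of `Ω` is of unique type and infinite Krull–Schmidt iff
`Ω` is eventually outward and its Tits form is positive definite on the root space; and
in that case every indecomposable is FLEI and taking dimension vectors gives a bijection
between isomorphism classes of indecomposables and positive roots. -/
theorem stmt19 (F : Type) [Field F] (Q : Quiv) (hconn : Q.Connected) :
    (KSUniqueType F Q ↔ (Q.EventuallyOutward ∧ PosDefTits Q)) ∧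
    ((Q.EventuallyOutward ∧ PosDefTits Q) →
      (∀ V : QRep F Q, V.Indec → V.IsFLEI) ∧
      (∀ V : QRep F Q, V.Indec → IsPosRoot Q (dimvec F V)) ∧
      (∀ n : Q.V → ℤ, IsPosRoot Q n → ∃ V : QRep F Q, V.Indec ∧ dimvec F V = n) ∧
      (∀ V W : QRep F Q, V.Indec → W.Indec → dimvec F V = dimvec F W → QRep.Iso V W)) := by
  rcases isEmpty_or_nonempty Q.V with hV | ⟨⟨r⟩⟩
  · exact ⟨⟨fun _ => ⟨fun j => isEmptyElim (j.vert 0), fun _ _ ⟨i, _⟩ => isEmptyElim i⟩,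
      fun _ => ksUniqueType_of_isEmpty F⟩, fun _ => ⟨fun V h => isEmptyElim h.1.choose,
      fun V h => isEmptyElim h.1.choose, fun n hn => absurd hn (not_isPosRoot_of_isEmpty n),
      fun V W h => isEmptyElim h.1.choose⟩⟩
  refine ⟨⟨fun h => ⟨h.eventuallyOutward, h.posDefTits hconn r⟩, fun ⟨hEO, hp⟩ => ?_⟩,
    fun ⟨hEO, hp⟩ => ?_⟩
  all_goals
    obtain ⟨T, R, hT, hf⟩ := exists_fits hconn r hEO hp
    have hR : ∀ N, (R.shift N).PD := fun N => (hf.shift N).pd hT hconn hp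
    obtain ⟨f, hh⟩ := hT.exists_height R
  · exact ksUniqueType_of_pd hR f hh
  · have hfl : ∀ V : QRep F Q, V.Indec → V.IsFLEI := fun V => RayData.Indec.flei hR f hh
    exact ⟨hfl, fun V hV => hV.isPosRoot hconn hT hf hR (hfl V hV),
      fun n => exists_indec_of_isPosRoot F hconn hT hf hR,
      fun V W hV hW => hV.iso_of_dimvec hR (hfl V hV) (hfl W hW) hW⟩
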